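/- For every integer n ≥ 1 such that α_min < 2γ − 16/n and every real α with α_min < α < 2γ − 16/n, the Lebesgue measure of the set of irrational x ∈ (0,1) with (2/n)·log q_n(x) ≤ α is at most C_α · e^{−I(α)·n}, where C_α = e^{16(|I'(α)|+1)}. -/

import Mathlib

open Filter MeasureTheory Set

/-- The Gauss map `T x = 1/x - ⌊1/x⌋`. -/
noncomputable def gaussMap (x : ℝ) : ℝ := Int.fract (1 / x)

/-- The `(i+1)`-st continued fraction digit `a_{i+1}(x) = ⌊1 / T^i x⌋`. -/
noncomputable def cfDigit (x : ℝ) (i : ℕ) : ℕ := ⌊1 / (gaussMap^[i] x)⌋₊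

/-- Denominators of the convergents: `q_0 = 1`, `q_1 = a_1`, `q_n = a_n q_{n-1} + q_{n-2}`,
given the digit sequence `a` (indexed so that `a i` is the `(i+1)`-st digit). -/
def contDen (a : ℕ → ℕ) : ℕ → ℕ
  | 0 => 1
  | 1 => a 0
  | (n + 2) => a (n + 1) * contDen a (n + 1) + contDen a n

/-- Numerators of the convergents: `p_0 = 0`, `p_1 = 1`, `p_n = a_n p_{n-1} + p_{n-2}`. -/
def contNum (a : ℕ → ℕ) : ℕ → ℕ
  | 0 => 0
  | 1 => 1
  | (n + 2) => a (n + 1) * contNum a (n + 1) + contNum a n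

/-- `q_n(x)`, the denominator of the `n`-th convergent of `x`. -/
noncomputable def qDen (n : ℕ) (x : ℝ) : ℕ := contDen (cfDigit x) n

/-- The level set `L(α)` of the Lyapunov exponent: irrationals `x ∈ (0,1)` with
`liminf (2/n) log q_n(x) = limsup (2/n) log q_n(x) = α`. -/
noncomputable def levelSet (α : EReal) : Set ℝ :=
  {x | x ∈ Set.Ioo (0 : ℝ) 1 ∧ Irrational x ∧
    Filter.liminf (fun n : ℕ => ((2 / (n : ℝ) * Real.log (qDen n x) : ℝ) : EReal))
      Filter.atTop = α ∧
    Filter.limsup (fun n : ℕ => ((2 / (n : ℝ) * Real.log (qDen n x) : ℝ) : EReal))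
      Filter.atTop = α}

/-- `b(α)`, the Hausdorff dimension of the level set `L(α)`. -/
noncomputable def dimSpec (α : ℝ) : ℝ := (dimH (levelSet (α : EReal))).toReal

/-- The rate function `I(α) = α (1 - b(α))`. -/
noncomputable def rateI (α : ℝ) : ℝ := α * (1 - dimSpec α)

/-- Lévy's constant `γ = π² / (12 log 2)`. -/
noncomputable def levyConst : ℝ := Real.pi ^ 2 / (12 * Real.log 2)

/-- `α_min = log ((√5 + 1)/2)`. -/
noncomputable def alphaMin : ℝ := Real.log ((Real.sqrt 5 + 1) / 2)

namespace ContFrac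

/-- The inverse branch of the iterated Gauss map attached to a word; the letter `a` stands for the
continued fraction digit `a + 1`. -/
noncomputable def mob : List ℕ → ℝ → ℝ
  | [], x => x
  | a :: w, x => 1 / ((a : ℝ) + 1 + mob w x)

/-- The product of the denominators met when evaluating `mob w x`; at `x = 0` it is the denominator
of the convergent with the given word. -/
noncomputable def den : List ℕ → ℝ → ℝ
  | [], _ => 1
  | a :: w, x => ((a : ℝ) + 1 + mob w x) * den w x

/-- The word of the first `n` digits of `x`, each lowered by one. -/
noncomputable def letters : ℕ → ℝ → List ℕ
  | 0, _ => []
  | n + 1, x => (⌊1 / x⌋₊ - 1) :: letters n (gaussMap x)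

/-- Irrational points of the unit interval. -/
def IrrUnit (x : ℝ) : Prop := x ∈ Ioo (0 : ℝ) 1 ∧ Irrational x

lemma mob_nonneg (w : List ℕ) {x : ℝ} (hx : 0 ≤ x) : 0 ≤ mob w x := by
  induction w with
  | nil => exact hx
  | cons a w ih => simp only [mob]; positivity

lemma mob_pos (w : List ℕ) {x : ℝ} (hx : 0 < x) : 0 < mob w x := by
  induction w with
  | nil => exact hx
  | cons a w ih => simp only [mob]; positivity

lemma mob_cons_pos (a : ℕ) (w : List ℕ) {x : ℝ} (hx : 0 ≤ x) : 0 < mob (a :: w) x := by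
  have := mob_nonneg w hx
  simp only [mob]; positivity

lemma mob_cons_lt_one (a : ℕ) (w : List ℕ) {x : ℝ} (hx : 0 < x) : mob (a :: w) x < 1 := by
  have := mob_pos w hx
  simp only [mob]
  rw [div_lt_one (by positivity)]
  have : (0 : ℝ) ≤ a := a.cast_nonneg
  linarith

lemma mob_le_one (w : List ℕ) {x : ℝ} (hx : 0 ≤ x) (hx1 : x ≤ 1) : mob w x ≤ 1 := by
  cases w with
  | nil => exact hx1
  | cons a w =>
    have := mob_nonneg w hx
    simp only [mob]
    rw [div_le_one (by positivity)]
    have : (0 : ℝ) ≤ a := a.cast_nonneg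
    linarith

lemma mob_lt_one (w : List ℕ) {x : ℝ} (hx : 0 < x) (hx1 : x < 1) : mob w x < 1 := by
  cases w with
  | nil => exact hx1
  | cons a w => exact mob_cons_lt_one a w hx

lemma mob_append (u v : List ℕ) (x : ℝ) : mob (u ++ v) x = mob u (mob v x) := by
  induction u with
  | nil => rfl
  | cons a u ih => simp [mob, ih]

lemma den_append (u v : List ℕ) (x : ℝ) : den (u ++ v) x = den u (mob v x) * den v x := by
  induction u with
  | nil => simp [den]
  | cons a u ih => simp [den, ih, mob_append, mul_assoc]

lemma one_le_den (w : List ℕ) {x : ℝ} (hx : 0 ≤ x) : 1 ≤ den w x := by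
  induction w with
  | nil => simp [den]
  | cons a w ih =>
    have := mob_nonneg w hx
    have : (0 : ℝ) ≤ a := a.cast_nonneg
    simp only [den]
    nlinarith

lemma den_pos (w : List ℕ) {x : ℝ} (hx : 0 ≤ x) : 0 < den w x :=
  zero_lt_one.trans_le (one_le_den w hx)

lemma abs_mob_sub (w : List ℕ) {x y : ℝ} (hx : 0 ≤ x) (hy : 0 ≤ y) :
    |mob w x - mob w y| = |x - y| / (den w x * den w y) := by
  induction w with
  | nil => simp [mob, den]
  | cons a w ih =>
    have h1 := mob_nonneg w hx
    have h2 := mob_nonneg w hy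
    have h3 := den_pos w hx
    have h4 := den_pos w hy
    have h5 : 0 < (a : ℝ) + 1 + mob w x := by positivity
    have h6 : 0 < (a : ℝ) + 1 + mob w y := by positivity
    have : 1 / ((a : ℝ) + 1 + mob w x) - 1 / ((a : ℝ) + 1 + mob w y) =
        -(mob w x - mob w y) / (((a : ℝ) + 1 + mob w x) * ((a : ℝ) + 1 + mob w y)) := by
      field_simp
      ring
    simp only [mob, den]
    rw [this, abs_div, abs_neg, ih, abs_of_pos (mul_pos h5 h6), div_div]
    congr 1
    ring

lemma den_affine (w : List ℕ) : ∃ c d e : ℝ, 0 ≤ c ∧ 0 ≤ d ∧ 0 ≤ e ∧ c ≤ den w 0 ∧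
    e + c ≤ d + den w 0 ∧
    ∀ x, 0 ≤ x → den w x = den w 0 + c * x ∧ mob w x * den w x = d + e * x := by
  induction w with
  | nil => exact ⟨0, 0, 1, by simp [den, mob]⟩
  | cons a w ih =>
    obtain ⟨c, d, e, hc, hd, he, h1, h2, h⟩ := ih
    have ha : (0 : ℝ) ≤ a := a.cast_nonneg
    have key : ∀ x, 0 ≤ x → den (a :: w) x = ((a + 1) * den w 0 + d) + ((a + 1) * c + e) * x ∧
        mob (a :: w) x * den (a :: w) x = den w 0 + c * x := by
      intro x hx
      obtain ⟨h3, h4⟩ := h x hx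
      have h5 := mob_nonneg w hx
      constructor
      · simp only [den]
        rw [add_mul, h4, h3]
        ring
      · simp only [den, mob]
        rw [← h3]
        have : 0 < (a : ℝ) + 1 + mob w x := by positivity
        field_simp
    have h0 : den (a :: w) 0 = (a + 1) * den w 0 + d := by simpa using (key 0 le_rfl).1
    have hq := one_le_den w (le_refl (0 : ℝ))
    refine ⟨(a + 1) * c + e, den w 0, c, by positivity, by positivity, hc, ?_, ?_, ?_⟩
    · rw [h0]
      nlinarith [mul_le_mul_of_nonneg_left h1 ha]
    · rw [h0]
      nlinarith [mul_le_mul_of_nonneg_left h1 ha]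
    · intro x hx
      rw [h0]
      exact key x hx

lemma den_zero_le (w : List ℕ) {x : ℝ} (hx : 0 ≤ x) : den w 0 ≤ den w x := by
  obtain ⟨c, d, e, hc, hd, he, h1, h2, h⟩ := den_affine w
  rw [(h x hx).1]
  nlinarith

lemma den_le_two_mul (w : List ℕ) {x : ℝ} (hx : 0 ≤ x) (hx1 : x ≤ 1) : den w x ≤ 2 * den w 0 := by
  obtain ⟨c, d, e, hc, hd, he, h1, h2, h⟩ := den_affine w
  rw [(h x hx).1]
  nlinarith

lemma den_mul_le (u v : List ℕ) : den u 0 * den v 0 ≤ den (u ++ v) 0 := by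
  rw [den_append]
  exact mul_le_mul_of_nonneg_right (den_zero_le u (mob_nonneg v le_rfl)) (den_pos v le_rfl).le

lemma abs_mob_sub_le (w : List ℕ) {x y : ℝ} (hx : 0 ≤ x) (hy : 0 ≤ y) (hx1 : x ≤ 1) (hy1 : y ≤ 1) :
    |mob w x - mob w y| ≤ (den w 0 ^ 2)⁻¹ := by
  rw [abs_mob_sub w hx hy, div_eq_mul_inv]
  have h0 := den_pos w (le_refl (0 : ℝ))
  have h1 := den_zero_le w hx
  have h2 := den_zero_le w hy
  have h3 : |x - y| ≤ 1 := by rw [abs_le]; constructor <;> linarith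
  have h4 : (den w x * den w y)⁻¹ ≤ (den w 0 ^ 2)⁻¹ := by
    apply inv_anti₀ (by positivity)
    rw [sq]
    exact mul_le_mul h1 h2 h0.le (h0.le.trans h1)
  have h5 : 0 ≤ (den w x * den w y)⁻¹ := by
    have := den_pos w hx
    have := den_pos w hy
    positivity
  nlinarith

lemma le_abs_mob_sub (w : List ℕ) {x y : ℝ} (hx : 0 ≤ x) (hy : 0 ≤ y) (hx1 : x ≤ 1) (hy1 : y ≤ 1) :
    |x - y| * (4 * den w 0 ^ 2)⁻¹ ≤ |mob w x - mob w y| := by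
  rw [abs_mob_sub w hx hy, div_eq_mul_inv]
  have h0 := den_pos w (le_refl (0 : ℝ))
  have h1 := den_le_two_mul w hx hx1
  have h2 := den_le_two_mul w hy hy1
  have h3 := den_pos w hx
  have h4 := den_pos w hy
  apply mul_le_mul_of_nonneg_left _ (abs_nonneg _)
  apply inv_anti₀ (by positivity)
  calc den w x * den w y ≤ (2 * den w 0) * (2 * den w 0) :=
        mul_le_mul h1 h2 h4.le (by positivity)
    _ = _ := by ring

/-! ### Digits of irrational points -/

lemma irrUnit_gaussMap {x : ℝ} (hx : IrrUnit x) : IrrUnit (gaussMap x) := by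
  have h : Irrational (gaussMap x) := by
    unfold gaussMap Int.fract
    rw [one_div]
    exact (irrational_inv_iff.mpr hx.2).sub_intCast _
  refine ⟨⟨lt_of_le_of_ne (Int.fract_nonneg _) ?_, Int.fract_lt_one _⟩, h⟩
  exact fun h0 => h ⟨0, by simpa [gaussMap] using h0⟩

lemma irrUnit_iterate {x : ℝ} (hx : IrrUnit x) (n : ℕ) : IrrUnit (gaussMap^[n] x) := by
  induction n with
  | zero => exact hx
  | succ n ih => rw [Function.iterate_succ_apply']; exact irrUnit_gaussMap ih

lemma one_le_floor {x : ℝ} (hx : x ∈ Ioo (0 : ℝ) 1) : 1 ≤ ⌊1 / x⌋₊ := by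
  rw [Nat.one_le_floor_iff, le_div_iff₀ hx.1]
  linarith [hx.2]

lemma floor_add_gaussMap {x : ℝ} (hx : 0 < x) : (⌊1 / x⌋₊ : ℝ) + gaussMap x = 1 / x := by
  have h0 : (0 : ℝ) ≤ 1 / x := by positivity
  rw [natCast_floor_eq_intCast_floor h0]
  exact Int.floor_add_fract _

lemma letter_cast {x : ℝ} (hx : x ∈ Ioo (0 : ℝ) 1) :
    ((⌊1 / x⌋₊ - 1 : ℕ) : ℝ) + 1 = ⌊1 / x⌋₊ := by
  rw [Nat.cast_sub (one_le_floor hx)]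
  simp

lemma letters_length (n : ℕ) (x : ℝ) : (letters n x).length = n := by
  induction n generalizing x with
  | zero => rfl
  | succ n ih => simp [letters, ih]

lemma mob_letters {x : ℝ} (hx : IrrUnit x) (n : ℕ) : mob (letters n x) (gaussMap^[n] x) = x := by
  induction n generalizing x with
  | zero => rfl
  | succ n ih =>
    simp only [letters, mob, Function.iterate_succ_apply]
    rw [ih (irrUnit_gaussMap hx), letter_cast hx.1, floor_add_gaussMap hx.1.1, one_div_one_div]

lemma letters_add (m n : ℕ) (x : ℝ) :
    letters (m + n) x = letters m x ++ letters n (gaussMap^[m] x) := by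
  induction m generalizing x with
  | zero => simp [letters]
  | succ m ih => rw [Nat.succ_add]; simp [letters, ih, Function.iterate_succ_apply]

lemma letters_succ (n : ℕ) (x : ℝ) :
    letters (n + 1) x = letters n x ++ [⌊1 / gaussMap^[n] x⌋₊ - 1] := by
  rw [letters_add]; rfl

lemma floor_branch (a : ℕ) {y : ℝ} (hy : y ∈ Ioo (0 : ℝ) 1) :
    ⌊1 / (1 / ((a : ℝ) + 1 + y))⌋₊ = a + 1 := by
  rw [one_div_one_div, Nat.floor_eq_iff (by have := hy.1; positivity)]
  push_cast
  constructor <;> linarith [hy.1, hy.2]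

lemma gaussMap_branch (a : ℕ) {y : ℝ} (hy : y ∈ Ioo (0 : ℝ) 1) :
    gaussMap (1 / ((a : ℝ) + 1 + y)) = y := by
  unfold gaussMap
  rw [one_div_one_div, Int.fract_eq_iff]
  exact ⟨hy.1.le, hy.2, a + 1, by push_cast; ring⟩

lemma mob_mem (w : List ℕ) {y : ℝ} (hy : y ∈ Ioo (0 : ℝ) 1) : mob w y ∈ Ioo (0 : ℝ) 1 :=
  ⟨mob_pos w hy.1, mob_lt_one w hy.1 hy.2⟩

lemma letters_mob (w : List ℕ) {y : ℝ} (hy : y ∈ Ioo (0 : ℝ) 1) :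
    letters w.length (mob w y) = w := by
  induction w with
  | nil => rfl
  | cons a w ih =>
    have := mob_mem w hy
    simp only [List.length_cons, letters, mob]
    rw [floor_branch a this, gaussMap_branch a this, ih]
    rfl

lemma iterate_mob (w : List ℕ) {y : ℝ} (hy : y ∈ Ioo (0 : ℝ) 1) :
    gaussMap^[w.length] (mob w y) = y := by
  induction w with
  | nil => rfl
  | cons a w ih =>
    simp only [List.length_cons, Function.iterate_succ_apply, mob]
    rw [gaussMap_branch a (mob_mem w hy), ih]

lemma den_letters {x : ℝ} (hx : IrrUnit x) (n : ℕ) {y : ℝ} (hy : 0 ≤ y) :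
    den (letters (n + 1) x) y = contDen (cfDigit x) (n + 1) + contDen (cfDigit x) n * y := by
  induction n generalizing y with
  | zero =>
    have : den (letters 1 x) y = ((⌊1 / x⌋₊ - 1 : ℕ) : ℝ) + 1 + y := by simp [letters, den, mob]
    rw [this, letter_cast hx.1]
    simp [contDen, cfDigit]
  | succ n ih =>
    rw [letters_succ (n + 1), den_append, ih (mob_nonneg _ hy)]
    simp only [den, mob, letter_cast (irrUnit_iterate hx (n + 1)).1]
    have hf := one_le_floor (irrUnit_iterate hx (n + 1)).1
    have : (0 : ℝ) < ⌊1 / gaussMap^[n + 1] x⌋₊ + y := by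
      have : (1 : ℝ) ≤ ⌊1 / gaussMap^[n + 1] x⌋₊ := by exact_mod_cast hf
      linarith
    simp only [contDen, cfDigit]
    push_cast
    field_simp
    ring

lemma qDen_eq {x : ℝ} (hx : IrrUnit x) (n : ℕ) : (qDen n x : ℝ) = den (letters n x) 0 := by
  cases n with
  | zero => simp [qDen, contDen, letters, den]
  | succ n => rw [den_letters hx n le_rfl]; simp [qDen]

lemma den_letters_mono (x : ℝ) : Monotone fun n => den (letters n x) 0 := by
  refine monotone_nat_of_le_succ fun n => ?_
  rw [letters_succ]
  refine le_trans ?_ (den_mul_le _ _)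
  exact le_mul_of_one_le_right (den_pos _ le_rfl).le (one_le_den _ le_rfl)

/-- A point all of whose Gauss iterates lie in the open unit interval is irrational. -/
lemma irrational_of_iterate_mem {x : ℝ} (h : ∀ n, gaussMap^[n] x ∈ Ioo (0 : ℝ) 1) :
    Irrational x := by
  suffices H : ∀ q : ℕ, ∀ p : ℕ, ∀ x : ℝ, x = p / q →
      ¬ ∀ n, gaussMap^[n] x ∈ Ioo (0 : ℝ) 1 by
    rintro ⟨r, rfl⟩
    have h0 := (h 0).1
    simp only [Function.iterate_zero, id] at h0
    have hr : 0 ≤ r.num := by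
      have : (0 : ℚ) < r := by exact_mod_cast h0
      exact (Rat.num_pos.mpr this).le
    refine H r.den r.num.toNat r ?_ h
    have h1 : ((r.num.toNat : ℕ) : ℝ) = (r.num : ℝ) := by
      exact_mod_cast congrArg (fun z : ℤ => (z : ℝ)) (Int.toNat_of_nonneg hr)
    rw [h1]
    exact_mod_cast (Rat.num_div_den r).symm
  intro q
  induction q using Nat.strong_induction_on with
  | _ q ih =>
    intro p x hx hT
    have h0 := hT 0
    simp only [Function.iterate_zero, id] at h0
    have hq : 0 < q := by
      rcases Nat.eq_zero_or_pos q with rfl | hq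
      · rw [hx] at h0; simp at h0
      · exact hq
    have hqR : (0 : ℝ) < q := by exact_mod_cast hq
    have hp : 0 < p := by
      rcases Nat.eq_zero_or_pos p with rfl | hp
      · rw [hx] at h0; simp at h0
      · exact hp
    have hpR : (0 : ℝ) < p := by exact_mod_cast hp
    have hpq : p < q := by
      have := h0.2
      rw [hx, div_lt_one hqR] at this
      exact_mod_cast this
    have hg := floor_add_gaussMap h0.1
    have hle : ⌊1 / x⌋₊ * p ≤ q := by
      have h1 : (⌊1 / x⌋₊ : ℝ) ≤ 1 / x := Nat.floor_le (by have := h0.1; positivity)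
      rw [hx, one_div_div, le_div_iff₀ hpR] at h1
      rw [hx, one_div_div]
      exact_mod_cast h1
    refine ih p hpq (q - ⌊1 / x⌋₊ * p) (gaussMap x) ?_ fun n => ?_
    · rw [Nat.cast_sub hle]
      have : gaussMap x = 1 / x - ⌊1 / x⌋₊ := by linarith
      rw [this]
      push_cast
      nth_rewrite 1 [hx]
      field_simp
    · have := hT (n + 1)
      rwa [Function.iterate_succ_apply] at this

/-- The set of irrational points whose first letters spell `w`. -/
def cyl (w : List ℕ) : Set ℝ := {x | IrrUnit x ∧ letters w.length x = w}

lemma ediam_cyl_le (w : List ℕ) : Metric.ediam (cyl w) ≤ ENNReal.ofReal ((den w 0 ^ 2)⁻¹) := by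
  refine Metric.ediam_le fun x hx y hy => ?_
  rw [edist_dist, Real.dist_eq]
  apply ENNReal.ofReal_le_ofReal
  have h1 := mob_letters hx.1 w.length
  have h2 := mob_letters hy.1 w.length
  rw [hx.2] at h1
  rw [hy.2] at h2
  rw [← h1, ← h2]
  have h3 := (irrUnit_iterate hx.1 w.length).1
  have h4 := (irrUnit_iterate hy.1 w.length).1
  exact abs_mob_sub_le w h3.1.le h4.1.le h3.2.le h4.2.le

lemma volume_cyl_le (w : List ℕ) : volume (cyl w) ≤ ENNReal.ofReal ((den w 0 ^ 2)⁻¹) :=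
  (Real.volume_le_diam _).trans (ediam_cyl_le w)

lemma exists_ofFn_letters (n : ℕ) (x : ℝ) : ∃ w : Fin n → ℕ, letters n x = List.ofFn w := by
  have : ∃ l : List ℕ, ∃ h : l.length = n, letters n x = l := ⟨_, letters_length n x, rfl⟩
  obtain ⟨l, rfl, hl⟩ := this
  exact ⟨l.get, by rw [hl, List.ofFn_get]⟩

/-- Twice the logarithm of `den`: up to a bounded error, minus the logarithm of the length of the
cylinder of `w`. -/
noncomputable def lg (w : List ℕ) (x : ℝ) : ℝ := 2 * Real.log (den w x)

lemma lg_nil (x : ℝ) : lg [] x = 0 := by simp [lg, den]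

lemma lg_nonneg (w : List ℕ) {x : ℝ} (hx : 0 ≤ x) : 0 ≤ lg w x :=
  mul_nonneg zero_le_two (Real.log_nonneg (one_le_den w hx))

lemma lg_append (u v : List ℕ) {x : ℝ} (hx : 0 ≤ x) :
    lg (u ++ v) x = lg u (mob v x) + lg v x := by
  unfold lg
  rw [den_append, Real.log_mul (den_pos u (mob_nonneg v hx)).ne' (den_pos v hx).ne']
  ring

lemma lg_zero_le (w : List ℕ) {x : ℝ} (hx : 0 ≤ x) : lg w 0 ≤ lg w x :=
  mul_le_mul_of_nonneg_left (Real.log_le_log (den_pos w le_rfl) (den_zero_le w hx)) zero_le_two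

lemma lg_le_add (w : List ℕ) {x : ℝ} (hx : 0 ≤ x) (hx1 : x ≤ 1) :
    lg w x ≤ lg w 0 + 2 * Real.log 2 := by
  have h := Real.log_le_log (den_pos w hx) (den_le_two_mul w hx hx1)
  rw [Real.log_mul two_ne_zero (den_pos w le_rfl).ne'] at h
  unfold lg
  linarith

lemma lg_add_le (u v : List ℕ) : lg u 0 + lg v 0 ≤ lg (u ++ v) 0 := by
  rw [lg_append u v le_rfl]
  linarith [lg_zero_le u (mob_nonneg v le_rfl)]

lemma lg_append_le (u v : List ℕ) : lg (u ++ v) 0 ≤ lg u 0 + lg v 0 + 2 * Real.log 2 := by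
  rw [lg_append u v le_rfl]
  linarith [lg_le_add u (mob_nonneg v le_rfl) (mob_le_one v le_rfl zero_le_one)]

lemma inv_den_sq (w : List ℕ) : (den w 0 ^ 2)⁻¹ = Real.exp (-lg w 0) := by
  have h : lg w 0 = Real.log (den w 0 ^ 2) := by rw [Real.log_pow]; simp [lg]
  rw [h, Real.exp_neg, Real.exp_log (pow_pos (den_pos w le_rfl) 2)]

lemma two_log_two_pos : 0 < 2 * Real.log 2 := mul_pos two_pos (Real.log_pos one_lt_two)

/-- The `n`-th partition function, i.e. the `n`-fold iterate of the transfer operator with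
parameter `t` applied to the constant function `1`. -/
noncomputable def Z (t : ℝ) (n : ℕ) (x : ℝ) : ENNReal :=
  ∑' w : Fin n → ℕ, ENNReal.ofReal (Real.exp (-t * lg (List.ofFn w) x))

/-- The transfer operator of the Gauss map. -/
noncomputable def transfer (t : ℝ) (f : ℝ → ENNReal) (x : ℝ) : ENNReal :=
  ∑' a : ℕ, ENNReal.ofReal (Real.exp (-t * lg [a] x)) * f (1 / ((a : ℝ) + 1 + x))

lemma Z_zero (t x : ℝ) : Z t 0 x = 1 := by
  simp [Z, lg_nil]

lemma Z_succ (t : ℝ) (n : ℕ) {x : ℝ} (hx : 0 ≤ x) : Z t (n + 1) x = transfer t (Z t n) x := by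
  unfold Z transfer
  rw [← Equiv.tsum_eq (Fin.snocEquiv fun _ => ℕ)]
  have : ∀ c : ℕ × (Fin n → ℕ), ENNReal.ofReal (Real.exp (-t * lg
      (List.ofFn ((Fin.snocEquiv fun _ => ℕ) c)) x)) =
      ENNReal.ofReal (Real.exp (-t * lg [c.1] x)) *
        ENNReal.ofReal (Real.exp (-t * lg (List.ofFn c.2) (1 / ((c.1 : ℝ) + 1 + x)))) := by
    rintro ⟨a, w⟩
    have h : List.ofFn ((Fin.snocEquiv fun _ => ℕ) (a, w)) = List.ofFn w ++ [a] := by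
      rw [List.ofFn_succ']
      simp [Fin.snocEquiv_apply]
    rw [h, lg_append _ _ hx, ← ENNReal.ofReal_mul (Real.exp_pos _).le, ← Real.exp_add]
    simp only [mob]
    congr 2
    ring
  rw [tsum_congr this, ENNReal.tsum_prod']
  simp only [ENNReal.tsum_mul_left]

lemma Z_le_Z_zero {t : ℝ} (ht : 0 ≤ t) (n : ℕ) {x : ℝ} (hx : 0 ≤ x) : Z t n x ≤ Z t n 0 := by
  refine ENNReal.tsum_le_tsum fun w => ENNReal.ofReal_le_ofReal (Real.exp_le_exp.mpr ?_)
  nlinarith [lg_zero_le (List.ofFn w) hx]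

lemma Z_zero_le {t : ℝ} (ht : 0 ≤ t) (n : ℕ) {x : ℝ} (hx : 0 ≤ x) (hx1 : x ≤ 1) :
    Z t n 0 ≤ ENNReal.ofReal (Real.exp (t * (2 * Real.log 2))) * Z t n x := by
  unfold Z
  rw [← ENNReal.tsum_mul_left]
  refine ENNReal.tsum_le_tsum fun w => ?_
  rw [← ENNReal.ofReal_mul (Real.exp_pos _).le, ← Real.exp_add]
  refine ENNReal.ofReal_le_ofReal (Real.exp_le_exp.mpr ?_)
  nlinarith [lg_le_add (List.ofFn w) hx hx1]

lemma Z_add_le {t : ℝ} (ht : 0 ≤ t) (m n : ℕ) : Z t (m + n) 0 ≤ Z t m 0 * Z t n 0 := by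
  unfold Z
  rw [← Equiv.tsum_eq (Fin.appendEquiv m n), ENNReal.tsum_prod', ← ENNReal.tsum_mul_right]
  refine ENNReal.tsum_le_tsum fun u => ?_
  rw [← ENNReal.tsum_mul_left]
  refine ENNReal.tsum_le_tsum fun v => ?_
  rw [← ENNReal.ofReal_mul (Real.exp_pos _).le, ← Real.exp_add]
  refine ENNReal.ofReal_le_ofReal (Real.exp_le_exp.mpr ?_)
  simp only [Fin.appendEquiv, Equiv.coe_fn_mk, List.ofFn_fin_append]
  nlinarith [lg_add_le (List.ofFn u) (List.ofFn v)]

lemma Z_mul_le {t : ℝ} (ht : 0 ≤ t) (m n : ℕ) :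
    Z t m 0 * Z t n 0 ≤ ENNReal.ofReal (Real.exp (t * (2 * Real.log 2))) * Z t (m + n) 0 := by
  unfold Z
  rw [← Equiv.tsum_eq (Fin.appendEquiv m n), ENNReal.tsum_prod', ← ENNReal.tsum_mul_right,
    ← ENNReal.tsum_mul_left]
  refine ENNReal.tsum_le_tsum fun u => ?_
  rw [← ENNReal.tsum_mul_left, ← ENNReal.tsum_mul_left]
  refine ENNReal.tsum_le_tsum fun v => ?_
  rw [← ENNReal.ofReal_mul (Real.exp_pos _).le, ← Real.exp_add,
    ← ENNReal.ofReal_mul (Real.exp_pos _).le, ← Real.exp_add]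
  refine ENNReal.ofReal_le_ofReal (Real.exp_le_exp.mpr ?_)
  simp only [Fin.appendEquiv, Equiv.coe_fn_mk, List.ofFn_fin_append]
  nlinarith [lg_append_le (List.ofFn u) (List.ofFn v)]

lemma exp_lg_singleton (t : ℝ) (a : ℕ) :
    Real.exp (-t * lg [a] 0) = ((a : ℝ) + 1) ^ (-(2 * t)) := by
  have : (0 : ℝ) < a + 1 := by positivity
  rw [Real.rpow_def_of_pos this]
  simp only [lg, den, mob, mul_one, add_zero]
  congr 1
  ring

lemma Z_one (t : ℝ) : Z t 1 0 = ∑' a : ℕ, ENNReal.ofReal (((a : ℝ) + 1) ^ (-(2 * t))) := by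
  refine (Z_succ t 0 le_rfl).trans ?_
  unfold transfer
  exact tsum_congr fun a => by rw [Z_zero, mul_one, exp_lg_singleton]

lemma Z_one_ne_top {t : ℝ} (ht : 1 / 2 < t) : Z t 1 0 ≠ ⊤ := by
  rw [Z_one]
  refine Summable.tsum_ofReal_ne_top ?_
  have h := (summable_nat_add_iff 1).mpr (Real.summable_nat_rpow_inv.mpr
    (show (1 : ℝ) < 2 * t by linarith))
  refine h.congr fun a => ?_
  rw [Real.rpow_neg (by positivity)]
  push_cast
  rfl

lemma Z_ne_top {t : ℝ} (ht : 1 / 2 < t) (n : ℕ) : Z t n 0 ≠ ⊤ := by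
  induction n with
  | zero => simp [Z_zero]
  | succ n ih =>
    exact ne_top_of_le_ne_top (ENNReal.mul_ne_top ih (Z_one_ne_top ht))
      (Z_add_le (by linarith) n 1)

lemma Z_pos (t : ℝ) (n : ℕ) (x : ℝ) : 0 < Z t n x :=
  (ENNReal.ofReal_pos.mpr (Real.exp_pos _)).trans_le (ENNReal.le_tsum (fun _ => 0))

/-- An almost additive sequence is linear up to a bounded error. -/
lemma exists_linear_rate {u : ℕ → ℝ} {c : ℝ} (h1 : ∀ m n, u (m + n) ≤ u m + u n)
    (h2 : ∀ m n, u m + u n ≤ u (m + n) + c) :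
    ∃ P : ℝ, ∀ n : ℕ, (n : ℝ) * P ≤ u n ∧ u n ≤ n * P + c := by
  have h0 : 0 ≤ u 0 ∧ u 0 ≤ c := by
    have := h1 0 0
    have := h2 0 0
    simp only [add_zero] at *
    constructor <;> linarith
  have hmul1 : ∀ m n : ℕ, u (m * (n + 1)) ≤ (n + 1) * u m := by
    intro m n
    induction n with
    | zero => simp
    | succ n ih =>
      rw [mul_add m (n + 1) 1, mul_one]
      push_cast
      linarith [h1 (m * (n + 1)) m]
  have hmul2 : ∀ m n : ℕ, (n + 1) * (u m - c) ≤ u (m * (n + 1)) := by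
    intro m n
    induction n with
    | zero => simp; linarith
    | succ n ih =>
      rw [mul_add m (n + 1) 1, mul_one]
      push_cast
      linarith [h2 (m * (n + 1)) m]
  have key : ∀ m n : ℕ, (u (m + 1) - c) / ((m : ℝ) + 1) ≤ u (n + 1) / ((n : ℝ) + 1) := by
    intro m n
    rw [div_le_div_iff₀ (by positivity) (by positivity)]
    have a1 := hmul2 (m + 1) n
    have a2 := hmul1 (n + 1) m
    rw [mul_comm (n + 1) (m + 1)] at a2
    linarith
  refine ⟨⨆ m : ℕ, (u (m + 1) - c) / ((m : ℝ) + 1), fun n => ?_⟩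
  cases n with
  | zero => simpa using h0
  | succ n =>
    have hn : (0 : ℝ) < n + 1 := by positivity
    push_cast
    constructor
    · have := ciSup_le fun m => key m n
      rw [le_div_iff₀ hn] at this
      linarith
    · have := le_ciSup (f := fun m : ℕ => (u (m + 1) - c) / ((m : ℝ) + 1))
        ⟨_, by rintro _ ⟨m, rfl⟩; exact key m 0⟩ n
      rw [div_le_iff₀ hn] at this
      linarith

/-- The logarithm of the partition function at `0`. -/
noncomputable def logZ (t : ℝ) (n : ℕ) : ℝ := Real.log (Z t n 0).toReal

lemma Z_eq_exp {t : ℝ} (ht : 1 / 2 < t) (n : ℕ) :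
    Z t n 0 = ENNReal.ofReal (Real.exp (logZ t n)) := by
  unfold logZ
  rw [Real.exp_log (ENNReal.toReal_pos (Z_pos t n 0).ne' (Z_ne_top ht n)),
    ENNReal.ofReal_toReal (Z_ne_top ht n)]

lemma exists_pressure {t : ℝ} (ht : 1 / 2 < t) :
    ∃ P : ℝ, ∀ n : ℕ, (n : ℝ) * P ≤ logZ t n ∧ logZ t n ≤ n * P + t * (2 * Real.log 2) := by
  have ht0 : 0 ≤ t := by linarith
  refine exists_linear_rate (fun m n => ?_) (fun m n => ?_)
  · have := Z_add_le ht0 m n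
    rwa [Z_eq_exp ht, Z_eq_exp ht, Z_eq_exp ht, ← ENNReal.ofReal_mul (Real.exp_pos _).le,
      ← Real.exp_add, ENNReal.ofReal_le_ofReal_iff (Real.exp_pos _).le, Real.exp_le_exp] at this
  · have := Z_mul_le ht0 m n
    rw [Z_eq_exp ht, Z_eq_exp ht, Z_eq_exp ht, ← ENNReal.ofReal_mul (Real.exp_pos _).le,
      ← Real.exp_add, ← ENNReal.ofReal_mul (Real.exp_pos _).le,
      ← Real.exp_add, ENNReal.ofReal_le_ofReal_iff (Real.exp_pos _).le, Real.exp_le_exp] at this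
    linarith

open Classical in
/-- The pressure function. -/
noncomputable def pressure (t : ℝ) : ℝ :=
  if h : 1 / 2 < t then (exists_pressure h).choose else 0

lemma le_logZ {t : ℝ} (ht : 1 / 2 < t) (n : ℕ) : (n : ℝ) * pressure t ≤ logZ t n := by
  unfold pressure
  rw [dif_pos ht]
  exact ((exists_pressure ht).choose_spec n).1

lemma logZ_le {t : ℝ} (ht : 1 / 2 < t) (n : ℕ) :
    logZ t n ≤ n * pressure t + t * (2 * Real.log 2) := by
  unfold pressure
  rw [dif_pos ht]
  exact ((exists_pressure ht).choose_spec n).2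

lemma le_Z {t : ℝ} (ht : 1 / 2 < t) (n : ℕ) :
    ENNReal.ofReal (Real.exp (n * pressure t)) ≤ Z t n 0 := by
  rw [Z_eq_exp ht]
  exact ENNReal.ofReal_le_ofReal (Real.exp_le_exp.mpr (le_logZ ht n))

lemma Z_le {t : ℝ} (ht : 1 / 2 < t) (n : ℕ) :
    Z t n 0 ≤ ENNReal.ofReal (Real.exp (n * pressure t + t * (2 * Real.log 2))) := by
  rw [Z_eq_exp ht]
  exact ENNReal.ofReal_le_ofReal (Real.exp_le_exp.mpr (logZ_le ht n))

lemma le_of_nat_mul_le {a b c : ℝ} (h : ∀ n : ℕ, (n : ℝ) * a ≤ n * b + c) : a ≤ b := by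
  by_contra! hab
  obtain ⟨n, hn⟩ := exists_nat_gt (c / (a - b))
  rw [div_lt_iff₀ (by linarith)] at hn
  linarith [h n]

lemma le_pressure {t a c : ℝ} (ht : 1 / 2 < t)
    (h : ∀ n : ℕ, ENNReal.ofReal (Real.exp (n * a - c)) ≤ Z t n 0) : a ≤ pressure t := by
  refine le_of_nat_mul_le (c := t * (2 * Real.log 2) + c) fun n => ?_
  have := (h n).trans (Z_le ht n)
  rw [ENNReal.ofReal_le_ofReal_iff (Real.exp_pos _).le, Real.exp_le_exp] at this
  linarith

lemma pressure_le {t a c : ℝ} (ht : 1 / 2 < t)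
    (h : ∀ n : ℕ, Z t n 0 ≤ ENNReal.ofReal (Real.exp (n * a + c))) : pressure t ≤ a := by
  refine le_of_nat_mul_le (c := c) fun n => ?_
  have := (le_Z ht n).trans (h n)
  rwa [ENNReal.ofReal_le_ofReal_iff (Real.exp_pos _).le, Real.exp_le_exp] at this

lemma logZ_convex {s t a b : ℝ} (hs : 1 / 2 < s) (ht : 1 / 2 < t) (ha : 0 ≤ a) (hb : 0 ≤ b)
    (hab : a + b = 1) (n : ℕ) :
    Z (a * s + b * t) n 0 ≤ ENNReal.ofReal (Real.exp (a * logZ s n + b * logZ t n)) := by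
  set A := logZ s n
  set B := logZ t n
  have key : ∀ w : Fin n → ℕ,
      ENNReal.ofReal (Real.exp (-(a * s + b * t) * lg (List.ofFn w) 0)) ≤
      ENNReal.ofReal (a * Real.exp (a * A + b * B - A)) *
        ENNReal.ofReal (Real.exp (-s * lg (List.ofFn w) 0)) +
      ENNReal.ofReal (b * Real.exp (a * A + b * B - B)) *
        ENNReal.ofReal (Real.exp (-t * lg (List.ofFn w) 0)) := by
    intro w
    set l := lg (List.ofFn w) 0
    rw [← ENNReal.ofReal_mul (by positivity), ← ENNReal.ofReal_mul (by positivity),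
      ← ENNReal.ofReal_add (by positivity) (by positivity)]
    apply ENNReal.ofReal_le_ofReal
    have h := Real.geom_mean_le_arith_mean2_weighted ha hb (Real.exp_pos (-s * l - A)).le
      (Real.exp_pos (-t * l - B)).le hab
    rw [← Real.exp_mul, ← Real.exp_mul, ← Real.exp_add] at h
    have h2 := mul_le_mul_of_nonneg_left h (Real.exp_pos (a * A + b * B)).le
    rw [← Real.exp_add] at h2
    calc Real.exp (-(a * s + b * t) * l)
        = Real.exp (a * A + b * B + ((-s * l - A) * a + (-t * l - B) * b)) := by congr 1; ring
      _ ≤ _ := h2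
      _ = _ := by
        rw [show a * A + b * B - A = a * A + b * B + (- A) by ring,
          show a * A + b * B - B = a * A + b * B + (- B) by ring,
          show -s * l - A = -s * l + (-A) by ring, show -t * l - B = -t * l + (-B) by ring]
        simp only [Real.exp_add]
        ring
  calc Z (a * s + b * t) n 0 ≤ _ := ENNReal.tsum_le_tsum key
    _ = ENNReal.ofReal (a * Real.exp (a * A + b * B - A)) * Z s n 0 +
        ENNReal.ofReal (b * Real.exp (a * A + b * B - B)) * Z t n 0 := by
      rw [ENNReal.tsum_add, ENNReal.tsum_mul_left, ENNReal.tsum_mul_left]; rfl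
    _ = _ := by
      rw [Z_eq_exp hs, Z_eq_exp ht, ← ENNReal.ofReal_mul (by positivity),
        ← ENNReal.ofReal_mul (by positivity), ← ENNReal.ofReal_add (by positivity) (by positivity)]
      congr 1
      rw [mul_assoc, mul_assoc, ← Real.exp_add, ← Real.exp_add, ← add_mul_of_exp hab]
where
  add_mul_of_exp {a b A B : ℝ} (hab : a + b = 1) :
      Real.exp (a * A + b * B) = a * Real.exp (a * A + b * B - A + A) +
        b * Real.exp (a * A + b * B - B + B) := by
    rw [sub_add_cancel, sub_add_cancel, ← add_mul, hab, one_mul]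

lemma pressure_convexOn : ConvexOn ℝ (Ioi (1 / 2)) pressure := by
  refine ⟨convex_Ioi _, fun s hs t ht a b ha hb hab => ?_⟩
  simp only [smul_eq_mul]
  have hs' : 1 / 2 < s := hs
  have ht' : 1 / 2 < t := ht
  have hmem : 1 / 2 < a * s + b * t := convex_Ioi (1 / 2 : ℝ) hs ht ha hb hab
  refine pressure_le (c := (a * s + b * t) * (2 * Real.log 2)) hmem fun n => ?_
  refine (logZ_convex hs ht ha hb hab n).trans
    (ENNReal.ofReal_le_ofReal (Real.exp_le_exp.mpr ?_))
  nlinarith [mul_le_mul_of_nonneg_left (logZ_le hs' n) ha,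
    mul_le_mul_of_nonneg_left (logZ_le ht' n) hb]

lemma Z_antitone {s t : ℝ} (h : s ≤ t) (n : ℕ) : Z t n 0 ≤ Z s n 0 := by
  refine ENNReal.tsum_le_tsum fun w => ENNReal.ofReal_le_ofReal (Real.exp_le_exp.mpr ?_)
  nlinarith [lg_nonneg (List.ofFn w) (le_refl (0 : ℝ))]

/-- The pressure blows up at the left end of its domain. -/
lemma exists_forall_le_pressure (B : ℝ) :
    ∃ r : ℝ, 1 / 2 < r ∧ ∀ t, 1 / 2 < t → t ≤ r → B ≤ pressure t := by
  obtain ⟨N, hN⟩ := (Real.tendsto_sum_range_one_div_nat_succ_atTop.eventually_gt_atTop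
    (Real.exp (B + 2 * Real.log 2))).exists
  have hcont : Continuous fun t : ℝ => ∑ i ∈ Finset.range N, ((i : ℝ) + 1) ^ (-(2 * t)) := by
    refine continuous_finsetSum _ fun i _ => ?_
    exact (Real.continuous_const_rpow (by positivity)).comp (by fun_prop)
  have h12 : Real.exp (B + 2 * Real.log 2) <
      ∑ i ∈ Finset.range N, ((i : ℝ) + 1) ^ (-(2 * (1 / 2 : ℝ))) := by
    convert! hN using 2 with i
    rw [show -(2 * (1 / 2 : ℝ)) = -1 by norm_num, Real.rpow_neg_one, one_div]
  have hev := hcont.continuousAt.eventually_const_lt h12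
  obtain ⟨δ, hδ, hball⟩ := Metric.eventually_nhds_iff.mp hev
  refine ⟨1 / 2 + min (δ / 2) (1 / 2), by positivity |> fun h : 0 < min (δ / 2) (1 / 2 : ℝ) => by
    linarith, fun t ht htr => ?_⟩
  have hm1 := min_le_left (δ / 2) (1 / 2 : ℝ)
  have hm2 := min_le_right (δ / 2) (1 / 2 : ℝ)
  have h1 := hball (y := t) (by rw [Real.dist_eq, abs_lt]; constructor <;> linarith)
  have h2 : ENNReal.ofReal (Real.exp (B + 2 * Real.log 2)) ≤ Z t 1 0 := by
    rw [Z_one]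
    refine (ENNReal.ofReal_le_ofReal h1.le).trans ?_
    rw [ENNReal.ofReal_sum_of_nonneg fun i _ => by positivity]
    exact ENNReal.sum_le_tsum _
  have h3 := h2.trans (Z_le ht 1)
  rw [ENNReal.ofReal_le_ofReal_iff (Real.exp_pos _).le, Real.exp_le_exp] at h3
  have := two_log_two_pos
  simp only [Nat.cast_one, one_mul] at h3
  nlinarith

lemma Z_eq_top {t : ℝ} (ht : t ≤ 1 / 2) {n : ℕ} (hn : 1 ≤ n) : Z t n 0 = ⊤ := by
  refine ENNReal.eq_top_of_forall_nnreal_le fun B => ?_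
  obtain ⟨r, hr, h⟩ := exists_forall_le_pressure (B : ℝ)
  refine le_trans ?_ ((le_Z hr n).trans (Z_antitone (ht.trans hr.le) n))
  rw [← ENNReal.ofReal_coe_nnreal]
  apply ENNReal.ofReal_le_ofReal
  have h1 := h r hr le_rfl
  have h2 := Real.add_one_le_exp (n * pressure r)
  have h3 : (1 : ℝ) ≤ n := by exact_mod_cast hn
  nlinarith [B.coe_nonneg]

lemma lg_singleton (a : ℕ) (x : ℝ) : lg [a] x = 2 * Real.log (a + 1 + x) := by
  simp [lg, den, mob]

lemma transfer_mono {t : ℝ} {f g : ℝ → ENNReal} (h : ∀ y ∈ Icc (0 : ℝ) 1, f y ≤ g y) {x : ℝ}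
    (hx : 0 ≤ x) : transfer t f x ≤ transfer t g x := by
  refine ENNReal.tsum_le_tsum fun a => mul_le_mul_right (h _ ⟨by positivity, ?_⟩) _
  rw [div_le_one (by positivity)]
  linarith [a.cast_nonneg (α := ℝ)]

lemma transfer_const_mul (t : ℝ) (c : ENNReal) (f : ℝ → ENNReal) (x : ℝ) :
    transfer t (fun y => c * f y) x = c * transfer t f x := by
  unfold transfer
  rw [← ENNReal.tsum_mul_left]
  exact tsum_congr fun a => by ring

/-- For `r` above the pressure, the transfer operator has a `exp r`-superharmonic function with
bounded distortion. -/
lemma exists_superharmonic {t r : ℝ} (ht : 1 / 2 < t) (hr : pressure t < r) :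
    ∃ G : ℝ → ℝ, (∀ x ∈ Icc (0 : ℝ) 1, 1 ≤ G x ∧ G x ≤ G 0 ∧
        G 0 ≤ Real.exp (t * (2 * Real.log 2)) * G x) ∧
      ∀ x ∈ Icc (0 : ℝ) 1,
        transfer t (fun y => ENNReal.ofReal (G y)) x ≤ ENNReal.ofReal (Real.exp r * G x) := by
  have ht0 : 0 ≤ t := by linarith
  set g : ℝ → ENNReal := fun x => ∑' n : ℕ, ENNReal.ofReal (Real.exp (-(n * r))) * Z t n x with hg
  have g_le : ∀ x, 0 ≤ x → g x ≤ g 0 := fun x hx =>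
    ENNReal.tsum_le_tsum fun n => mul_le_mul_right (Z_le_Z_zero ht0 n hx) _
  have g_zero : g 0 ≠ ⊤ := by
    have hs : Summable fun n : ℕ =>
        Real.exp (t * (2 * Real.log 2)) * Real.exp (pressure t - r) ^ n :=
      (summable_geometric_of_lt_one (Real.exp_pos _).le
        (by rw [Real.exp_lt_one_iff]; linarith)).mul_left _
    refine ne_top_of_le_ne_top hs.tsum_ofReal_ne_top (ENNReal.tsum_le_tsum fun n => ?_)
    refine (mul_le_mul_right (Z_le ht n) _).trans ?_
    rw [← ENNReal.ofReal_mul (Real.exp_pos _).le, ← Real.exp_add, ← Real.exp_nat_mul,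
      ← Real.exp_add]
    refine ENNReal.ofReal_le_ofReal (Real.exp_le_exp.mpr (le_of_eq ?_))
    ring
  have g_top : ∀ x, 0 ≤ x → g x ≠ ⊤ := fun x hx => ne_top_of_le_ne_top g_zero (g_le x hx)
  refine ⟨fun x => (g x).toReal, fun x hx => ⟨?_, ?_, ?_⟩, fun x hx => ?_⟩
  · rw [← ENNReal.toReal_one]
    refine ENNReal.toReal_mono (g_top x hx.1) ?_
    refine le_trans ?_ (ENNReal.le_tsum 0)
    simp [Z_zero]
  · exact ENNReal.toReal_mono g_zero (g_le x hx.1)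
  · rw [← ENNReal.toReal_ofReal (Real.exp_pos (t * (2 * Real.log 2))).le, ← ENNReal.toReal_mul]
    refine ENNReal.toReal_mono (ENNReal.mul_ne_top ENNReal.ofReal_ne_top (g_top x hx.1)) ?_
    rw [hg]
    dsimp only
    rw [← ENNReal.tsum_mul_left]
    refine ENNReal.tsum_le_tsum fun n => ?_
    refine (mul_le_mul_right (Z_zero_le ht0 n hx.1 hx.2) _).trans (le_of_eq ?_)
    ring
  · have h1 : transfer t (fun y => ENNReal.ofReal (g y).toReal) x ≤ transfer t g x :=
      transfer_mono (fun y _ => ENNReal.ofReal_toReal_le) hx.1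
    refine h1.trans ?_
    rw [ENNReal.ofReal_mul (Real.exp_pos _).le, ENNReal.ofReal_toReal (g_top x hx.1)]
    have h2 : transfer t g x =
        ∑' n : ℕ, ENNReal.ofReal (Real.exp (-(n * r))) * Z t (n + 1) x := by
      unfold transfer
      rw [hg]
      dsimp only
      simp only [← ENNReal.tsum_mul_left]
      rw [ENNReal.tsum_comm]
      refine tsum_congr fun n => ?_
      rw [Z_succ t n hx.1]
      unfold transfer
      rw [← ENNReal.tsum_mul_left]
      exact tsum_congr fun a => by ring
    rw [h2]
    calc _ ≤ ∑' n : ℕ, ENNReal.ofReal (Real.exp r) *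
          (ENNReal.ofReal (Real.exp (-((n + 1 : ℕ) * r))) * Z t (n + 1) x) := by
          refine ENNReal.tsum_le_tsum fun n => le_of_eq ?_
          rw [← mul_assoc, ← ENNReal.ofReal_mul (Real.exp_pos _).le, ← Real.exp_add]
          congr 3
          push_cast
          ring
      _ ≤ _ := by
          rw [ENNReal.tsum_mul_left]
          refine mul_le_mul_right ?_ _
          exact ENNReal.tsum_comp_le_tsum_of_injective (add_left_injective 1)
            fun n : ℕ => ENNReal.ofReal (Real.exp (-(n * r))) * Z t n x

/-- A quantitative Cauchy–Schwarz inequality with a defect. -/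
lemma tsum_sqrt_mul_le {p q : ℕ → ℝ} (hp : ∀ a, 0 ≤ p a) (hq : ∀ a, 0 ≤ q a)
    (hp1 : ∑' a, ENNReal.ofReal (p a) ≤ 1) (hq1 : ∑' a, ENNReal.ofReal (q a) ≤ 1) {δ : ℝ}
    (hδ0 : 0 ≤ δ) (i : ℕ) (hδ : 2 * δ ≤ (√(p i) - √(q i)) ^ 2) :
    ∑' a, ENNReal.ofReal (√(p a) * √(q a)) ≤ ENNReal.ofReal (1 - δ) := by
  have key : ∑' a, ENNReal.ofReal (√(p a) * √(q a)) + ENNReal.ofReal δ ≤ 1 := by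
    calc _ ≤ ∑' a, ENNReal.ofReal (√(p a) * √(q a)) +
          ∑' a, ENNReal.ofReal ((√(p a) - √(q a)) ^ 2 / 2) := by
          gcongr
          exact (ENNReal.ofReal_le_ofReal (by linarith)).trans (ENNReal.le_tsum i)
      _ = ∑' a, (ENNReal.ofReal (1 / 2) * ENNReal.ofReal (p a) +
          ENNReal.ofReal (1 / 2) * ENNReal.ofReal (q a)) := by
          rw [← ENNReal.tsum_add]
          refine tsum_congr fun a => ?_
          rw [← ENNReal.ofReal_mul (by norm_num), ← ENNReal.ofReal_mul (by norm_num),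
            ← ENNReal.ofReal_add (by positivity) (by positivity),
            ← ENNReal.ofReal_add (mul_nonneg (by norm_num) (hp a))
              (mul_nonneg (by norm_num) (hq a))]
          congr 1
          nlinarith [Real.sq_sqrt (hp a), Real.sq_sqrt (hq a)]
      _ ≤ ENNReal.ofReal (1 / 2) * 1 + ENNReal.ofReal (1 / 2) * 1 := by
          rw [ENNReal.tsum_add, ENNReal.tsum_mul_left, ENNReal.tsum_mul_left]
          gcongr
      _ = 1 := by
          rw [mul_one, ← ENNReal.ofReal_add (by norm_num) (by norm_num)]
          norm_num
  rw [ENNReal.ofReal_sub _ hδ0, ENNReal.ofReal_one]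
  exact ENNReal.le_sub_of_add_le_right ENNReal.ofReal_ne_top key

lemma quarter_le_sq_sqrt_sub {p q : ℝ} (hp : 0 ≤ p) (h : 4 * p ≤ q) :
    q / 4 ≤ (√p - √q) ^ 2 := by
  have hq : 0 ≤ q := by linarith
  have h1 : 2 * √p ≤ √q := by
    rw [show (2 : ℝ) * √p = √(4 * p) by
      rw [Real.sqrt_mul (by norm_num), show (4 : ℝ) = 2 ^ 2 by norm_num,
        Real.sqrt_sq (by norm_num)]]
    exact Real.sqrt_le_sqrt h
  nlinarith [Real.sq_sqrt hp, Real.sq_sqrt hq, Real.sqrt_nonneg p, Real.sqrt_nonneg q]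

lemma branch_mem (a : ℕ) {x : ℝ} (hx : 0 ≤ x) : 1 / ((a : ℝ) + 1 + x) ∈ Icc (0 : ℝ) 1 := by
  refine ⟨by positivity, ?_⟩
  rw [div_le_one (by positivity)]
  linarith [a.cast_nonneg (α := ℝ)]

lemma lg_singleton_mono (a : ℕ) {x y : ℝ} (hx : 0 ≤ x) (hxy : x ≤ y) : lg [a] x ≤ lg [a] y := by
  rw [lg_singleton, lg_singleton]
  exact mul_le_mul_of_nonneg_left (Real.log_le_log (by positivity) (by linarith)) zero_le_two

lemma le_lg_singleton_sub (N : ℕ) {x : ℝ} (hx : 0 ≤ x) (hx1 : x ≤ 1) :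
    2 * Real.log (((N : ℝ) + 2) / 2) ≤ lg [N] x - lg [0] x := by
  rw [lg_singleton, lg_singleton, ← mul_sub, ← Real.log_div (by positivity) (by positivity)]
  refine mul_le_mul_of_nonneg_left (Real.log_le_log (by positivity) ?_) zero_le_two
  rw [div_le_div_iff₀ (by positivity) (by positivity)]
  push_cast
  nlinarith [N.cast_nonneg (α := ℝ)]

/-- The gain in the Cauchy–Schwarz inequality for two superharmonic functions at different
parameters is uniform. -/
lemma exists_uniform_gain {s t : ℝ} (hs : 1 / 2 < s) (hst : s < t) (R S : ℝ) :
    ∃ δ : ℝ, 0 < δ ∧ ∀ (G H : ℝ → ℝ) (r q : ℝ), r ≤ R → q ≤ S →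
      (∀ x ∈ Icc (0 : ℝ) 1, 1 ≤ G x ∧ G x ≤ G 0 ∧
        G 0 ≤ Real.exp (s * (2 * Real.log 2)) * G x) →
      (∀ x ∈ Icc (0 : ℝ) 1, 1 ≤ H x ∧ H x ≤ H 0 ∧
        H 0 ≤ Real.exp (t * (2 * Real.log 2)) * H x) →
      ∀ x ∈ Icc (0 : ℝ) 1, ∃ i : ℕ, 2 * δ ≤
        (√(Real.exp (-s * lg [i] x) * G (1 / ((i : ℝ) + 1 + x)) / (Real.exp r * G x)) -
          √(Real.exp (-t * lg [i] x) * H (1 / ((i : ℝ) + 1 + x)) / (Real.exp q * H x))) ^ 2 := by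
  set D := s * (2 * Real.log 2)
  set E := t * (2 * Real.log 2)
  obtain ⟨N, hN⟩ : ∃ N : ℕ, Real.log 16 + (D + E) ≤
      (t - s) * (2 * Real.log (((N : ℝ) + 2) / 2)) := by
    have h1 : Tendsto (fun N : ℕ => ((N : ℝ) + 2) / 2) atTop atTop :=
      (tendsto_atTop_add_const_right _ _ tendsto_natCast_atTop_atTop).atTop_div_const two_pos
    have h2 : Tendsto (fun N : ℕ => (t - s) * (2 * Real.log (((N : ℝ) + 2) / 2))) atTop atTop :=
      ((Real.tendsto_log_atTop.comp h1).const_mul_atTop two_pos).const_mul_atTop (by linarith)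
    exact (h2.eventually_ge_atTop _).exists
  set d1 := Real.exp (-t * lg [0] 1 - (E + S))
  set d2 := Real.exp (-s * lg [N] 1 - (D + R))
  have hd1 : 0 < d1 := Real.exp_pos _
  have hd2 : 0 < d2 := Real.exp_pos _
  refine ⟨min d1 d2 / 8, by positivity, fun G H r q hr hq hG hH x hx => ?_⟩
  have hm1 := min_le_left d1 d2
  have hm2 := min_le_right d1 d2
  have lower : ∀ (τ C B ρ : ℝ) (F : ℝ → ℝ) (i : ℕ), 1 / 2 < τ → ρ ≤ B →
      (∀ x ∈ Icc (0 : ℝ) 1, 1 ≤ F x ∧ F x ≤ F 0 ∧ F 0 ≤ Real.exp C * F x) →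
      Real.exp (-τ * lg [i] 1 - (C + B)) ≤
        Real.exp (-τ * lg [i] x) * F (1 / ((i : ℝ) + 1 + x)) / (Real.exp ρ * F x) := by
    intro τ C B ρ F i hτ hρ hF
    obtain ⟨a1, a2, a3⟩ := hF x hx
    obtain ⟨b1, b2, b3⟩ := hF _ (branch_mem i hx.1)
    rw [le_div_iff₀ (mul_pos (Real.exp_pos _) (by linarith)), ← mul_assoc, ← Real.exp_add]
    calc _ ≤ Real.exp (-τ * lg [i] x - C) * F x := by
          refine mul_le_mul_of_nonneg_right (Real.exp_le_exp.mpr ?_) (by linarith)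
          nlinarith [lg_singleton_mono i hx.1 hx.2]
      _ ≤ Real.exp (-τ * lg [i] x - C) * (Real.exp C * F (1 / ((i : ℝ) + 1 + x))) :=
          mul_le_mul_of_nonneg_left (a2.trans b3) (Real.exp_pos _).le
      _ = _ := by rw [← mul_assoc, ← Real.exp_add, sub_add_cancel]
  have hGx := hG x hx
  have hHx := hH x hx
  have pos : ∀ (τ ρ : ℝ) (F : ℝ → ℝ) (i : ℕ), (∀ x ∈ Icc (0 : ℝ) 1, 1 ≤ F x) →
      0 < Real.exp (-τ * lg [i] x) * F (1 / ((i : ℝ) + 1 + x)) / (Real.exp ρ * F x) :=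
    fun τ ρ F i h => div_pos (mul_pos (Real.exp_pos _)
      (one_pos.trans_le (h _ (branch_mem i hx.1)))) (mul_pos (Real.exp_pos _)
      (one_pos.trans_le (h x hx)))
  have pG := fun i => pos s r G i fun x hx => (hG x hx).1
  have pH := fun i => pos t q H i fun x hx => (hH x hx).1
  rcases le_or_gt (4 * (Real.exp (-s * lg [0] x) * G (1 / (((0 : ℕ) : ℝ) + 1 + x)) /
      (Real.exp r * G x))) (Real.exp (-t * lg [0] x) * H (1 / (((0 : ℕ) : ℝ) + 1 + x)) /
      (Real.exp q * H x)) with h | h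
  · refine ⟨0, ?_⟩
    have h1 := quarter_le_sq_sqrt_sub (pG 0).le h
    have h2 := lower t E S q H 0 (hs.trans hst) hq hH
    refine le_trans ?_ h1
    linarith
  · refine ⟨N, ?_⟩
    have h2 := lower s D R r G N hs hr hG
    have cross : 16 * (Real.exp (-t * lg [N] x) * H (1 / ((N : ℝ) + 1 + x)) / (Real.exp q * H x) *
        (Real.exp (-s * lg [0] x) * G (1 / (((0 : ℕ) : ℝ) + 1 + x)) / (Real.exp r * G x))) ≤
        Real.exp (-t * lg [0] x) * H (1 / (((0 : ℕ) : ℝ) + 1 + x)) / (Real.exp q * H x) *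
        (Real.exp (-s * lg [N] x) * G (1 / ((N : ℝ) + 1 + x)) / (Real.exp r * G x)) := by
      rw [div_mul_div_comm, div_mul_div_comm, mul_div_assoc']
      refine div_le_div_of_nonneg_right ?_ (by
        have := hGx.1; have := hHx.1; positivity)
      obtain ⟨a1, a2, a3⟩ := hH _ (branch_mem N hx.1)
      obtain ⟨b1, b2, b3⟩ := hH _ (branch_mem 0 hx.1)
      obtain ⟨c1, c2, c3⟩ := hG _ (branch_mem N hx.1)
      obtain ⟨e1, e2, e3⟩ := hG _ (branch_mem 0 hx.1)
      set HN := H (1 / ((N : ℝ) + 1 + x))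
      set H0 := H (1 / (((0 : ℕ) : ℝ) + 1 + x))
      set GN := G (1 / ((N : ℝ) + 1 + x))
      set G0 := G (1 / (((0 : ℕ) : ℝ) + 1 + x))
      have hle := le_lg_singleton_sub N hx.1 hx.2
      calc _ = Real.exp (Real.log 16 - t * lg [N] x - s * lg [0] x) * (HN * G0) := by
            rw [sub_eq_add_neg, sub_eq_add_neg, Real.exp_add, Real.exp_add,
              Real.exp_log (by norm_num), neg_mul, neg_mul]
            ring
        _ ≤ Real.exp (-t * lg [0] x - s * lg [N] x - (D + E)) *
            ((Real.exp E * H0) * (Real.exp D * GN)) := by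
            refine mul_le_mul (Real.exp_le_exp.mpr ?_) (mul_le_mul (a2.trans b3) (e2.trans c3)
              (by linarith) (by positivity)) (by positivity) (Real.exp_pos _).le
            nlinarith [mul_le_mul_of_nonneg_left hle (sub_nonneg.mpr hst.le)]
        _ = _ := by
            rw [show -t * lg [0] x - s * lg [N] x - (D + E) =
              -t * lg [0] x + (-s * lg [N] x) + (-E) + (-D) by ring]
            simp only [Real.exp_add, Real.exp_neg]
            field_simp
    have h1 : (Real.exp (-s * lg [N] x) * G (1 / ((N : ℝ) + 1 + x)) / (Real.exp r * G x)) / 4 ≤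
        (√(Real.exp (-t * lg [N] x) * H (1 / ((N : ℝ) + 1 + x)) / (Real.exp q * H x)) -
        √(Real.exp (-s * lg [N] x) * G (1 / ((N : ℝ) + 1 + x)) / (Real.exp r * G x))) ^ 2 := by
      refine quarter_le_sq_sqrt_sub (pH N).le ?_
      have := pG 0
      have := pG N
      by_contra! hcon
      nlinarith [mul_lt_mul_of_pos_right h (pG N), mul_lt_mul_of_pos_right hcon (pG 0)]
    rw [← neg_sub, neg_sq]
    refine le_trans ?_ h1
    linarith

lemma pressure_midpoint_lt {s t : ℝ} (hs : 1 / 2 < s) (hst : s < t) :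
    pressure ((s + t) / 2) < (pressure s + pressure t) / 2 := by
  have ht : 1 / 2 < t := hs.trans hst
  set m := (s + t) / 2 with hm
  have hm' : 1 / 2 < m := by linarith
  obtain ⟨δ, hδ, hgain⟩ := exists_uniform_gain hs hst (pressure s + 1) (pressure t + 1)
  set κ := max (1 - δ) (1 / 2) with hκ
  have hκ0 : 0 < κ := lt_max_of_lt_right (by norm_num)
  have hκ1 : κ < 1 := max_lt (by linarith) (by norm_num)
  suffices h : ∀ η : ℝ, 0 < η → η ≤ 1 →
      pressure m ≤ Real.log κ + (pressure s + pressure t) / 2 + η by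
    have h1 : pressure m ≤ Real.log κ + (pressure s + pressure t) / 2 := by
      refine le_of_forall_pos_le_add fun η hη => ?_
      exact (h (min η 1) (by positivity) (min_le_right _ _)).trans
        (by linarith [min_le_left η 1])
    linarith [Real.log_neg hκ0 hκ1]
  intro η hη hη1
  set r := pressure s + η
  set q := pressure t + η
  obtain ⟨G, hG, hGs⟩ := exists_superharmonic hs (show pressure s < r by linarith)
  obtain ⟨H, hH, hHs⟩ := exists_superharmonic ht (show pressure t < q by linarith)
  set F : ℝ → ℝ := fun x => √(G x) * √(H x)
  have step : ∀ x ∈ Icc (0 : ℝ) 1, transfer m (fun y => ENNReal.ofReal (F y)) x ≤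
      ENNReal.ofReal (κ * Real.exp ((r + q) / 2) * F x) := by
    intro x hx
    obtain ⟨i, hi⟩ := hgain G H r q (by linarith) (by linarith) hG hH x hx
    have hGp : 0 < G x := one_pos.trans_le (hG x hx).1
    have hHp : 0 < H x := one_pos.trans_le (hH x hx).1
    have hGy := fun a : ℕ => (hG _ (branch_mem a hx.1)).1
    have hHy := fun a : ℕ => (hH _ (branch_mem a hx.1)).1
    have sum1 : ∀ (τ ρ : ℝ) (K : ℝ → ℝ), (∀ x ∈ Icc (0 : ℝ) 1, 1 ≤ K x) →
        transfer τ (fun y => ENNReal.ofReal (K y)) x ≤ ENNReal.ofReal (Real.exp ρ * K x) →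
        ∑' a : ℕ, ENNReal.ofReal (Real.exp (-τ * lg [a] x) * K (1 / ((a : ℝ) + 1 + x)) /
          (Real.exp ρ * K x)) ≤ 1 := by
      intro τ ρ K hK1 hK
      have hc : 0 < Real.exp ρ * K x := mul_pos (Real.exp_pos _) (one_pos.trans_le (hK1 x hx))
      have : ∀ a : ℕ, ENNReal.ofReal (Real.exp (-τ * lg [a] x) * K (1 / ((a : ℝ) + 1 + x)) /
          (Real.exp ρ * K x)) = ENNReal.ofReal (Real.exp ρ * K x)⁻¹ *
          (ENNReal.ofReal (Real.exp (-τ * lg [a] x)) *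
            ENNReal.ofReal (K (1 / ((a : ℝ) + 1 + x)))) := by
        intro a
        rw [← ENNReal.ofReal_mul (Real.exp_pos _).le, ← ENNReal.ofReal_mul (by positivity)]
        congr 1
        ring
      rw [tsum_congr this, ENNReal.tsum_mul_left]
      refine (mul_le_mul_right hK _).trans (le_of_eq ?_)
      rw [← ENNReal.ofReal_mul (by positivity), inv_mul_cancel₀ hc.ne', ENNReal.ofReal_one]
    have h := tsum_sqrt_mul_le
      (fun a => div_nonneg (mul_nonneg (Real.exp_pos _).le (zero_le_one.trans (hGy a)))
        (mul_pos (Real.exp_pos r) hGp).le)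
      (fun a => div_nonneg (mul_nonneg (Real.exp_pos _).le (zero_le_one.trans (hHy a)))
        (mul_pos (Real.exp_pos q) hHp).le)
      (sum1 s r G (fun x hx => (hG x hx).1) (hGs x hx))
      (sum1 t q H (fun x hx => (hH x hx).1) (hHs x hx)) hδ.le i hi
    calc transfer m (fun y => ENNReal.ofReal (F y)) x
        = ENNReal.ofReal (Real.exp ((r + q) / 2) * F x) * ∑' a : ℕ, ENNReal.ofReal
          (√(Real.exp (-s * lg [a] x) * G (1 / ((a : ℝ) + 1 + x)) / (Real.exp r * G x)) *
          √(Real.exp (-t * lg [a] x) * H (1 / ((a : ℝ) + 1 + x)) / (Real.exp q * H x))) := by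
          unfold transfer
          rw [← ENNReal.tsum_mul_left]
          refine tsum_congr fun a => ?_
          rw [← ENNReal.ofReal_mul (Real.exp_pos _).le, ← ENNReal.ofReal_mul (by positivity)]
          congr 1
          have e1 : √(Real.exp (-s * lg [a] x)) * √(Real.exp (-t * lg [a] x)) =
              Real.exp (-m * lg [a] x) := by
            rw [Real.sqrt_eq_rpow, Real.sqrt_eq_rpow, ← Real.exp_mul, ← Real.exp_mul,
              ← Real.exp_add, hm]
            congr 1
            ring
          have e2 : √(Real.exp r) * √(Real.exp q) = Real.exp ((r + q) / 2) := by
            rw [Real.sqrt_eq_rpow, Real.sqrt_eq_rpow, ← Real.exp_mul, ← Real.exp_mul,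
              ← Real.exp_add]
            congr 1
            ring
          have hG0 := zero_le_one.trans (hGy a)
          have hH0 := zero_le_one.trans (hHy a)
          rw [Real.sqrt_div (by positivity), Real.sqrt_div (by positivity),
            Real.sqrt_mul (Real.exp_pos _).le, Real.sqrt_mul (Real.exp_pos _).le,
            Real.sqrt_mul (Real.exp_pos _).le, Real.sqrt_mul (Real.exp_pos _).le,
            ← e1, ← e2]
          have := Real.sqrt_pos.mpr hGp
          have := Real.sqrt_pos.mpr hHp
          have := Real.sqrt_pos.mpr (Real.exp_pos r)
          have := Real.sqrt_pos.mpr (Real.exp_pos q)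
          simp only [F]
          field_simp
      _ ≤ ENNReal.ofReal (Real.exp ((r + q) / 2) * F x) * ENNReal.ofReal κ :=
          mul_le_mul_right (h.trans (ENNReal.ofReal_le_ofReal (le_max_left _ _))) _
      _ = _ := by
          rw [← ENNReal.ofReal_mul (by positivity)]
          congr 1
          ring
  have iter : ∀ n : ℕ, ∀ x ∈ Icc (0 : ℝ) 1,
      Z m n x ≤ ENNReal.ofReal ((κ * Real.exp ((r + q) / 2)) ^ n * F x) := by
    intro n
    induction n with
    | zero =>
      intro x hx
      rw [Z_zero, pow_zero, one_mul, ← ENNReal.ofReal_one]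
      refine ENNReal.ofReal_le_ofReal ?_
      exact one_le_mul_of_one_le_of_one_le (Real.one_le_sqrt.mpr (hG x hx).1)
        (Real.one_le_sqrt.mpr (hH x hx).1)
    | succ n ih =>
      intro x hx
      rw [Z_succ m n hx.1]
      refine (transfer_mono ih hx.1).trans ?_
      simp only [ENNReal.ofReal_mul (pow_nonneg (mul_nonneg hκ0.le (Real.exp_pos _).le) n)]
      rw [transfer_const_mul]
      refine (mul_le_mul_right (step x hx) _).trans (le_of_eq ?_)
      rw [← ENNReal.ofReal_mul (by positivity)]
      congr 1
      ring
  have hF0 : 0 < F 0 := mul_pos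
    (Real.sqrt_pos.mpr (one_pos.trans_le (hG 0 ⟨le_rfl, zero_le_one⟩).1))
    (Real.sqrt_pos.mpr (one_pos.trans_le (hH 0 ⟨le_rfl, zero_le_one⟩).1))
  have := pressure_le (a := Real.log κ + (r + q) / 2) (c := Real.log (F 0)) hm' fun n => ?_
  · linarith
  · refine (iter n 0 ⟨le_rfl, zero_le_one⟩).trans (ENNReal.ofReal_le_ofReal (le_of_eq ?_))
    rw [Real.exp_add, Real.exp_log hF0, Real.exp_nat_mul, Real.exp_add, Real.exp_log hκ0]

open Real in
lemma den_replicate_zero (n : ℕ) :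
    mob (List.replicate n 0) goldenRatio⁻¹ = goldenRatio⁻¹ ∧
      den (List.replicate n 0) goldenRatio⁻¹ = goldenRatio ^ n := by
  have hφ := goldenRatio_pos
  have hsq := goldenRatio_sq
  have h1 : 1 + goldenRatio⁻¹ = goldenRatio := by
    rw [← mul_right_inj' hφ.ne', mul_add, mul_inv_cancel₀ hφ.ne']
    linarith
  induction n with
  | zero => simp [mob, den]
  | succ n ih =>
    rw [List.replicate_succ]
    simp only [mob, den, ih, Nat.cast_zero, zero_add, h1, one_div, pow_succ]
    exact ⟨trivial, by ring⟩

open Real in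
/-- The minimal Lyapunov exponent. -/
noncomputable def minExp : ℝ := 2 * log goldenRatio

lemma minExp_pos : 0 < minExp := mul_pos two_pos (Real.log_pos Real.one_lt_goldenRatio)

lemma lg_replicate_zero_le (n : ℕ) : lg (List.replicate n 0) 0 ≤ n * minExp := by
  refine (lg_zero_le _ (inv_nonneg.mpr Real.goldenRatio_pos.le)).trans (le_of_eq ?_)
  rw [lg, (den_replicate_zero n).2, Real.log_pow, minExp]
  ring

lemma neg_mul_minExp_le_pressure {t : ℝ} (ht : 1 / 2 < t) : -(t * minExp) ≤ pressure t := by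
  refine le_pressure (c := 0) ht fun n => ?_
  refine le_trans ?_ (ENNReal.le_tsum fun _ : Fin n => 0)
  refine ENNReal.ofReal_le_ofReal (Real.exp_le_exp.mpr ?_)
  rw [List.ofFn_const]
  nlinarith [lg_replicate_zero_le n]

lemma pressure_continuousOn : ContinuousOn pressure (Ioi (1 / 2)) :=
  pressure_convexOn.continuousOn isOpen_Ioi

lemma exists_minimizer {β : ℝ} (hβ : minExp < β) :
    ∃ s, 1 / 2 < s ∧ ∀ t, 1 / 2 < t → pressure s + s * β ≤ pressure t + t * β := by
  have hβ0 : 0 < β := minExp_pos.trans hβ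
  obtain ⟨r, hr, hrP⟩ := exists_forall_le_pressure (pressure 1 + β)
  set T := max 1 ((pressure 1 + β) / (β - minExp))
  have hr' : 1 / 2 < min r 1 := lt_min hr (by norm_num)
  have hrT : min r 1 ≤ T := (min_le_right _ _).trans (le_max_left _ _)
  have hsub : Icc (min r 1) T ⊆ Ioi (1 / 2) := fun t ht => hr'.trans_le ht.1
  obtain ⟨s, hs, hmin⟩ := isCompact_Icc.exists_isMinOn (nonempty_Icc.mpr hrT)
    (f := fun t => pressure t + t * β)
    ((pressure_continuousOn.mono hsub).add (by fun_prop))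
  have h1 := hmin (show (1 : ℝ) ∈ Icc (min r 1) T from ⟨min_le_right _ _, le_max_left _ _⟩)
  simp only [one_mul, mem_ofPred_eq] at h1
  refine ⟨s, hsub hs, fun t ht => ?_⟩
  by_cases htr : t < min r 1
  · have := hrP t ht (htr.le.trans (min_le_left _ _))
    nlinarith [mul_pos (by linarith : 0 < t) hβ0]
  · by_cases htT : t ≤ T
    · exact hmin ⟨not_lt.mp htr, htT⟩
    · have h2 : (pressure 1 + β) / (β - minExp) ≤ t :=
        (le_max_right _ _).trans (not_le.mp htT).le
      rw [div_le_iff₀ (by linarith)] at h2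
      linarith [neg_mul_minExp_le_pressure ht]

/-- The Legendre transform of the pressure. -/
noncomputable def legendre (β : ℝ) : ℝ := sInf ((fun t => pressure t + t * β) '' Ioi (1 / 2))

lemma legendre_eq {β s : ℝ} (hs : 1 / 2 < s)
    (h : ∀ t, 1 / 2 < t → pressure s + s * β ≤ pressure t + t * β) :
    legendre β = pressure s + s * β :=
  IsLeast.csInf_eq ⟨⟨s, hs, rfl⟩, by rintro _ ⟨t, ht, rfl⟩; exact h t ht⟩

lemma legendre_le {β t : ℝ} (hβ : minExp < β) (ht : 1 / 2 < t) :
    legendre β ≤ pressure t + t * β := by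
  obtain ⟨s, hs, h⟩ := exists_minimizer hβ
  rw [legendre_eq hs h]
  exact h t ht

lemma legendre_pos {β : ℝ} (hβ : minExp < β) : 0 < legendre β := by
  obtain ⟨s, hs, h⟩ := exists_minimizer hβ
  rw [legendre_eq hs h]
  nlinarith [neg_mul_minExp_le_pressure hs]

lemma minimizer_strict {α s : ℝ} (hs : 1 / 2 < s)
    (h : ∀ t, 1 / 2 < t → pressure s + s * α ≤ pressure t + t * α) {t : ℝ} (ht : 1 / 2 < t)
    (hne : t ≠ s) : pressure s + s * α < pressure t + t * α := by
  rcases lt_or_gt_of_ne hne with hlt | hlt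
  · have h1 := pressure_midpoint_lt ht hlt
    have h2 := h ((t + s) / 2) (by linarith)
    linarith
  · have h1 := pressure_midpoint_lt hs hlt
    have h2 := h ((s + t) / 2) (by linarith)
    linarith

lemma exists_linear_growth {α s ε : ℝ} (hs : 1 / 2 < s)
    (h : ∀ t, 1 / 2 < t → pressure s + s * α ≤ pressure t + t * α) (hε : 0 < ε) :
    ∃ c : ℝ, 0 < c ∧ ∀ t, 1 / 2 < t → ε ≤ |t - s| →
      pressure s + s * α + c * |t - s| ≤ pressure t + t * α := by
  wlog hsε : 1 / 2 < s - ε generalizing ε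
  · obtain ⟨c, hc, H⟩ := this (ε := (s - 1 / 2) / 2) (by linarith) (by linarith)
    exact ⟨c, hc, fun t ht hts => H t ht (by linarith)⟩
  set g : ℝ → ℝ := fun t => pressure t + t * α
  have hconv : ConvexOn ℝ (Ioi (1 / 2)) g := by
    refine pressure_convexOn.add ⟨convex_Ioi _, fun x _ y _ a b _ _ _ => le_of_eq ?_⟩
    simp only [smul_eq_mul]
    ring
  have h1 : 0 < g (s - ε) - g s :=
    sub_pos.mpr (minimizer_strict hs h hsε (by linarith))
  have h2 : 0 < g (s + ε) - g s :=
    sub_pos.mpr (minimizer_strict hs h (by linarith) (by linarith))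
  refine ⟨min ((g (s - ε) - g s) / ε) ((g (s + ε) - g s) / ε), by positivity,
    fun t ht hts => ?_⟩
  have hm1 := min_le_left ((g (s - ε) - g s) / ε) ((g (s + ε) - g s) / ε)
  have hm2 := min_le_right ((g (s - ε) - g s) / ε) ((g (s + ε) - g s) / ε)
  change g s + _ ≤ g t
  rcases le_total s t with hst | hst
  · rw [abs_of_nonneg (by linarith)] at hts ⊢
    have h3 := hconv.secant_mono (a := s) (x := s + ε) (y := t) hs
      (show 1 / 2 < s + ε by linarith) ht (by linarith) (by linarith) (by linarith)
    rw [add_sub_cancel_left] at h3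
    have h4 := hm2.trans h3
    rw [le_div_iff₀ (by linarith)] at h4
    linarith
  · rw [abs_of_nonpos (by linarith)] at hts ⊢
    have h3 := hconv.secant_mono (a := s) (x := t) (y := s - ε) hs ht hsε
      (by linarith) (by linarith) (by linarith)
    rw [show s - ε - s = -ε by ring, div_neg] at h3
    have h4 : min ((g (s - ε) - g s) / ε) ((g (s + ε) - g s) / ε) ≤ (g t - g s) / (s - t) := by
      rw [← neg_sub t s, div_neg]
      linarith
    rw [le_div_iff₀ (by linarith)] at h4
    linarith

lemma hasDerivAt_legendre {α s : ℝ} (hα : minExp < α) (hs : 1 / 2 < s)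
    (h : ∀ t, 1 / 2 < t → pressure s + s * α ≤ pressure t + t * α) :
    HasDerivAt legendre s α := by
  rw [hasDerivAt_iff_isLittleO, Asymptotics.isLittleO_iff]
  intro ε hε
  obtain ⟨c, hc, hgrow⟩ := exists_linear_growth hs h hε
  have h1 : ∀ᶠ β in nhds α, minExp < β := eventually_gt_nhds hα
  filter_upwards [h1, Metric.ball_mem_nhds α hc] with β hβ hβc
  rw [Metric.mem_ball, Real.dist_eq] at hβc
  obtain ⟨t, ht, hmin⟩ := exists_minimizer hβ
  rw [legendre_eq hs h, legendre_eq ht hmin, smul_eq_mul, Real.norm_eq_abs, Real.norm_eq_abs]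
  have up := hmin s hs
  have low := h t ht
  have hts : |t - s| ≤ ε := by
    by_contra! hcon
    have h2 := hgrow t ht hcon.le
    have h3 : c * |t - s| ≤ |β - α| * |t - s| := by
      rw [← abs_mul, mul_comm]
      refine le_trans ?_ (neg_le_abs _)
      linarith
    nlinarith [hε.trans hcon]
  have h4 : |(β - α) * (t - s)| ≤ |β - α| * ε := by
    rw [abs_mul]
    exact mul_le_mul_of_nonneg_left hts (abs_nonneg _)
  rw [abs_le] at h4 ⊢
  constructor <;> nlinarith

lemma two_div_mul_log_qDen {x : ℝ} (hx : IrrUnit x) (n : ℕ) :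
    2 / (n : ℝ) * Real.log (qDen n x) = lg (letters n x) 0 / n := by
  rw [qDen_eq hx, lg]
  ring

lemma mem_levelSet_iff {β x : ℝ} : x ∈ levelSet (β : EReal) ↔
    IrrUnit x ∧ Tendsto (fun n : ℕ => lg (letters n x) 0 / n) atTop (nhds β) := by
  constructor
  · rintro ⟨h1, h2, h3, h4⟩
    refine ⟨⟨h1, h2⟩, ?_⟩
    have h := tendsto_of_liminf_eq_limsup h3 h4
    rw [EReal.tendsto_coe] at h
    exact h.congr fun n => two_div_mul_log_qDen ⟨h1, h2⟩ n
  · rintro ⟨hx, h⟩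
    have h' : Tendsto (fun n : ℕ => ((2 / (n : ℝ) * Real.log (qDen n x) : ℝ) : EReal)) atTop
        (nhds (β : EReal)) := by
      rw [EReal.tendsto_coe]
      exact h.congr fun n => (two_div_mul_log_qDen hx n).symm
    exact ⟨hx.1, hx.2, h'.liminf_eq, h'.limsup_eq⟩

/-- Points whose Lyapunov sums are `ε`-close to the slope `β` from time `N` on. -/
def nearSet (β ε : ℝ) (N : ℕ) : Set ℝ :=
  {x | IrrUnit x ∧ ∀ n : ℕ, N ≤ n → |lg (letters n x) 0 - β * n| ≤ ε * n}

lemma levelSet_subset_iUnion_nearSet {β ε : ℝ} (hε : 0 < ε) :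
    levelSet (β : EReal) ⊆ ⋃ N, nearSet β ε N := by
  intro x hx
  obtain ⟨hx, h⟩ := mem_levelSet_iff.mp hx
  obtain ⟨N, hN⟩ := eventually_atTop.mp (h.eventually (Metric.ball_mem_nhds β hε))
  refine mem_iUnion.mpr ⟨N + 1, hx, fun n hn => ?_⟩
  have h1 := hN n (by omega)
  have hn0 : (0 : ℝ) < n := by exact_mod_cast (by omega : 0 < n)
  rw [Real.dist_eq] at h1
  have h2 : lg (letters n x) 0 - β * n = (lg (letters n x) 0 / n - β) * n := by
    field_simp
  rw [h2, abs_mul, abs_of_pos hn0]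
  exact mul_le_mul_of_nonneg_right h1.le hn0.le

lemma hausdorffMeasure_nearSet_ne_top {β ε t s : ℝ} (ht : 1 / 2 < t) (hs : 0 < s)
    (hε : ε < β) (h : pressure t + |s - t| * ε ≤ (s - t) * β) (N : ℕ) :
    μH[s] (nearSet β ε N) ≠ ⊤ := by
  have lgw : ∀ {n : ℕ} (w : Fin n → ℕ) {x : ℝ}, N ≤ n → x ∈ cyl (List.ofFn w) ∩ nearSet β ε N →
      |lg (List.ofFn w) 0 - β * n| ≤ ε * n := by
    intro n w x hn hx
    have h1 := hx.2.2 n hn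
    have h2 := hx.1.2
    rw [List.length_ofFn] at h2
    rwa [h2] at h1
  have ediam_le : ∀ {n : ℕ} (w : Fin n → ℕ),
      Metric.ediam (cyl (List.ofFn w) ∩ nearSet β ε N) ≤
        ENNReal.ofReal (Real.exp (-lg (List.ofFn w) 0)) := fun w => by
    rw [← inv_den_sq]
    exact (Metric.ediam_mono inter_subset_left).trans (ediam_cyl_le _)
  refine ne_top_of_le_ne_top (b := ENNReal.ofReal (Real.exp (t * (2 * Real.log 2))))
    ENNReal.ofReal_ne_top ?_
  refine (Measure.hausdorffMeasure_le_liminf_tsum (l := atTop) s (nearSet β ε N)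
    (fun n : ℕ => ENNReal.ofReal (Real.exp (-(β - ε)) ^ n)) ?_
    (fun n (w : Fin n → ℕ) => cyl (List.ofFn w) ∩ nearSet β ε N) ?_ ?_).trans ?_
  · rw [← ENNReal.ofReal_zero]
    exact ENNReal.tendsto_ofReal (tendsto_pow_atTop_nhds_zero_of_lt_one (Real.exp_pos _).le
      (by rw [Real.exp_lt_one_iff]; linarith))
  · filter_upwards [eventually_ge_atTop N] with n hn w
    rcases (cyl (List.ofFn w) ∩ nearSet β ε N).eq_empty_or_nonempty with he | ⟨x, hx⟩
    · simp [he]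
    · refine (ediam_le w).trans (ENNReal.ofReal_le_ofReal ?_)
      rw [← Real.exp_nat_mul]
      refine Real.exp_le_exp.mpr ?_
      have := (abs_le.mp (lgw w hn hx)).1
      linarith
  · filter_upwards with n x hx
    obtain ⟨w, hw⟩ := exists_ofFn_letters n x
    exact mem_iUnion.mpr ⟨w, ⟨hx.1, by rw [List.length_ofFn, hw]⟩, hx⟩
  · have hev : ∀ᶠ n : ℕ in atTop,
        ∑' w : Fin n → ℕ, Metric.ediam (cyl (List.ofFn w) ∩ nearSet β ε N) ^ s ≤
          ENNReal.ofReal (Real.exp (t * (2 * Real.log 2))) := by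
      filter_upwards [eventually_ge_atTop N] with n hn
      have term : ∀ w : Fin n → ℕ,
          Metric.ediam (cyl (List.ofFn w) ∩ nearSet β ε N) ^ s ≤
            ENNReal.ofReal (Real.exp (-(n * pressure t))) *
              ENNReal.ofReal (Real.exp (-t * lg (List.ofFn w) 0)) := by
        intro w
        rcases (cyl (List.ofFn w) ∩ nearSet β ε N).eq_empty_or_nonempty with he | ⟨x, hx⟩
        · simp [he, hs]
        · refine (ENNReal.rpow_le_rpow (ediam_le w) hs.le).trans ?_
          rw [ENNReal.ofReal_rpow_of_pos (Real.exp_pos _), ← Real.exp_mul,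
            ← ENNReal.ofReal_mul (Real.exp_pos _).le, ← Real.exp_add]
          refine ENNReal.ofReal_le_ofReal (Real.exp_le_exp.mpr ?_)
          have h1 := mul_le_mul_of_nonneg_left (lgw w hn hx) (abs_nonneg (s - t))
          rw [← abs_mul] at h1
          have h2 := (abs_le.mp h1).1
          nlinarith [mul_le_mul_of_nonneg_left h (n.cast_nonneg (α := ℝ))]
      refine (ENNReal.tsum_le_tsum term).trans ?_
      rw [ENNReal.tsum_mul_left]
      refine (mul_le_mul_right (Z_le ht n) _).trans (le_of_eq ?_)
      rw [← ENNReal.ofReal_mul (Real.exp_pos _).le, ← Real.exp_add]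
      congr 2
      ring
    exact (liminf_le_liminf hev).trans (le_of_eq (liminf_const _))

lemma dimH_levelSet_le {β t s : ℝ} (hβ : 0 < β) (ht : 1 / 2 < t) (hs : 0 < s)
    (h : pressure t + t * β < s * β) :
    dimH (levelSet (β : EReal)) ≤ ENNReal.ofReal s := by
  obtain ⟨ε, hε, h1, h2⟩ : ∃ ε : ℝ, 0 < ε ∧ ε < β ∧ pressure t + |s - t| * ε ≤ (s - t) * β := by
    have hd : 0 < (s - t) * β - pressure t := by linarith
    refine ⟨min (β / 2) (((s - t) * β - pressure t) / (|s - t| + 1)), by positivity,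
      (min_le_left _ _).trans_lt (by linarith), ?_⟩
    have h3 := min_le_right (β / 2) (((s - t) * β - pressure t) / (|s - t| + 1))
    rw [le_div_iff₀ (by positivity)] at h3
    have : 0 ≤ min (β / 2) (((s - t) * β - pressure t) / (|s - t| + 1)) := by positivity
    linarith
  refine (dimH_mono (levelSet_subset_iUnion_nearSet hε)).trans ?_
  rw [dimH_iUnion]
  refine iSup_le fun N => ?_
  refine dimH_le_of_hausdorffMeasure_ne_top (d := s.toNNReal) ?_
  rw [Real.coe_toNNReal s hs.le]
  exact hausdorffMeasure_nearSet_ne_top ht hs h1 h2 N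

lemma dimH_levelSet_le_legendre {β : ℝ} (hβ : minExp < β) :
    dimH (levelSet (β : EReal)) ≤ ENNReal.ofReal (legendre β / β) := by
  have hβ0 := minExp_pos.trans hβ
  obtain ⟨t, ht, hmin⟩ := exists_minimizer hβ
  have hpos := legendre_pos hβ
  rw [legendre_eq ht hmin] at hpos ⊢
  set a := (pressure t + t * β) / β
  have ha : 0 < a := div_pos hpos hβ0
  have key : ∀ s : ℝ, a < s → dimH (levelSet (β : EReal)) ≤ ENNReal.ofReal s := fun s hs =>
    dimH_levelSet_le hβ0 ht (ha.trans hs) ((div_lt_iff₀ hβ0).mp hs)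
  refine ge_of_tendsto (ENNReal.tendsto_ofReal
    (tendsto_id.mono_left nhdsWithin_le_nhds : Tendsto id (nhdsWithin a (Ioi a)) (nhds a))) ?_
  filter_upwards [self_mem_nhdsWithin] with s hs
  exact key s hs

lemma continuousOn_mob (w : List ℕ) : ContinuousOn (mob w) (Icc 0 1) := by
  refine (LipschitzOnWith.of_dist_le_mul (K := 1) fun x hx y hy => ?_).continuousOn
  rw [Real.dist_eq, Real.dist_eq, abs_mob_sub w hx.1 hy.1, NNReal.coe_one, one_mul]
  exact div_le_self (abs_nonneg _)
    (one_le_mul_of_one_le_of_one_le (one_le_den w hx.1) (one_le_den w hy.1))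

lemma injOn_mob (w : List ℕ) : InjOn (mob w) (Icc 0 1) := by
  intro x hx y hy h
  have h1 := abs_mob_sub w hx.1 hy.1
  rw [h, sub_self, abs_zero, eq_comm, div_eq_zero_iff] at h1
  rcases h1 with h1 | h1
  · exact sub_eq_zero.mp (abs_eq_zero.mp h1)
  · exact absurd h1 (mul_pos (den_pos w hx.1) (den_pos w hy.1)).ne'

lemma mob_mem_Icc (w : List ℕ) {x : ℝ} (hx : x ∈ Icc (0 : ℝ) 1) : mob w x ∈ Icc (0 : ℝ) 1 :=
  ⟨mob_nonneg w hx.1, mob_le_one w hx.1 hx.2⟩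

/-- An infinite concatenation of words is the expansion of an irrational point. -/
lemma exists_point {v b : ℕ → List ℕ} (hv : ∀ k, v (k + 1) = v k ++ b k)
    (hb : ∀ k, b k ≠ []) :
    ∃ x, IrrUnit x ∧ ∃ y : ℕ → ℝ, ∀ k, y k ∈ Ioo (0 : ℝ) 1 ∧ mob (v k) (y k) = x ∧
      mob (b k) (y (k + 1)) = y k := by
  obtain ⟨x, hx⟩ : (⋂ k, mob (v k) '' Icc 0 1).Nonempty := by
    refine IsCompact.nonempty_iInter_of_sequence_nonempty_isCompact_isClosed _ (fun k => ?_)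
      (fun k => (nonempty_Icc.mpr zero_le_one).image _)
      (isCompact_Icc.image_of_continuousOn (continuousOn_mob _))
      (fun k => (isCompact_Icc.image_of_continuousOn (continuousOn_mob _)).isClosed)
    rintro _ ⟨y, hy, rfl⟩
    rw [hv, mob_append]
    exact ⟨_, mob_mem_Icc _ hy, rfl⟩
  simp only [mem_iInter, mem_image] at hx
  choose y hy hxy using hx
  have step : ∀ k, mob (b k) (y (k + 1)) = y k := fun k => by
    refine injOn_mob (v k) (mob_mem_Icc _ (hy _)) (hy k) ?_
    rw [← mob_append, ← hv, hxy, hxy]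
  have pos : ∀ k, 0 < y k := fun k => by
    rw [← step k]
    obtain ⟨a, w, haw⟩ := List.exists_cons_of_ne_nil (hb k)
    rw [haw]
    exact mob_cons_pos a w (hy _).1
  have lt : ∀ k, y k < 1 := fun k => by
    rw [← step k]
    obtain ⟨a, w, haw⟩ := List.exists_cons_of_ne_nil (hb k)
    rw [haw]
    exact mob_cons_lt_one a w (pos _)
  have mem : ∀ k, y k ∈ Ioo (0 : ℝ) 1 := fun k => ⟨pos k, lt k⟩
  have len : ∀ k, k ≤ (v k).length := fun k => by
    induction k with
    | zero => exact Nat.zero_le _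
    | succ k ih =>
      rw [hv, List.length_append]
      have := List.length_pos_of_ne_nil (hb k)
      omega
  refine ⟨x, ⟨?_, irrational_of_iterate_mem fun n => ?_⟩, y, fun k => ⟨mem k, hxy k, step k⟩⟩
  · rw [← hxy 0]
    exact mob_mem _ (mem 0)
  · have h1 : x = mob ((v n).take n) (mob ((v n).drop n) (y n)) := by
      rw [← mob_append, List.take_append_drop, hxy]
    have h2 := iterate_mob ((v n).take n) (mob_mem ((v n).drop n) (mem n))
    rw [List.length_take, min_eq_left (len n), ← h1] at h2
    rw [h2]
    exact mob_mem _ (mem n)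

lemma mob_mem_core {B : ℝ} (hB : 1 ≤ B) (w : List ℕ) (hw : ∀ a ∈ w, (a : ℝ) + 2 ≤ B) {z : ℝ}
    (hz : z ∈ Icc (1 / B) (B / (B + 1))) : mob w z ∈ Icc (1 / B) (B / (B + 1)) := by
  induction w with
  | nil => exact hz
  | cons a w ih =>
    obtain ⟨h1, h2⟩ := ih fun a ha => hw a (List.mem_cons_of_mem _ ha)
    have ha := hw a List.mem_cons_self
    have h3 : B / (B + 1) ≤ 1 := by rw [div_le_one (by linarith)]; linarith
    have h4 : 0 < 1 / B := by positivity
    simp only [mob]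
    have h5 : (0 : ℝ) ≤ a := a.cast_nonneg
    constructor
    · exact one_div_le_one_div_of_le (by linarith) (by linarith)
    · calc 1 / ((a : ℝ) + 1 + mob w z) ≤ 1 / (1 + 1 / B) :=
          one_div_le_one_div_of_le (by linarith) (by linarith)
        _ = B / (B + 1) := by field_simp

lemma mob_separation {B : ℝ} (hB : 1 ≤ B) (w w' : List ℕ) (hlen : w.length = w'.length)
    (hne : w ≠ w') (hw : ∀ a ∈ w, (a : ℝ) + 2 ≤ B) (hw' : ∀ a ∈ w', (a : ℝ) + 2 ≤ B) {z z' : ℝ}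
    (hz : z ∈ Icc (1 / B) (B / (B + 1))) (hz' : z' ∈ Icc (1 / B) (B / (B + 1))) :
    ((B ^ 2)⁻¹) ^ w.length * (B + 1)⁻¹ ≤ |mob w z - mob w' z'| := by
  induction w generalizing w' with
  | nil => exact absurd (List.length_eq_zero_iff.mp hlen.symm).symm hne
  | cons a w ih =>
    cases w' with
    | nil => simp at hlen
    | cons a' w' =>
      have hwm : ∀ a ∈ w, (a : ℝ) + 2 ≤ B := fun a ha => hw a (List.mem_cons_of_mem _ ha)
      have hwm' : ∀ a ∈ w', (a : ℝ) + 2 ≤ B := fun a ha => hw' a (List.mem_cons_of_mem _ ha)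
      have ha := hw a List.mem_cons_self
      have ha' := hw' a' List.mem_cons_self
      have t1 := mob_mem_core hB w hwm hz
      have t1' := mob_mem_core hB w' hwm' hz'
      have hB0 : 0 < B := by linarith
      have h3 : B / (B + 1) = 1 - (B + 1)⁻¹ := by field_simp; ring
      have h4 : 0 < 1 / B := by positivity
      have h6 : 0 < (B + 1)⁻¹ := by positivity
      set t := mob w z with ht
      set t' := mob w' z' with ht'
      have p1 : 0 < (a : ℝ) + 1 + t := by have := a.cast_nonneg (α := ℝ); linarith [t1.1]
      have p2 : 0 < (a' : ℝ) + 1 + t' := by have := a'.cast_nonneg (α := ℝ); linarith [t1'.1]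
      have q1 : (a : ℝ) + 1 + t ≤ B := by linarith [t1.2]
      have q2 : (a' : ℝ) + 1 + t' ≤ B := by linarith [t1'.2]
      have key : |((a' : ℝ) + 1 + t') - (a + 1 + t)| * (B ^ 2)⁻¹ ≤
          |mob (a :: w) z - mob (a' :: w') z'| := by
        simp only [mob]
        rw [← ht, ← ht', div_sub_div _ _ p1.ne' p2.ne', abs_div, abs_of_pos (mul_pos p1 p2),
          one_mul, mul_one, div_eq_mul_inv]
        refine mul_le_mul_of_nonneg_left (inv_anti₀ (mul_pos p1 p2) ?_) (abs_nonneg _)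
        rw [sq]
        exact mul_le_mul q1 q2 p2.le hB0.le
      refine le_trans ?_ key
      rw [List.length_cons, pow_succ, mul_assoc, mul_comm ((B ^ 2)⁻¹), ← mul_assoc]
      refine mul_le_mul_of_nonneg_right ?_ (by positivity)
      by_cases haa : a = a'
      · subst haa
        have hne' : w ≠ w' := fun h => hne (by rw [h])
        refine (ih w' (by simpa using hlen) hne' hwm hwm').trans (le_of_eq ?_)
        rw [abs_sub_comm]
        congr 1
        ring
      · have h7 : ((B ^ 2)⁻¹) ^ w.length ≤ 1 :=
          pow_le_one₀ (by positivity) (inv_le_one_of_one_le₀ (one_le_pow₀ hB))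
        refine (mul_le_of_le_one_left h6.le h7).trans ?_
        rcases lt_or_gt_of_ne haa with h | h
        · have : (a : ℝ) + 1 ≤ a' := by exact_mod_cast h
          exact le_trans (by linarith [t1.2, t1'.1]) (le_abs_self _)
        · have : (a' : ℝ) + 1 ≤ a := by exact_mod_cast h
          exact le_trans (by linarith [t1'.2, t1.1]) (neg_le_abs _)

/-- Two families of `M` words of length `L`, one pushing the Lyapunov sums above the slope `β`,
the other one pushing them below. -/
structure Blocks (β : ℝ) (L M : ℕ) where
  up : Fin M → List ℕ
  down : Fin M → List ℕ
  up_injective : Function.Injective up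
  down_injective : Function.Injective down
  length_up : ∀ i, (up i).length = L
  length_down : ∀ i, (down i).length = L
  le_lg_up : ∀ i, β * L ≤ lg (up i) 0
  lg_down_le : ∀ i, lg (down i) 0 + 2 * Real.log 2 ≤ β * L

namespace Blocks

variable {β : ℝ} {L M : ℕ} (F : Blocks β L M)

open Classical in
/-- The next block: chosen so as to steer the Lyapunov sum towards the slope `β`. -/
noncomputable def next (u : List ℕ) (i : Fin M) : List ℕ :=
  if lg u 0 ≤ β * u.length then F.up i else F.down i

/-- The word coded by the first `k` symbols of `ω`. -/
noncomputable def word (ω : ℕ → Fin M) : ℕ → List ℕ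
  | 0 => []
  | k + 1 => word ω k ++ F.next (word ω k) (ω k)

lemma length_next (u : List ℕ) (i : Fin M) : (F.next u i).length = L := by
  unfold next
  split_ifs
  exacts [F.length_up i, F.length_down i]

lemma next_injective (u : List ℕ) : Function.Injective (F.next u) := by
  unfold next
  split_ifs
  exacts [F.up_injective, F.down_injective]

lemma length_word (ω : ℕ → Fin M) (k : ℕ) : (F.word ω k).length = k * L := by
  induction k with
  | zero => simp [word]
  | succ k ih => rw [word, List.length_append, ih, length_next]; ring

lemma word_congr {ω ω' : ℕ → Fin M} {k : ℕ} (h : ∀ i < k, ω i = ω' i) :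
    F.word ω k = F.word ω' k := by
  induction k with
  | zero => rfl
  | succ k ih =>
    rw [word, word, ih fun i hi => h i (by omega), h k (by omega)]

lemma exists_lg_next_le : ∃ C : ℝ, ∀ u i, lg (F.next u i) 0 ≤ C := by
  refine ⟨∑ i, (lg (F.up i) 0 + lg (F.down i) 0), fun u i => ?_⟩
  have h1 : lg (F.up i) 0 + lg (F.down i) 0 ≤ ∑ i, (lg (F.up i) 0 + lg (F.down i) 0) :=
    Finset.single_le_sum (f := fun i => lg (F.up i) 0 + lg (F.down i) 0)
      (fun i _ => add_nonneg (lg_nonneg _ le_rfl) (lg_nonneg _ le_rfl)) (Finset.mem_univ i)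
  have := lg_nonneg (F.up i) (le_refl (0 : ℝ))
  have := lg_nonneg (F.down i) (le_refl (0 : ℝ))
  unfold next
  split_ifs <;> linarith

lemma exists_abs_lg_word_le (hβ : 0 ≤ β) :
    ∃ C : ℝ, ∀ ω k, |lg (F.word ω k) 0 - β * (k * L : ℕ)| ≤ C := by
  obtain ⟨C, hC⟩ := F.exists_lg_next_le
  have h2 := two_log_two_pos
  have hβL : 0 ≤ β * L := by positivity
  refine ⟨|C| + β * L + 2 * Real.log 2, fun ω k => ?_⟩
  have hC0 := le_abs_self C
  have hC1 := abs_nonneg C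
  induction k with
  | zero => simp [word, lg_nil]; positivity
  | succ k ih =>
    rw [abs_le] at ih ⊢
    have e : β * (((k + 1) * L : ℕ) : ℝ) = β * ((k * L : ℕ) : ℝ) + β * L := by push_cast; ring
    have a1 := lg_add_le (F.word ω k) (F.next (F.word ω k) (ω k))
    have a2 := lg_append_le (F.word ω k) (F.next (F.word ω k) (ω k))
    have a3 := hC (F.word ω k) (ω k)
    have a4 := lg_nonneg (F.next (F.word ω k) (ω k)) (le_refl (0 : ℝ))
    rw [word, e]
    by_cases h : lg (F.word ω k) 0 ≤ β * (F.word ω k).length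
    · have hn : F.next (F.word ω k) (ω k) = F.up (ω k) := if_pos h
      have := F.le_lg_up (ω k)
      rw [length_word] at h
      rw [← hn] at this
      constructor <;> linarith
    · have hn : F.next (F.word ω k) (ω k) = F.down (ω k) := if_neg h
      have := F.lg_down_le (ω k)
      rw [length_word] at h
      rw [← hn] at this
      constructor <;> linarith

lemma exists_letters_bound :
    ∃ B : ℝ, 1 ≤ B ∧ ∀ u i, ∀ a ∈ F.next u i, (a : ℝ) + 2 ≤ B := by
  refine ⟨((∑ i, ((F.up i).sum + (F.down i).sum) : ℕ) : ℝ) + 2, ?_, fun u i a ha => ?_⟩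
  · have : (0 : ℝ) ≤ ((∑ i, ((F.up i).sum + (F.down i).sum) : ℕ) : ℝ) := Nat.cast_nonneg _
    linarith
  · have h1 : (F.up i).sum + (F.down i).sum ≤ ∑ i, ((F.up i).sum + (F.down i).sum) :=
      Finset.single_le_sum (f := fun i => (F.up i).sum + (F.down i).sum)
        (fun i _ => Nat.zero_le _) (Finset.mem_univ i)
    have h2 : a ≤ (F.next u i).sum := List.le_sum_of_mem ha
    have h3 : (F.next u i).sum ≤ (F.up i).sum + (F.down i).sum := by
      unfold next
      split_ifs <;> omega
    have : a ≤ ∑ i, ((F.up i).sum + (F.down i).sum) := by omega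
    have : (a : ℝ) ≤ ((∑ i, ((F.up i).sum + (F.down i).sum) : ℕ) : ℝ) := by exact_mod_cast this
    linarith

lemma exists_coding (hL : 1 ≤ L) (ω : ℕ → Fin M) : ∃ x, IrrUnit x ∧ ∃ y : ℕ → ℝ, ∀ k,
    y k ∈ Ioo (0 : ℝ) 1 ∧ mob (F.word ω k) (y k) = x ∧
      mob (F.next (F.word ω k) (ω k)) (y (k + 1)) = y k := by
  refine exists_point (fun k => rfl) fun k h => ?_
  have := F.length_next (F.word ω k) (ω k)
  rw [h, List.length_nil] at this
  omega

/-- A tail of a coded point stays away from `0` and `1`. -/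
lemma tail_mem_core (hL : 1 ≤ L) {B : ℝ} (hB1 : 1 ≤ B)
    (hB : ∀ u i, ∀ a ∈ F.next u i, (a : ℝ) + 2 ≤ B) {ω : ℕ → Fin M} {y : ℕ → ℝ}
    (hy : ∀ k, y k ∈ Ioo (0 : ℝ) 1)
    (hyy : ∀ k, mob (F.next (F.word ω k) (ω k)) (y (k + 1)) = y k) (k : ℕ) :
    y k ∈ Icc (1 / B) (B / (B + 1)) := by
  have cons : ∀ k, ∃ a w, F.next (F.word ω k) (ω k) = a :: w := fun k =>
    List.exists_cons_of_length_pos (by rw [length_next]; omega)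
  have low : ∀ (w : List ℕ), (∀ a ∈ w, (a : ℝ) + 2 ≤ B) → ∀ z, 0 ≤ z → z ≤ 1 → w ≠ [] →
      1 / B ≤ mob w z := by
    intro w hw z hz hz1 hne
    obtain ⟨a, v, rfl⟩ := List.exists_cons_of_ne_nil hne
    have h1 := mob_nonneg v hz
    have h2 := mob_le_one v hz hz1
    have h3 := hw a List.mem_cons_self
    simp only [mob]
    exact one_div_le_one_div_of_le (by positivity) (by linarith)
  have low1 : ∀ k, 1 / B ≤ y k := fun k => by
    rw [← hyy k]
    obtain ⟨a, w, h⟩ := cons k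
    exact low _ (hB _ _) _ (hy _).1.le (hy _).2.le (by rw [h]; simp)
  refine ⟨low1 k, ?_⟩
  rw [← hyy k]
  obtain ⟨a, w, h⟩ := cons k
  have hw : ∀ b ∈ w, (b : ℝ) + 2 ≤ B := fun b hb =>
    hB (F.word ω k) (ω k) b (by rw [h]; exact List.mem_cons_of_mem _ hb)
  have h1 : 1 / B ≤ mob w (y (k + 1)) := by
    by_cases hne : w = []
    · rw [hne]
      exact low1 _
    · exact low w hw _ (hy _).1.le (hy _).2.le hne
  rw [h]
  simp only [mob]
  have hB0 : 0 < B := by linarith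
  calc 1 / ((a : ℝ) + 1 + mob w (y (k + 1))) ≤ 1 / (1 + 1 / B) :=
      one_div_le_one_div_of_le (by positivity) (by linarith [a.cast_nonneg (α := ℝ)])
    _ = B / (B + 1) := by field_simp

lemma mem_levelSet (hβ : 0 ≤ β) (hL : 1 ≤ L) {ω : ℕ → Fin M} {x : ℝ} (hx : IrrUnit x)
    {y : ℕ → ℝ} (hy : ∀ k, y k ∈ Ioo (0 : ℝ) 1) (hxy : ∀ k, mob (F.word ω k) (y k) = x) :
    x ∈ levelSet (β : EReal) := by
  obtain ⟨C, hC⟩ := F.exists_abs_lg_word_le hβ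
  rw [mem_levelSet_iff]
  refine ⟨hx, ?_⟩
  have hletters : ∀ k, letters (k * L) x = F.word ω k := fun k => by
    rw [← hxy k]
    nth_rewrite 1 [← F.length_word ω k]
    exact letters_mob _ (hy k)
  have hmono : Monotone fun n => lg (letters n x) 0 := fun m n hmn =>
    mul_le_mul_of_nonneg_left (Real.log_le_log (den_pos _ le_rfl) (den_letters_mono x hmn))
      zero_le_two
  have bound : ∀ n : ℕ, |lg (letters n x) 0 - β * n| ≤ C + β * L := fun n => by
    have h1 : n / L * L ≤ n := Nat.div_mul_le_self n L
    have h2 : n ≤ (n / L + 1) * L := (Nat.lt_div_mul_add (a := n) (b := L) (by omega)).le.trans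
      (by rw [add_mul, one_mul])
    have h3 := hmono h1
    have h4 := hmono h2
    simp only [hletters] at h3 h4
    have h5 := (abs_le.mp (hC ω (n / L))).1
    have h6 := (abs_le.mp (hC ω (n / L + 1))).2
    have h7 : (((n / L + 1) * L : ℕ) : ℝ) = ((n / L * L : ℕ) : ℝ) + L := by push_cast; ring
    have h8 : ((n / L * L : ℕ) : ℝ) ≤ n := by exact_mod_cast h1
    have h9 : (n : ℝ) ≤ ((n / L * L : ℕ) : ℝ) + L := by rw [← h7]; exact_mod_cast h2
    rw [h7] at h6
    have := mul_le_mul_of_nonneg_left h8 hβ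
    have := mul_le_mul_of_nonneg_left h9 hβ
    rw [abs_le]
    constructor <;> linarith
  have hlim : Tendsto (fun n : ℕ => (C + β * L) / (n : ℝ)) atTop (nhds 0) :=
    tendsto_const_div_atTop_nhds_zero_nat _
  rw [tendsto_iff_dist_tendsto_zero]
  refine squeeze_zero' (Eventually.of_forall fun n => dist_nonneg) ?_ hlim
  filter_upwards [eventually_gt_atTop 0] with n hn
  have hn' : (0 : ℝ) < n := by exact_mod_cast hn
  rw [Real.dist_eq, le_div_iff₀ hn', ← abs_of_pos hn', ← abs_mul, abs_of_pos hn', sub_mul,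
    div_mul_cancel₀ _ hn'.ne']
  exact bound n

/-- The level set contains a Cantor set whose dimension is controlled by the number of blocks. -/
lemma le_dimH (F : Blocks β L M) (hβ : 0 < β) (hL : 1 ≤ L) {s : ℝ} (hs : 0 < s)
    (hM : Real.exp (s * (β * L)) ≤ M) : ENNReal.ofReal s ≤ dimH (levelSet (β : EReal)) := by
  have hL' : (1 : ℝ) ≤ L := by exact_mod_cast hL
  have hM1 : 1 < M := by
    have : (1 : ℝ) < M := lt_of_lt_of_le (Real.one_lt_exp_iff.mpr (by positivity)) hM
    exact_mod_cast this
  choose x hx y hy using F.exists_coding hL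
  obtain ⟨C, hC⟩ := F.exists_abs_lg_word_le hβ.le
  obtain ⟨B, hB1, hB⟩ := F.exists_letters_bound
  have hB0 : 0 < B := by linarith
  set c := ((B ^ 2)⁻¹) ^ L * (B + 1)⁻¹ with hc
  have hc0 : 0 < c := by positivity
  have sep : ∀ ω ω' : ℕ → Fin M, ∀ k, (∀ i < k, ω i = ω' i) → ω k ≠ ω' k →
      c / 4 * Real.exp (-(β * (k * L : ℕ)) - C) ≤ |x ω - x ω'| := by
    intro ω ω' k hlt hne
    have hw := F.word_congr hlt
    have h1 := le_abs_mob_sub (F.word ω k) (hy ω k).1.1.le (hy ω' k).1.1.le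
      (hy ω k).1.2.le (hy ω' k).1.2.le
    rw [(hy ω k).2.1, hw, (hy ω' k).2.1] at h1
    have h2 := mob_separation hB1 (F.next (F.word ω k) (ω k)) (F.next (F.word ω' k) (ω' k))
      (by rw [length_next, length_next]) (by rw [hw]; exact fun h => hne (F.next_injective _ h))
      (hB _ _) (hB _ _)
      (F.tail_mem_core hL hB1 hB (fun k => (hy ω k).1) (fun k => (hy ω k).2.2) (k + 1))
      (F.tail_mem_core hL hB1 hB (fun k => (hy ω' k).1) (fun k => (hy ω' k).2.2) (k + 1))
    rw [(hy ω k).2.2, (hy ω' k).2.2, length_next, ← hc] at h2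
    refine le_trans ?_ h1
    rw [mul_inv, inv_den_sq]
    have h3 := (abs_le.mp (hC ω' k)).2
    calc c / 4 * Real.exp (-(β * (k * L : ℕ)) - C)
        ≤ |y ω k - y ω' k| / 4 * Real.exp (-lg (F.word ω' k) 0) := by
          gcongr
          linarith
      _ = _ := by ring
  have first : ∀ ω ω' : ℕ → Fin M, ω ≠ ω' → ∃ k, (∀ i < k, ω i = ω' i) ∧ ω k ≠ ω' k := by
    intro ω ω' hne
    obtain ⟨k, hk⟩ := Function.ne_iff.mp hne
    classical
    have hex : ∃ k, ω k ≠ ω' k := ⟨k, hk⟩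
    exact ⟨Nat.find hex, fun i hi => not_not.mp (Nat.find_min hex hi), Nat.find_spec hex⟩
  have hxinj : Function.Injective x := by
    intro ω ω' h
    by_contra hne
    obtain ⟨k, hlt, hk⟩ := first ω ω' hne
    have := sep ω ω' k hlt hk
    rw [h, sub_self, abs_zero] at this
    exact absurd this (not_le.mpr (by positivity))
  have : NeZero M := ⟨by omega⟩
  set f : ℝ → ℝ := fun z => Real.ofDigits (Function.invFun x z) with hf
  have hfx : ∀ ω, f (x ω) = Real.ofDigits ω := fun ω => by
    simp only [hf, Function.leftInverse_invFun hxinj ω]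
  set D : ℝ := (Real.exp C / (c / 4)) ^ s with hD
  have hD0 : 0 < D := by positivity
  have holder : HolderOnWith D.toNNReal s.toNNReal f (range x) := by
    rintro _ ⟨ω, rfl⟩ _ ⟨ω', rfl⟩
    by_cases hne : ω = ω'
    · simp [hne]
    obtain ⟨k, hlt, hk⟩ := first ω ω' hne
    have h1 := sep ω ω' k hlt hk
    have hpos : 0 < |x ω - x ω'| := lt_of_lt_of_le (by positivity) h1
    rw [hfx, hfx, edist_dist, edist_dist, Real.dist_eq, Real.dist_eq,
      Real.coe_toNNReal s hs.le, ENNReal.ofReal_rpow_of_pos hpos, ← ENNReal.ofReal,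
      ← ENNReal.ofReal_mul hD0.le]
    refine ENNReal.ofReal_le_ofReal ((Real.abs_ofDigits_sub_ofDigits_le hlt).trans ?_)
    rw [hD, ← Real.mul_rpow (by positivity) hpos.le]
    have h2 : Real.exp (-(β * (k * L : ℕ))) ≤ Real.exp C / (c / 4) * |x ω - x ω'| := by
      rw [div_mul_eq_mul_div, le_div_iff₀ (by positivity)]
      rw [sub_eq_add_neg, Real.exp_add, Real.exp_neg C] at h1
      have := mul_le_mul_of_nonneg_left h1 (Real.exp_pos C).le
      calc _ = Real.exp C * (c / 4 * (Real.exp (-(β * (k * L : ℕ))) * (Real.exp C)⁻¹)) := by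
            field_simp
        _ ≤ _ := this
    refine le_trans ?_ (Real.rpow_le_rpow (Real.exp_pos _).le h2 hs.le)
    rw [← Real.exp_mul]
    calc ((M : ℝ) ^ k)⁻¹ ≤ (Real.exp (s * (β * L)) ^ k)⁻¹ :=
          inv_anti₀ (by positivity) (pow_le_pow_left₀ (Real.exp_pos _).le hM k)
      _ = Real.exp (-(β * (k * L : ℕ)) * s) := by
          rw [← Real.exp_nat_mul, ← Real.exp_neg]
          congr 1
          push_cast
          ring
  have himg : Icc (0 : ℝ) 1 ⊆ f '' range x := by
    intro z hz
    obtain ⟨ω, -, hω⟩ := Real.ofDigits_SurjOn hM1 hz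
    exact ⟨x ω, mem_range_self ω, by rw [hfx, hω]⟩
  have hs' : 0 < s.toNNReal := Real.toNNReal_pos.mpr hs
  have h1 : (1 : ENNReal) ≤ dimH (f '' range x) := by
    have h := Real.dimH_of_nonempty_interior (E := ℝ) (s := Icc (0 : ℝ) 1) (by simp)
    rw [Module.finrank_self, Nat.cast_one] at h
    exact h.symm.le.trans (dimH_mono himg)
  have h2 := h1.trans (holder.dimH_image_le hs')
  have h3 : (s.toNNReal : ENNReal) ≤ dimH (range x) := by
    rw [ENNReal.le_div_iff_mul_le (by simp [hs]) (by simp), one_mul] at h2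
    exact h2
  refine h3.trans (dimH_mono ?_)
  rintro _ ⟨ω, rfl⟩
  exact F.mem_levelSet hβ.le hL (hx ω) (fun k => (hy ω k).1) fun k => (hy ω k).2.1

end Blocks

section Counting

variable {ι : Type*}

lemma exists_centering (F : Finset ι) (l : ι → ℝ) {a b : ι} (ha : a ∈ F) (hb : b ∈ F)
    (hla : l a < 0) (hlb : 0 < l b) :
    ∃ τ : ℝ, ∑ i ∈ F, l i * Real.exp (-τ * l i) = 0 := by
  set f : ℝ → ℝ := fun τ => ∑ i ∈ F, Real.exp (-τ * l i) with hf
  have hpos : 0 ≤ f 0 := Finset.sum_nonneg fun i _ => (Real.exp_pos _).le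
  have single : ∀ i ∈ F, ∀ τ, 1 + -τ * l i ≤ f τ := fun i hi τ =>
    (by linarith [Real.add_one_le_exp (-τ * l i)] : 1 + -τ * l i ≤ Real.exp (-τ * l i)).trans
      (Finset.single_le_sum (f := fun i => Real.exp (-τ * l i))
        (fun i _ => (Real.exp_pos _).le) hi)
  have hderiv : ∀ τ, HasDerivAt f (∑ i ∈ F, Real.exp (-τ * l i) * (-1 * l i)) τ := fun τ =>
    HasDerivAt.fun_sum fun i _ => (((hasDerivAt_id τ).neg).mul_const (l i)).exp
  have hcont : Continuous f := continuous_iff_continuousAt.mpr fun τ => (hderiv τ).continuousAt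
  set T := max (f 0 / (-l a)) (f 0 / l b)
  have hT : 0 ≤ T := le_max_of_le_right (by positivity)
  obtain ⟨τ, -, hτ⟩ := (isCompact_Icc (a := -T) (b := T)).exists_isMinOn
    ⟨0, by constructor <;> linarith⟩ hcont.continuousOn
  have hmin : ∀ σ, f τ ≤ f σ := by
    intro σ
    have h0 : f τ ≤ f 0 := hτ (show (0 : ℝ) ∈ Icc (-T) T by constructor <;> linarith)
    rcases lt_or_ge T σ with h | h
    · have h1 : f 0 / (-l a) ≤ σ := (le_max_left _ _).trans h.le
      rw [div_le_iff₀ (by linarith)] at h1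
      linarith [single a ha σ]
    · rcases lt_or_ge σ (-T) with h' | h'
      · have h1 : f 0 / l b ≤ -σ := (le_max_right _ _).trans (by linarith)
        rw [div_le_iff₀ hlb] at h1
        linarith [single b hb σ]
      · exact hτ ⟨h', h⟩
  have hloc : IsLocalMin f τ := Eventually.of_forall hmin
  have h0 := hloc.hasDerivAt_eq_zero (hderiv τ)
  refine ⟨τ, ?_⟩
  rw [← neg_eq_zero, ← h0, ← Finset.sum_neg_distrib]
  exact Finset.sum_congr rfl fun i _ => by ring

variable [Fintype ι]

/-- The first two moments of a sum of independent centred random variables. -/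
lemma moments (p l : ι → ℝ) (hp : ∑ i, p i = 1) (hl : ∑ i, p i * l i = 0) (m : ℕ) :
    ∑ w : Fin m → ι, ∏ i, p (w i) = 1 ∧
    ∑ w : Fin m → ι, (∏ i, p (w i)) * ∑ i, l (w i) = 0 ∧
    ∑ w : Fin m → ι, (∏ i, p (w i)) * (∑ i, l (w i)) ^ 2 = m * ∑ i, p i * l i ^ 2 := by
  induction m with
  | zero => simp
  | succ m ih =>
    obtain ⟨h0, h1, h2⟩ := ih
    simp only [← (Fin.consEquiv fun _ => ι).sum_comp, Fin.consEquiv_apply, Fin.prod_univ_succ,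
      Fin.sum_univ_succ, Fin.cons_zero, Fin.cons_succ, Fintype.sum_prod_type]
    refine ⟨?_, ?_, ?_⟩
    · simp only [← Finset.mul_sum, h0, mul_one, hp]
    · have : ∀ i : ι, ∑ w : Fin m → ι, (p i * ∏ j, p (w j)) * (l i + ∑ j, l (w j)) =
          p i * l i * (∑ w : Fin m → ι, ∏ j, p (w j)) +
            p i * ∑ w : Fin m → ι, (∏ j, p (w j)) * ∑ j, l (w j) := fun i => by
        rw [Finset.mul_sum, Finset.mul_sum, ← Finset.sum_add_distrib]
        exact Finset.sum_congr rfl fun w _ => by ring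
      simp only [this, h0, h1, mul_one, mul_zero, add_zero, hl]
    · have : ∀ i : ι, ∑ w : Fin m → ι, (p i * ∏ j, p (w j)) * (l i + ∑ j, l (w j)) ^ 2 =
          p i * l i ^ 2 * (∑ w : Fin m → ι, ∏ j, p (w j)) +
            2 * (p i * l i) * (∑ w : Fin m → ι, (∏ j, p (w j)) * ∑ j, l (w j)) +
            p i * ∑ w : Fin m → ι, (∏ j, p (w j)) * (∑ j, l (w j)) ^ 2 := fun i => by
        rw [Finset.mul_sum, Finset.mul_sum, Finset.mul_sum, ← Finset.sum_add_distrib,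
          ← Finset.sum_add_distrib]
        exact Finset.sum_congr rfl fun w _ => by ring
      simp only [this, h0, h1, h2, mul_one, mul_zero, add_zero, Finset.sum_add_distrib,
        ← Finset.sum_mul, hp, one_mul]
      push_cast
      ring

open Classical in
/-- Exponentially many words have almost vanishing sums. -/
lemma exists_count_le (l : ι → ℝ) {τ : ℝ} (hτ : ∑ i, l i * Real.exp (-τ * l i) = 0)
    [Nonempty ι] {ε : ℝ} (hε : 0 < ε) :
    ∀ᶠ m : ℕ in atTop, 1 / 2 * ((∑ i, Real.exp (-τ * l i)) ^ m * Real.exp (-(|τ| * (ε * m)))) ≤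
      ((Finset.univ.filter fun w : Fin m → ι => |∑ i, l (w i)| ≤ ε * m).card : ℝ) := by
  set φ := ∑ i, Real.exp (-τ * l i) with hφ
  have hφ0 : 0 < φ := Finset.sum_pos (fun i _ => Real.exp_pos _) Finset.univ_nonempty
  set p : ι → ℝ := fun i => Real.exp (-τ * l i) / φ with hp
  have hp0 : ∀ i, 0 ≤ p i := fun i => by positivity
  have hp1 : ∑ i, p i = 1 := by rw [hp, ← Finset.sum_div, div_self hφ0.ne']
  have hpl : ∑ i, p i * l i = 0 := by
    have : ∀ i, p i * l i = l i * Real.exp (-τ * l i) / φ := fun i => by rw [hp]; ring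
    simp only [this, ← Finset.sum_div, hτ, zero_div]
  set V := ∑ i, p i * l i ^ 2
  have hlarge : ∀ᶠ m : ℕ in atTop, 2 * V / ε ^ 2 < m :=
    tendsto_natCast_atTop_atTop.eventually_gt_atTop _
  filter_upwards [hlarge, eventually_gt_atTop 0] with m hm hm0
  have hm0' : (0 : ℝ) < m := by exact_mod_cast hm0
  obtain ⟨h0, -, h2⟩ := moments p l hp1 hpl m
  set good := Finset.univ.filter fun w : Fin m → ι => |∑ i, l (w i)| ≤ ε * m with hgood
  have hP0 : ∀ w : Fin m → ι, 0 ≤ ∏ i, p (w i) := fun w => Finset.prod_nonneg fun i _ => hp0 _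
  have cheb : ∑ w : Fin m → ι, ∏ i, p (w i) ≤ ∑ w ∈ good, ∏ i, p (w i) +
      ∑ w : Fin m → ι, (∏ i, p (w i)) * (∑ i, l (w i)) ^ 2 / (ε * m) ^ 2 := by
    rw [hgood, Finset.sum_filter, ← Finset.sum_add_distrib]
    refine Finset.sum_le_sum fun w _ => ?_
    split_ifs with h
    · exact le_add_of_nonneg_right (div_nonneg (mul_nonneg (hP0 w) (sq_nonneg _)) (sq_nonneg _))
    · rw [zero_add, mul_div_assoc]
      refine le_mul_of_one_le_right (hP0 w) ?_
      rw [one_le_div (by positivity), ← sq_abs (∑ i, l (w i))]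
      exact pow_le_pow_left₀ (by positivity) (not_le.mp h).le 2
  rw [h0, ← Finset.sum_div, h2] at cheb
  have hV : m * V / (ε * m) ^ 2 ≤ 1 / 2 := by
    rw [div_lt_iff₀ (by positivity)] at hm
    rw [div_le_div_iff₀ (by positivity) (by norm_num)]
    nlinarith
  have term : ∀ w ∈ good, ∏ i, p (w i) ≤ Real.exp (|τ| * (ε * m)) / φ ^ m := by
    intro w hw
    have hw' : |∑ i, l (w i)| ≤ ε * m := (Finset.mem_filter.mp hw).2
    simp only [hp, Finset.prod_div_distrib, Finset.prod_const, Finset.card_univ,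
      Fintype.card_fin, ← Real.exp_sum, ← Finset.mul_sum]
    refine div_le_div_of_nonneg_right (Real.exp_le_exp.mpr ?_) (by positivity)
    calc -τ * ∑ i, l (w i) ≤ |-τ * ∑ i, l (w i)| := le_abs_self _
      _ = |τ| * |∑ i, l (w i)| := by rw [abs_mul, abs_neg]
      _ ≤ _ := mul_le_mul_of_nonneg_left hw' (abs_nonneg _)
  have hsum := Finset.sum_le_card_nsmul good _ _ term
  rw [nsmul_eq_mul] at hsum
  have h3 : 1 / 2 ≤ (good.card : ℝ) * (Real.exp (|τ| * (ε * m)) / φ ^ m) := by linarith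
  rw [Real.exp_neg, ← mul_assoc, ← div_eq_mul_inv, div_le_iff₀ (Real.exp_pos _)]
  rw [mul_div_assoc', le_div_iff₀ (by positivity)] at h3
  exact h3

end Counting

lemma exists_word_large (C : ℝ) : ∃ a : ℕ, ∀ w : List ℕ, C ≤ lg (a :: w) 0 := by
  obtain ⟨a, ha⟩ := exists_nat_gt (Real.exp (C / 2))
  refine ⟨a, fun w => ?_⟩
  have h1 : C / 2 ≤ Real.log (a + 1) := by
    rw [Real.le_log_iff_exp_le (by positivity)]
    linarith
  have h2 := lg_add_le [a] w
  rw [lg_singleton, add_zero] at h2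
  have h3 := lg_nonneg w (le_refl (0 : ℝ))
  rw [List.singleton_append] at h2
  linarith

lemma ofReal_exp_lt_tsum {β : ℝ} (hβ : minExp < β) {K : ℕ} (hK : 1 ≤ K) {a : ℝ}
    (ha : a < K * legendre β) (τ : ℝ) :
    ENNReal.ofReal (Real.exp a) <
      ∑' w : Fin K → ℕ, ENNReal.ofReal (Real.exp (-τ * (lg (List.ofFn w) 0 - β * K))) := by
  have h : ∑' w : Fin K → ℕ, ENNReal.ofReal (Real.exp (-τ * (lg (List.ofFn w) 0 - β * K))) =
      ENNReal.ofReal (Real.exp (τ * (β * K))) * Z τ K 0 := by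
    unfold Z
    rw [← ENNReal.tsum_mul_left]
    refine tsum_congr fun w => ?_
    rw [← ENNReal.ofReal_mul (Real.exp_pos _).le, ← Real.exp_add]
    congr 2
    ring
  rw [h]
  rcases le_or_gt τ (1 / 2) with hτ | hτ
  · rw [Z_eq_top hτ hK, ENNReal.mul_top (by simpa using Real.exp_pos _)]
    exact ENNReal.ofReal_lt_top
  · refine lt_of_lt_of_le ?_ (mul_le_mul_right (le_Z hτ K) _)
    rw [← ENNReal.ofReal_mul (Real.exp_pos _).le, ← Real.exp_add]
    refine (ENNReal.ofReal_lt_ofReal_iff (Real.exp_pos _)).mpr (Real.exp_lt_exp.mpr ?_)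
    have := mul_le_mul_of_nonneg_left (legendre_le hβ hτ) (K.cast_nonneg (α := ℝ))
    linarith

/-- A finite set of words whose free energy is almost that of the full set, for all parameters. -/
lemma exists_finset_words {β : ℝ} (hβ : minExp < β) {K : ℕ} (hK : 1 ≤ K) {a : ℝ}
    (ha : a < K * legendre β) :
    ∃ F : Finset (Fin K → ℕ), (∃ w ∈ F, lg (List.ofFn w) 0 - β * K < 0) ∧
      (∃ w ∈ F, 0 < lg (List.ofFn w) 0 - β * K) ∧
      ∀ τ : ℝ, Real.exp a ≤ ∑ w ∈ F, Real.exp (-τ * (lg (List.ofFn w) 0 - β * K)) := by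
  classical
  set l : (Fin K → ℕ) → ℝ := fun w => lg (List.ofFn w) 0 - β * K with hl
  have hK' : (1 : ℝ) ≤ K := by exact_mod_cast hK
  obtain ⟨u, hu⟩ : ∃ u, l u < 0 := by
    refine ⟨fun _ => 0, ?_⟩
    simp only [hl, List.ofFn_const]
    nlinarith [lg_replicate_zero_le K]
  obtain ⟨v, hv⟩ : ∃ v, 0 < l v := by
    obtain ⟨A, hA⟩ := exists_word_large (β * K + 1)
    obtain ⟨n, rfl⟩ : ∃ n, K = n + 1 := ⟨K - 1, by omega⟩
    refine ⟨fun _ => A, ?_⟩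
    simp only [hl, List.ofFn_const, List.replicate_succ]
    linarith [hA (List.replicate n A)]
  set Φ : Finset (Fin K → ℕ) → ℝ → ℝ := fun F τ => ∑ w ∈ F, Real.exp (-τ * l w) with hΦ
  have mono : ∀ τ, Monotone fun F => Φ F τ := fun τ F G h =>
    Finset.sum_le_sum_of_subset_of_nonneg h fun w _ _ => (Real.exp_pos _).le
  set T := max (|a| / (-l u)) (|a| / l v)
  obtain ⟨F, hF⟩ := (isCompact_Icc (a := -T) (b := T)).elim_directed_cover
    (fun F => {τ | Real.exp a < Φ F τ}) (fun F => isOpen_lt continuous_const (by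
      simp only [hΦ]; fun_prop)) (fun τ _ => by
      have h := ofReal_exp_lt_tsum hβ hK ha τ
      rw [ENNReal.tsum_eq_iSup_sum, lt_iSup_iff] at h
      obtain ⟨F, hF⟩ := h
      rw [← ENNReal.ofReal_sum_of_nonneg fun w _ => (Real.exp_pos _).le] at hF
      exact mem_iUnion.mpr ⟨F, (ENNReal.ofReal_lt_ofReal_iff_of_nonneg (Real.exp_pos _).le).mp hF⟩)
    (Monotone.directed_le fun F G h τ hτ => lt_of_lt_of_le hτ (mono τ h))
  refine ⟨F ∪ {u, v}, ⟨u, by simp, hu⟩, ⟨v, by simp, hv⟩, fun τ => ?_⟩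
  have single : ∀ w ∈ F ∪ {u, v}, a ≤ -τ * l w → Real.exp a ≤ Φ (F ∪ {u, v}) τ := fun w hw h =>
    (Real.exp_le_exp.mpr h).trans (Finset.single_le_sum (f := fun w => Real.exp (-τ * l w))
      (fun w _ => (Real.exp_pos _).le) hw)
  have ha' := le_abs_self a
  rcases lt_or_ge T τ with h | h
  · refine single u (by simp) ?_
    have h1 : |a| / (-l u) ≤ τ := (le_max_left _ _).trans h.le
    rw [div_le_iff₀ (by linarith)] at h1
    linarith
  · rcases lt_or_ge τ (-T) with h' | h'
    · refine single v (by simp) ?_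
      have h1 : |a| / l v ≤ -τ := (le_max_right _ _).trans (by linarith)
      rw [div_le_iff₀ hv] at h1
      linarith
    · exact (le_of_lt (hF ⟨h', h⟩)).trans (mono τ Finset.subset_union_left)

lemma lg_flatten (L : List (List ℕ)) :
    (L.map fun u => lg u 0).sum ≤ lg L.flatten 0 ∧
      lg L.flatten 0 ≤ (L.map fun u => lg u 0).sum + L.length * (2 * Real.log 2) := by
  induction L with
  | nil => simp [lg_nil]
  | cons u L ih =>
    simp only [List.map_cons, List.sum_cons, List.flatten_cons, List.length_cons]
    have h1 := lg_add_le u L.flatten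
    have h2 := lg_append_le u L.flatten
    push_cast
    constructor <;> linarith

lemma ofFn_flatten_injective {K m : ℕ} :
    Function.Injective fun w : Fin m → Fin K → ℕ =>
      (List.ofFn fun i => List.ofFn (w i)).flatten := by
  intro w w' h
  have h1 : (List.ofFn fun i => List.ofFn (w i)) = List.ofFn fun i => List.ofFn (w' i) := by
    refine List.eq_iff_flatten_eq.mpr ⟨h, ?_⟩
    rw [List.map_ofFn, List.map_ofFn]
    congr 1
    funext i
    simp
  have h2 := List.ofFn_injective h1
  funext i
  exact List.ofFn_injective (congrFun h2 i)

/-- Exponentially many words have Lyapunov sums close to a given slope. -/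
lemma exists_words {β : ℝ} (hβ : minExp < β) {a ε : ℝ} (ha : a < legendre β) (hε : 0 < ε)
    (N₀ : ℕ) : ∃ N ≥ N₀, ∃ S : Finset (List ℕ),
      (∀ u ∈ S, u.length = N ∧ |lg u 0 - β * N| ≤ ε * N) ∧ Real.exp (a * N) ≤ S.card := by
  classical
  obtain ⟨a', ha', ha''⟩ := exists_between ha
  obtain ⟨K, hK⟩ := exists_nat_gt (max 1 (4 * Real.log 2 / ε))
  have hK1 : (1 : ℝ) < K := (le_max_left _ _).trans_lt hK
  have hK2 : 4 * Real.log 2 < ε * K := by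
    have := (le_max_right _ _).trans_lt hK
    rw [div_lt_iff₀ hε] at this
    linarith
  have hK1' : 1 ≤ K := by exact_mod_cast hK1.le
  obtain ⟨F, ⟨u, hu, hlu⟩, ⟨v, hv, hlv⟩, hF⟩ :=
    exists_finset_words hβ hK1' (mul_lt_mul_of_pos_left ha'' (by linarith : (0 : ℝ) < K))
  set l : (Fin K → ℕ) → ℝ := fun w => lg (List.ofFn w) 0 - β * K with hl
  obtain ⟨τ, hτ⟩ := exists_centering F l hu hv hlu hlv
  have : Nonempty F := ⟨⟨u, hu⟩⟩
  set δ := min (ε * K / 2) (K * (a' - a) / 2 / (|τ| + 1)) with hδ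
  have hτ1 : 0 < |τ| + 1 := by positivity
  have hg : 0 < K * (a' - a) := mul_pos (by linarith) (by linarith)
  have hδ0 : 0 < δ := lt_min (by positivity) (by positivity)
  have hδ1 : δ ≤ ε * K / 2 := min_le_left _ _
  have hδ2 : |τ| * δ ≤ K * (a' - a) / 2 := by
    have := min_le_right (ε * K / 2) (K * (a' - a) / 2 / (|τ| + 1))
    rw [← hδ, le_div_iff₀ hτ1] at this
    nlinarith
  have hcount := exists_count_le (fun i : F => l i) (τ := τ)
    (by rw [← hτ]; exact Finset.sum_coe_sort F fun i => l i * Real.exp (-τ * l i)) hδ0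
  have hlarge : ∀ᶠ m : ℕ in atTop, Real.log 2 / (K * (a' - a) / 2) < m :=
    tendsto_natCast_atTop_atTop.eventually_gt_atTop _
  obtain ⟨m, hm, hm1, hm0⟩ := (hcount.and (hlarge.and (eventually_ge_atTop N₀))).exists
  rw [Finset.sum_coe_sort F fun i => Real.exp (-τ * l i)] at hm
  rw [div_lt_iff₀ (by positivity)] at hm1
  refine ⟨m * K, le_trans hm0 (Nat.le_mul_of_pos_right m hK1'), Finset.image
    (fun w : Fin m → F => (List.ofFn fun i => List.ofFn (w i : Fin K → ℕ)).flatten)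
    (Finset.univ.filter fun w : Fin m → F => |∑ i, l (w i)| ≤ δ * m), ?_, ?_⟩
  · intro x hx
    obtain ⟨w, hw, rfl⟩ := Finset.mem_image.mp hx
    have hw' : |∑ i, l (w i)| ≤ δ * m := (Finset.mem_filter.mp hw).2
    refine ⟨by simp [List.length_flatten, List.map_ofFn, Function.comp_def], ?_⟩
    obtain ⟨h1, h2⟩ := lg_flatten (List.ofFn fun i => List.ofFn (w i : Fin K → ℕ))
    simp only [List.map_ofFn, Function.comp_def, List.sum_ofFn, List.length_ofFn] at h1 h2
    have h3 : ∑ i, l (w i) = ∑ i, lg (List.ofFn (w i : Fin K → ℕ)) 0 - m * (β * K) := by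
      simp [hl, Finset.sum_sub_distrib]
    rw [h3, abs_le] at hw'
    have hm' : (0 : ℝ) ≤ m := m.cast_nonneg
    have h4 := mul_le_mul_of_nonneg_right hδ1 hm'
    have h5 := mul_le_mul_of_nonneg_right hK2.le hm'
    push_cast
    rw [abs_le]
    constructor <;> nlinarith [mul_nonneg hm' (Real.log_pos one_lt_two).le]
  · rw [Finset.card_image_of_injective]
    · refine le_trans ?_ hm
      have h1 : Real.exp (m * (K * a')) ≤ (∑ i ∈ F, Real.exp (-τ * l i)) ^ m := by
        rw [Real.exp_nat_mul]
        exact pow_le_pow_left₀ (Real.exp_pos _).le (hF τ) m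
      have h2 : (1 / 2 : ℝ) = Real.exp (-Real.log 2) := by
        rw [Real.exp_neg, Real.exp_log two_pos, one_div]
      calc Real.exp (a * (m * K : ℕ)) ≤
          Real.exp (-Real.log 2 + (m * (K * a') + -(|τ| * (δ * m)))) := by
            refine Real.exp_le_exp.mpr ?_
            have := mul_le_mul_of_nonneg_right hδ2 (m.cast_nonneg (α := ℝ))
            push_cast
            nlinarith
        _ = 1 / 2 * (Real.exp (m * (K * a')) * Real.exp (-(|τ| * (δ * m)))) := by
            rw [Real.exp_add, Real.exp_add, h2]
        _ ≤ _ := by gcongr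
    · intro w w' h
      have := ofFn_flatten_injective h
      funext i
      exact Subtype.ext (congrFun this i)

/-- Below the critical value, steering blocks of words exist. -/
lemma exists_blocks {β : ℝ} (hβ : minExp < β) {s : ℝ} (hs : 0 < s) (hs' : s * β < legendre β) :
    ∃ L M : ℕ, 1 ≤ L ∧ Real.exp (s * (β * L)) ≤ M ∧ Nonempty (Blocks β L M) := by
  have hβ0 : 0 < β := minExp_pos.trans hβ
  obtain ⟨a, ha, ha'⟩ := exists_between hs'
  have hd : 0 < β - minExp := by linarith
  have hsβ : 0 < s * β := by positivity
  set g := a - s * β with hg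
  have hg0 : 0 < g := by linarith
  set ε := g * (β - minExp) / (2 * (s * β)) with hε
  have hε0 : 0 < ε := by positivity
  obtain ⟨N₀, hN₀⟩ := exists_nat_gt (s * β * (4 * Real.log 2 / (β - minExp) + 2) / (g / 2))
  obtain ⟨N, hN, S, hS, hcard⟩ := exists_words hβ ha' hε0 N₀
  have hNN : s * β * (4 * Real.log 2 / (β - minExp) + 2) ≤ N * (g / 2) := by
    rw [div_lt_iff₀ (by positivity)] at hN₀
    have : (N₀ : ℝ) ≤ N := by exact_mod_cast hN
    nlinarith
  set n := ⌈(ε * N + 4 * Real.log 2) / (β - minExp)⌉₊ with hn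
  have hn1 : ε * N + 4 * Real.log 2 ≤ (n + 1) * (β - minExp) := by
    rw [← div_le_iff₀ hd]
    exact (Nat.le_ceil _).trans (by linarith)
  have hn2 : (n : ℝ) + 1 ≤ (ε * N + 4 * Real.log 2) / (β - minExp) + 2 := by
    have := Nat.ceil_lt_add_one (show 0 ≤ (ε * N + 4 * Real.log 2) / (β - minExp) from
      div_nonneg (add_nonneg (by positivity) (by positivity)) hd.le)
    linarith
  obtain ⟨A, hA⟩ := exists_word_large (β * (n + 1) + ε * N)
  set e := S.equivFin.symm
  refine ⟨N + (n + 1), S.card, by omega, hcard.trans' (Real.exp_le_exp.mpr ?_), ⟨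
    { up := fun i => (e i : List ℕ) ++ A :: List.replicate n 0
      down := fun i => (e i : List ℕ) ++ List.replicate (n + 1) 0
      up_injective := fun i j h => e.injective (Subtype.ext (List.append_cancel_right h))
      down_injective := fun i j h => e.injective (Subtype.ext (List.append_cancel_right h))
      length_up := fun i => by simp [(hS _ (e i).2).1]
      length_down := fun i => by simp [(hS _ (e i).2).1]
      le_lg_up := fun i => ?_
      lg_down_le := fun i => ?_ }⟩⟩
  · push_cast
    have h1 : s * β * (ε * N) = N * (g / 2) * (β - minExp) := by
      rw [hε]
      field_simp
    have h2 : s * β * ((ε * N + 4 * Real.log 2) / (β - minExp) + 2) =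
        N * (g / 2) + s * β * (4 * Real.log 2 / (β - minExp) + 2) := by
      have : N * (g / 2) = s * β * (ε * N) / (β - minExp) := by
        rw [h1]; field_simp
      rw [this]
      ring
    have h3 := mul_le_mul_of_nonneg_left hn2 hsβ.le
    nlinarith
  · have h1 := lg_add_le (e i) (A :: List.replicate n 0)
    have h2 := hA (List.replicate n 0)
    have h3 := (abs_le.mp (hS _ (e i).2).2).1
    push_cast
    linarith
  · have h1 := lg_append_le (e i) (List.replicate (n + 1) 0)
    have h2 := lg_replicate_zero_le (n + 1)
    have h3 := (abs_le.mp (hS _ (e i).2).2).2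
    push_cast at h2 ⊢
    linarith

lemma dimH_levelSet {β : ℝ} (hβ : minExp < β) :
    dimH (levelSet (β : EReal)) = ENNReal.ofReal (legendre β / β) := by
  have hβ0 : 0 < β := minExp_pos.trans hβ
  refine le_antisymm (dimH_levelSet_le_legendre hβ) (le_of_forall_lt fun c hc => ?_)
  have hc' : c ≠ ⊤ := ne_top_of_lt hc
  obtain ⟨s, hs, hs'⟩ := exists_between ((ENNReal.lt_ofReal_iff_toReal_lt hc').mp hc)
  have hs0 : 0 < s := ENNReal.toReal_nonneg.trans_lt hs
  rw [lt_div_iff₀ hβ0] at hs'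
  obtain ⟨L, M, hL, hM, ⟨F⟩⟩ := exists_blocks hβ hs0 hs'
  exact ((ENNReal.lt_ofReal_iff_toReal_lt hc').mpr hs).trans_le (F.le_dimH hβ0 hL hs0 hM)

lemma rateI_eq {β : ℝ} (hβ : minExp < β) : rateI β = β - legendre β := by
  have hβ0 : 0 < β := minExp_pos.trans hβ
  rw [rateI, dimSpec, dimH_levelSet hβ,
    ENNReal.toReal_ofReal (div_nonneg (legendre_pos hβ).le hβ0.le)]
  field_simp

lemma deriv_rateI {α s : ℝ} (hα : minExp < α) (hs : 1 / 2 < s)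
    (h : ∀ t, 1 / 2 < t → pressure s + s * α ≤ pressure t + t * α) :
    deriv rateI α = 1 - s := by
  have h1 : rateI =ᶠ[nhds α] fun β => β - legendre β := by
    filter_upwards [lt_mem_nhds hα] with β hβ using rateI_eq hβ
  exact h1.deriv_eq.trans ((hasDerivAt_id α).sub (hasDerivAt_legendre hα hs h)).deriv

lemma measurable_mob (w : List ℕ) : Measurable (mob w) := by
  induction w with
  | nil => exact measurable_id
  | cons a w ih => exact measurable_const.div (measurable_const.add ih)

lemma measurable_den (w : List ℕ) : Measurable (den w) := by
  induction w with
  | nil => exact measurable_const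
  | cons a w ih => exact (measurable_const.add (measurable_mob w)).mul ih

lemma measurable_lg (w : List ℕ) : Measurable (lg w) :=
  (Real.measurable_log.comp (measurable_den w)).const_mul 2

lemma exp_neg_lg_singleton (a : ℕ) {x : ℝ} (hx : 0 ≤ x) :
    Real.exp (-1 * lg [a] x) = (((a : ℝ) + 1 + x) ^ 2)⁻¹ := by
  have h : (0 : ℝ) < a + 1 + x := by positivity
  rw [lg_singleton, show -1 * (2 * Real.log (a + 1 + x)) = -Real.log ((a + 1 + x) ^ 2) by
    rw [Real.log_pow]; push_cast; ring, Real.exp_neg, Real.exp_log (by positivity)]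

lemma image_branch (a : ℕ) :
    (fun x : ℝ => 1 / ((a : ℝ) + 1 + x)) '' Ico 0 1 = {y ∈ Ioc (0 : ℝ) 1 | ⌊1 / y⌋₊ = a + 1} := by
  ext y
  constructor
  · rintro ⟨x, ⟨hx0, hx1⟩, rfl⟩
    have h : (0 : ℝ) < a + 1 + x := by positivity
    refine ⟨⟨by positivity, ?_⟩, ?_⟩
    · rw [div_le_one h]
      linarith [a.cast_nonneg (α := ℝ)]
    · simp only [one_div_one_div]
      rw [Nat.floor_eq_iff h.le]
      push_cast
      constructor <;> linarith
  · rintro ⟨⟨hy0, hy1⟩, hy⟩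
    rw [Nat.floor_eq_iff (by positivity)] at hy
    push_cast at hy
    refine ⟨1 / y - (a + 1), ⟨by linarith, by linarith⟩, ?_⟩
    simp

/-- The transfer operator with parameter `1` preserves the Lebesgue integral. -/
lemma lintegral_transfer {f : ℝ → ENNReal} (hf : Measurable f) :
    ∫⁻ x in Ico 0 1, transfer 1 f x = ∫⁻ x in Ico 0 1, f x := by
  have hunion : Ioc (0 : ℝ) 1 = ⋃ a : ℕ, {y ∈ Ioc (0 : ℝ) 1 | ⌊1 / y⌋₊ = a + 1} := by
    ext y
    simp only [mem_iUnion, mem_ofPred_eq]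
    refine ⟨fun hy => ⟨⌊1 / y⌋₊ - 1, hy, ?_⟩, fun ⟨_, hy, _⟩ => hy⟩
    have : 1 ≤ ⌊1 / y⌋₊ := Nat.le_floor (by simpa using (one_le_div hy.1).mpr hy.2)
    omega
  have hmeas : ∀ a : ℕ, MeasurableSet {y ∈ Ioc (0 : ℝ) 1 | ⌊1 / y⌋₊ = a + 1} := fun a =>
    measurableSet_Ioc.inter ((Nat.measurable_floor.comp (measurable_const.div measurable_id))
      (measurableSet_singleton (a + 1)))
  have hdisj : Pairwise (Function.onFun Disjoint
      fun a : ℕ => {y ∈ Ioc (0 : ℝ) 1 | ⌊1 / y⌋₊ = a + 1}) := fun a b hab =>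
    disjoint_left.mpr fun y ha hb => hab (by have h1 := ha.2; have h2 := hb.2; omega)
  rw [setLIntegral_congr (f := f) (Ico_ae_eq_Ioc (μ := volume) (a := (0 : ℝ)) (b := 1)), hunion,
    lintegral_iUnion hmeas hdisj]
  unfold transfer
  rw [lintegral_tsum]
  · refine tsum_congr fun a => ?_
    rw [← image_branch, lintegral_image_eq_lintegral_abs_deriv_mul
      (f' := fun x => -(((a : ℝ) + 1 + x) ^ 2)⁻¹) measurableSet_Ico]
    · refine setLIntegral_congr_fun measurableSet_Ico fun x hx => ?_
      simp only [abs_neg]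
      rw [exp_neg_lg_singleton a hx.1, abs_of_nonneg (by positivity)]
    · intro x hx
      have h : ((a : ℝ) + 1 + x) ≠ 0 := by have := hx.1; positivity
      have := (((hasDerivAt_id' x).const_add ((a : ℝ) + 1)).fun_inv h).hasDerivWithinAt
        (s := Ico 0 1)
      simpa [one_div, neg_div] using this
    · intro x hx y hy h
      simpa using h
  · intro a
    exact ((Real.measurable_exp.comp ((measurable_lg [a]).const_mul (-1))).ennreal_ofReal.mul
      (hf.comp (measurable_const.div (measurable_const.add measurable_id)))).aemeasurable

lemma tsum_words_succ (n : ℕ) (φ : List ℕ → ENNReal) :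
    ∑' w : Fin (n + 1) → ℕ, φ (List.ofFn w) =
      ∑' a : ℕ, ∑' u : Fin n → ℕ, φ (List.ofFn u ++ [a]) := by
  rw [← Equiv.tsum_eq (Fin.snocEquiv fun _ => ℕ), ← ENNReal.tsum_prod]
  refine tsum_congr fun c => ?_
  rw [List.ofFn_succ']
  simp [Fin.snocEquiv_apply]

/-- The density of the Gauss measure, up to normalisation. -/
noncomputable def gaussDensity (x : ℝ) : ℝ := 1 / (1 + x)

lemma gaussDensity_pos {x : ℝ} (hx : 0 ≤ x) : 0 < gaussDensity x := by
  unfold gaussDensity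
  positivity

lemma measurable_gaussDensity : Measurable gaussDensity :=
  measurable_const.div (measurable_const.add measurable_id)

lemma transfer_gaussDensity {x : ℝ} (hx : 0 ≤ x) :
    transfer 1 (fun y => ENNReal.ofReal (gaussDensity y)) x =
      ENNReal.ofReal (gaussDensity x) := by
  unfold transfer
  have term : ∀ a : ℕ, ENNReal.ofReal (Real.exp (-1 * lg [a] x)) *
      ENNReal.ofReal (gaussDensity (1 / ((a : ℝ) + 1 + x))) =
      ENNReal.ofReal (1 / ((a : ℝ) + 1 + x) - 1 / (((a + 1 : ℕ) : ℝ) + 1 + x)) := fun a => by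
    rw [← ENNReal.ofReal_mul (Real.exp_pos _).le, exp_neg_lg_singleton a hx]
    congr 1
    have h : (0 : ℝ) < a + 1 + x := by positivity
    unfold gaussDensity
    push_cast
    field_simp
    ring
  have hnn : ∀ a : ℕ, 0 ≤ 1 / ((a : ℝ) + 1 + x) - 1 / (((a + 1 : ℕ) : ℝ) + 1 + x) := fun a => by
    rw [sub_nonneg]
    push_cast
    exact one_div_le_one_div_of_le (by positivity) (by linarith)
  have hlim : Tendsto (fun a : ℕ => 1 / ((a : ℝ) + 1 + x)) atTop (nhds 0) := by
    refine Tendsto.div_atTop tendsto_const_nhds ?_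
    exact tendsto_atTop_add_const_right _ _
      (tendsto_atTop_add_const_right _ _ tendsto_natCast_atTop_atTop)
  have hsum : HasSum (fun a : ℕ => 1 / ((a : ℝ) + 1 + x) - 1 / (((a + 1 : ℕ) : ℝ) + 1 + x))
      (gaussDensity x) := by
    rw [hasSum_iff_tendsto_nat_of_nonneg hnn]
    simp only [Finset.sum_range_sub' (fun a : ℕ => 1 / ((a : ℝ) + 1 + x))]
    simpa [gaussDensity] using tendsto_const_nhds.sub hlim
  rw [tsum_congr term, ← ENNReal.ofReal_tsum_of_nonneg hnn hsum.summable, hsum.tsum_eq]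

/-- The iterated transfer operator applied to the Gauss density. -/
noncomputable def gaussSum (n : ℕ) (x : ℝ) : ENNReal :=
  ∑' w : Fin n → ℕ, ENNReal.ofReal (Real.exp (-1 * lg (List.ofFn w) x)) *
    ENNReal.ofReal (gaussDensity (mob (List.ofFn w) x))

/-- The iterated transfer operator applied to the Gauss density, weighted by `lg`. -/
noncomputable def gaussLgSum (n : ℕ) (x : ℝ) : ENNReal :=
  ∑' w : Fin n → ℕ, ENNReal.ofReal (Real.exp (-1 * lg (List.ofFn w) x)) *
    ENNReal.ofReal (gaussDensity (mob (List.ofFn w) x)) * ENNReal.ofReal (lg (List.ofFn w) x)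

lemma measurable_gaussLgSum (n : ℕ) : Measurable (gaussLgSum n) :=
  Measurable.tsum fun _ =>
    ((Real.measurable_exp.comp ((measurable_lg _).const_mul (-1))).ennreal_ofReal.mul
      (measurable_gaussDensity.comp (measurable_mob _)).ennreal_ofReal).mul
      (measurable_lg _).ennreal_ofReal

lemma exp_lg_append (u : List ℕ) (a : ℕ) {x : ℝ} (hx : 0 ≤ x) :
    ENNReal.ofReal (Real.exp (-1 * lg (u ++ [a]) x)) = ENNReal.ofReal (Real.exp (-1 * lg [a] x)) *
      ENNReal.ofReal (Real.exp (-1 * lg u (1 / ((a : ℝ) + 1 + x)))) := by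
  rw [lg_append _ _ hx, ← ENNReal.ofReal_mul (Real.exp_pos _).le, ← Real.exp_add]
  simp only [mob]
  congr 2
  ring

lemma gaussSum_eq (n : ℕ) {x : ℝ} (hx : 0 ≤ x) :
    gaussSum n x = ENNReal.ofReal (gaussDensity x) := by
  induction n generalizing x with
  | zero => simp [gaussSum, lg_nil, mob]
  | succ n ih =>
    rw [← transfer_gaussDensity hx]
    unfold gaussSum transfer
    rw [tsum_words_succ n fun w => ENNReal.ofReal (Real.exp (-1 * lg w x)) *
      ENNReal.ofReal (gaussDensity (mob w x))]
    refine tsum_congr fun a => ?_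
    beta_reduce
    rw [← ih (branch_mem a hx).1, gaussSum, ← ENNReal.tsum_mul_left]
    refine tsum_congr fun u => ?_
    rw [exp_lg_append _ a hx, mob_append, mul_assoc]
    simp only [mob]

lemma gaussLgSum_succ (n : ℕ) {x : ℝ} (hx : 0 ≤ x) :
    gaussLgSum (n + 1) x = transfer 1 (gaussLgSum n) x +
      transfer 1 (fun y => ENNReal.ofReal (gaussDensity y) *
        ENNReal.ofReal (-2 * Real.log y)) x := by
  unfold transfer
  rw [← ENNReal.tsum_add]
  unfold gaussLgSum
  rw [tsum_words_succ n fun w => ENNReal.ofReal (Real.exp (-1 * lg w x)) *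
      ENNReal.ofReal (gaussDensity (mob w x)) * ENNReal.ofReal (lg w x)]
  refine tsum_congr fun a => ?_
  have hy := (branch_mem a hx).1
  beta_reduce
  rw [← gaussSum_eq n hy, gaussSum, ← ENNReal.tsum_mul_left, ← ENNReal.tsum_mul_right,
    ← ENNReal.tsum_mul_left, ← ENNReal.tsum_add]
  refine tsum_congr fun u => ?_
  have h1 : lg [a] x = -2 * Real.log (1 / ((a : ℝ) + 1 + x)) := by
    rw [lg_singleton, one_div, Real.log_inv]
    ring
  rw [exp_lg_append _ a hx, mob_append, lg_append _ [a] hx, ← h1,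
    ENNReal.ofReal_add (lg_nonneg _ (mob_nonneg [a] hx)) (lg_nonneg [a] hx)]
  simp only [mob]
  ring

lemma lintegral_gaussLgSum (n : ℕ) : ∫⁻ x in Ico 0 1, gaussLgSum n x = n *
    ∫⁻ x in Ico (0 : ℝ) 1, ENNReal.ofReal (gaussDensity x) * ENNReal.ofReal (-2 * Real.log x) := by
  induction n with
  | zero => simp [gaussLgSum, lg_nil]
  | succ n ih =>
    have hm : Measurable fun x =>
        ENNReal.ofReal (gaussDensity x) * ENNReal.ofReal (-2 * Real.log x) :=
      measurable_gaussDensity.ennreal_ofReal.mul (Real.measurable_log.const_mul _).ennreal_ofReal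
    have hm' : Measurable (transfer 1 (gaussLgSum n)) := Measurable.tsum fun a =>
      (Real.measurable_exp.comp ((measurable_lg [a]).const_mul (-1))).ennreal_ofReal.mul
        ((measurable_gaussLgSum n).comp (measurable_const.div (measurable_const.add measurable_id)))
    rw [setLIntegral_congr_fun measurableSet_Ico fun x hx => gaussLgSum_succ n hx.1,
      lintegral_add_left hm', lintegral_transfer (measurable_gaussLgSum n), lintegral_transfer hm,
      ih]
    push_cast
    ring

lemma hasSum_alternating_squares :
    HasSum (fun k : ℕ => 1 / ((2 * k + 1 : ℕ) : ℝ) ^ 2 - 1 / ((2 * k + 2 : ℕ) : ℝ) ^ 2)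
      (Real.pi ^ 2 / 12) := by
  have h : HasSum (fun n : ℕ => 1 / ((n + 1 : ℕ) : ℝ) ^ 2) (Real.pi ^ 2 / 6) := by
    simpa using (hasSum_nat_add_iff' 1).mpr hasSum_zeta_two
  have hodd : HasSum (fun k : ℕ => 1 / ((2 * k + 2 : ℕ) : ℝ) ^ 2) (Real.pi ^ 2 / 6 / 4) := by
    refine (h.div_const 4).congr_fun fun k => ?_
    push_cast
    field_simp
    ring
  have heven : Summable fun k : ℕ => 1 / ((2 * k + 1 : ℕ) : ℝ) ^ 2 :=
    h.summable.comp_injective (i := fun k : ℕ => 2 * k) fun a b hab => by simpa using hab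
  obtain ⟨A, hA⟩ := heven
  have hsum := (hA.even_add_odd hodd (f := fun n : ℕ => 1 / ((n + 1 : ℕ) : ℝ) ^ 2)).unique h
  rw [show Real.pi ^ 2 / 12 = A - Real.pi ^ 2 / 6 / 4 by linarith]
  exact hA.sub hodd

/-- An antiderivative of `-x ^ j * log x`. -/
noncomputable def logPrimitive (j : ℕ) (x : ℝ) : ℝ :=
  x ^ j * (x / (j + 1) ^ 2 - x * Real.log x / (j + 1))

lemma continuous_logPrimitive (j : ℕ) : Continuous (logPrimitive j) := by
  have := Real.continuous_mul_log
  unfold logPrimitive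
  fun_prop

lemma hasDerivAt_logPrimitive (j : ℕ) {x : ℝ} (hx : 0 < x) :
    HasDerivAt (logPrimitive j) (-Real.log x * x ^ j) x := by
  have h1 : HasDerivAt (fun x : ℝ => x ^ (j + 1) * (1 / ((j : ℝ) + 1) ^ 2 - Real.log x / (j + 1)))
      (((j + 1 : ℕ) * x ^ j) * (1 / ((j : ℝ) + 1) ^ 2 - Real.log x / (j + 1)) +
        x ^ (j + 1) * (-(x⁻¹ / (j + 1)))) x :=
    (by simpa using hasDerivAt_pow (j + 1) x : HasDerivAt (fun x : ℝ => x ^ (j + 1))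
      (((j + 1 : ℕ) * x ^ j)) x).mul (((Real.hasDerivAt_log hx.ne').div_const _).const_sub _)
  have h2 : logPrimitive j =
      fun x : ℝ => x ^ (j + 1) * (1 / ((j : ℝ) + 1) ^ 2 - Real.log x / (j + 1)) := by
    funext x
    unfold logPrimitive
    ring
  rw [h2]
  convert h1 using 1
  push_cast
  field_simp
  ring

lemma lintegral_log_pair (k : ℕ) :
    ∫⁻ x in Ico (0 : ℝ) 1, ENNReal.ofReal (-Real.log x * x ^ (2 * k) * (1 - x)) =
      ENNReal.ofReal (1 / ((2 * k + 1 : ℕ) : ℝ) ^ 2 - 1 / ((2 * k + 2 : ℕ) : ℝ) ^ 2) := by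
  have hc : Continuous fun x => logPrimitive (2 * k) x - logPrimitive (2 * k + 1) x :=
    (continuous_logPrimitive _).sub (continuous_logPrimitive _)
  have hd : ∀ x ∈ Ioo (0 : ℝ) 1,
      HasDerivAt (fun x => logPrimitive (2 * k) x - logPrimitive (2 * k + 1) x)
        (-Real.log x * x ^ (2 * k) * (1 - x)) x := fun x hx => by
    refine ((hasDerivAt_logPrimitive (2 * k) hx.1).fun_sub
      (hasDerivAt_logPrimitive (2 * k + 1) hx.1)).congr_deriv ?_
    ring
  have hnn : ∀ x ∈ Ioo (0 : ℝ) 1, 0 ≤ -Real.log x * x ^ (2 * k) * (1 - x) := fun x hx =>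
    mul_nonneg (mul_nonneg (neg_nonneg.mpr (Real.log_nonpos hx.1.le hx.2.le))
      (pow_nonneg hx.1.le _)) (by linarith [hx.2])
  have hi := intervalIntegral.integrableOn_deriv_of_nonneg hc.continuousOn hd hnn
  have hI := intervalIntegral.integral_eq_sub_of_hasDerivAt_of_le zero_le_one hc.continuousOn hd
    ((intervalIntegrable_iff_integrableOn_Ioc_of_le zero_le_one).mpr hi)
  rw [intervalIntegral.integral_of_le zero_le_one, integral_Ioc_eq_integral_Ioo] at hI
  rw [setLIntegral_congr (Ioo_ae_eq_Ico (μ := volume) (a := (0 : ℝ)) (b := 1)).symm,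
    ← ofReal_integral_eq_lintegral_ofReal (hi.mono_set Ioo_subset_Ioc_self)
      ((ae_restrict_iff' measurableSet_Ioo).mpr (Eventually.of_forall hnn)), hI]
  congr 1
  simp [logPrimitive]
  ring

lemma lintegral_gaussDensity_log :
    ∫⁻ x in Ico (0 : ℝ) 1, ENNReal.ofReal (gaussDensity x) * ENNReal.ofReal (-2 * Real.log x) =
      ENNReal.ofReal (Real.pi ^ 2 / 6) := by
  have hnn : ∀ x ∈ Ico (0 : ℝ) 1, ∀ k : ℕ, 0 ≤ -Real.log x * x ^ (2 * k) * (1 - x) :=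
    fun x hx k => mul_nonneg (mul_nonneg (neg_nonneg.mpr (Real.log_nonpos hx.1 hx.2.le))
      (pow_nonneg hx.1 _)) (by linarith [hx.2])
  have hexp : ∀ x ∈ Ico (0 : ℝ) 1,
      ENNReal.ofReal (gaussDensity x) * ENNReal.ofReal (-2 * Real.log x) =
        2 * ∑' k : ℕ, ENNReal.ofReal (-Real.log x * x ^ (2 * k) * (1 - x)) := fun x hx => by
    have hsq : x ^ 2 < 1 := by nlinarith [hx.1, hx.2]
    have hs : HasSum (fun k : ℕ => -Real.log x * x ^ (2 * k) * (1 - x))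
        (-Real.log x * (1 - x ^ 2)⁻¹ * (1 - x)) := by
      simp only [pow_mul]
      exact ((hasSum_geometric_of_lt_one (sq_nonneg x) hsq).mul_left _).mul_right _
    rw [← ENNReal.ofReal_tsum_of_nonneg (hnn x hx) hs.summable, hs.tsum_eq,
      ← ENNReal.ofReal_mul (gaussDensity_pos hx.1).le,
      show (2 : ENNReal) = ENNReal.ofReal 2 by simp, ← ENNReal.ofReal_mul zero_le_two]
    congr 1
    have h1 : 1 - x ≠ 0 := by linarith [hx.2]
    have h2 : 1 + x ≠ 0 := by linarith [hx.1]
    rw [gaussDensity, show 1 - x ^ 2 = (1 - x) * (1 + x) by ring]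
    field_simp
  have hm : ∀ k : ℕ, Measurable fun x : ℝ =>
      ENNReal.ofReal (-Real.log x * x ^ (2 * k) * (1 - x)) := fun k => by fun_prop
  rw [setLIntegral_congr_fun measurableSet_Ico hexp,
    lintegral_const_mul _ (Measurable.tsum fun k => hm k),
    lintegral_tsum fun k => (hm k).aemeasurable]
  simp only [lintegral_log_pair]
  rw [← ENNReal.ofReal_tsum_of_nonneg _ hasSum_alternating_squares.summable,
    hasSum_alternating_squares.tsum_eq, show (2 : ENNReal) = ENNReal.ofReal 2 by simp,
    ← ENNReal.ofReal_mul zero_le_two]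
  · congr 1
    ring
  · intro k
    rw [sub_nonneg]
    push_cast
    exact one_div_le_one_div_of_le (by positivity) (by gcongr; norm_num)

lemma lintegral_gaussDensity :
    ∫⁻ x in Ico (0 : ℝ) 1, ENNReal.ofReal (gaussDensity x) = ENNReal.ofReal (Real.log 2) := by
  have hpos : ∀ x ∈ Icc (0 : ℝ) 1, 1 + x ≠ 0 := fun x hx => by linarith [hx.1]
  have hc : ContinuousOn (fun x : ℝ => Real.log (1 + x)) (Icc 0 1) :=
    (continuousOn_const.add continuousOn_id).log hpos
  have hd : ∀ x ∈ Ioo (0 : ℝ) 1, HasDerivAt (fun x : ℝ => Real.log (1 + x)) (gaussDensity x) x :=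
    fun x hx => ((hasDerivAt_id' x).const_add 1).log (hpos x (Ioo_subset_Icc_self hx))
  have hnn : ∀ x ∈ Ioo (0 : ℝ) 1, 0 ≤ gaussDensity x := fun x hx => (gaussDensity_pos hx.1.le).le
  have hi := intervalIntegral.integrableOn_deriv_of_nonneg hc hd hnn
  have hI := intervalIntegral.integral_eq_sub_of_hasDerivAt_of_le zero_le_one hc hd
    ((intervalIntegrable_iff_integrableOn_Ioc_of_le zero_le_one).mpr hi)
  rw [intervalIntegral.integral_of_le zero_le_one, integral_Ioc_eq_integral_Ioo] at hI
  rw [setLIntegral_congr (Ioo_ae_eq_Ico (μ := volume) (a := (0 : ℝ)) (b := 1)).symm,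
    ← ofReal_integral_eq_lintegral_ofReal (hi.mono_set Ioo_subset_Ioc_self)
      ((ae_restrict_iff' measurableSet_Ioo).mpr (Eventually.of_forall hnn)), hI]
  norm_num

lemma gaussDensity_le_one {x : ℝ} (hx : 0 ≤ x) : gaussDensity x ≤ 1 := by
  unfold gaussDensity
  rw [div_le_one (by linarith)]
  linarith

/-- The tangent line inequality for the exponential function, summed against the Gauss density. -/
lemma gaussSum_le_Z {t m : ℝ} (ht : t ≤ 1) (hm : 0 ≤ m) (n : ℕ) {x : ℝ} (hx : 0 ≤ x) :
    ENNReal.ofReal (Real.exp m) * (gaussSum n x + ENNReal.ofReal (1 - t) * gaussLgSum n x) ≤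
      Z t n x + ENNReal.ofReal (Real.exp m * m) * gaussSum n x := by
  unfold gaussSum gaussLgSum Z
  rw [← ENNReal.tsum_mul_left, ← ENNReal.tsum_mul_left, ← ENNReal.tsum_add,
    ← ENNReal.tsum_mul_left, ← ENNReal.tsum_add]
  refine ENNReal.tsum_le_tsum fun w => ?_
  set l := lg (List.ofFn w) x
  set h := gaussDensity (mob (List.ofFn w) x)
  have hl : 0 ≤ l := lg_nonneg _ hx
  have h0 : 0 ≤ h := (gaussDensity_pos (mob_nonneg _ hx)).le
  have h1 : h ≤ 1 := gaussDensity_le_one (mob_nonneg _ hx)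
  have hE := Real.exp_pos (-1 * l)
  have ht' : 0 ≤ 1 - t := by linarith
  rw [← ENNReal.ofReal_mul hE.le, ← ENNReal.ofReal_mul (by positivity),
    ← ENNReal.ofReal_mul (by positivity), ← ENNReal.ofReal_add (by positivity) (by positivity),
    ← ENNReal.ofReal_mul (by positivity), ← ENNReal.ofReal_mul (by positivity),
    ← ENNReal.ofReal_add (by positivity) (by positivity)]
  refine ENNReal.ofReal_le_ofReal ?_
  have h2 : Real.exp m * (1 + (1 - t) * l - m) ≤ Real.exp ((1 - t) * l) := by
    have := Real.add_one_le_exp ((1 - t) * l - m)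
    calc Real.exp m * (1 + (1 - t) * l - m) ≤ Real.exp m * Real.exp ((1 - t) * l - m) := by
          gcongr; linarith
      _ = _ := by rw [← Real.exp_add]; congr 1; ring
  have h3 : Real.exp (-t * l) = Real.exp (-1 * l) * Real.exp ((1 - t) * l) := by
    rw [← Real.exp_add]; congr 1; ring
  have h4 : Real.exp (-1 * l) * h * Real.exp ((1 - t) * l) ≤ Real.exp (-t * l) := by
    rw [h3]
    have := mul_le_mul_of_nonneg_left h1
      (mul_pos hE (Real.exp_pos ((1 - t) * l))).le
    linarith
  have h5 := mul_le_mul_of_nonneg_left h2 (mul_nonneg hE.le h0)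
  nlinarith

/-- The pressure lies above its tangent line at `1`, whose slope is the Lyapunov exponent of the
Gauss measure. -/
lemma levy_mul_le_pressure {t : ℝ} (ht : 1 / 2 < t) (ht1 : t ≤ 1) :
    2 * levyConst * (1 - t) ≤ pressure t := by
  have hlog : 0 < Real.log 2 := Real.log_pos one_lt_two
  refine le_pressure (c := -Real.log (Real.log 2)) ht fun n => ?_
  set m := n * (2 * levyConst * (1 - t)) with hm
  have hm0 : 0 ≤ m := by
    have : 0 ≤ levyConst := by unfold levyConst; positivity
    exact mul_nonneg n.cast_nonneg (mul_nonneg (by linarith) (by linarith))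
  have hmeas : Measurable fun x => ENNReal.ofReal (gaussDensity x) :=
    measurable_gaussDensity.ennreal_ofReal
  have hmeas' : Measurable fun x =>
      ENNReal.ofReal (gaussDensity x) + ENNReal.ofReal (1 - t) * gaussLgSum n x :=
    hmeas.add ((measurable_gaussLgSum n).const_mul _)
  have key : ENNReal.ofReal (Real.exp m) * (ENNReal.ofReal (Real.log 2) +
      ENNReal.ofReal (1 - t) * (n * ENNReal.ofReal (Real.pi ^ 2 / 6))) ≤
      Z t n 0 + ENNReal.ofReal (Real.exp m * m) * ENNReal.ofReal (Real.log 2) := by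
    rw [← lintegral_gaussDensity, ← lintegral_gaussDensity_log, ← lintegral_gaussLgSum,
      ← lintegral_const_mul _ (measurable_gaussLgSum n), ← lintegral_add_left hmeas,
      ← lintegral_const_mul _ hmeas',
      ← lintegral_const_mul _ hmeas]
    calc _ ≤ ∫⁻ x in Ico (0 : ℝ) 1, (Z t n 0 +
          ENNReal.ofReal (Real.exp m * m) * ENNReal.ofReal (gaussDensity x)) := by
          refine setLIntegral_mono' measurableSet_Ico fun x hx => ?_
          have := gaussSum_le_Z ht1 hm0 n hx.1
          rw [gaussSum_eq n hx.1] at this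
          exact this.trans (by gcongr; exact Z_le_Z_zero (by linarith) n hx.1)
      _ = _ := by
          rw [lintegral_add_left measurable_const]
          simp
  have hZ := Z_ne_top ht n
  rw [← ENNReal.ofReal_toReal hZ] at key ⊢
  have ht' : 0 ≤ 1 - t := by linarith
  rw [← ENNReal.ofReal_natCast n, ← ENNReal.ofReal_mul n.cast_nonneg, ← ENNReal.ofReal_mul ht',
    ← ENNReal.ofReal_add hlog.le (by positivity), ← ENNReal.ofReal_mul (Real.exp_pos _).le,
    ← ENNReal.ofReal_mul (by positivity),
    ← ENNReal.ofReal_add ENNReal.toReal_nonneg (by positivity),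
    ENNReal.ofReal_le_ofReal_iff (add_nonneg ENNReal.toReal_nonneg (by positivity))] at key
  refine ENNReal.ofReal_le_ofReal ?_
  have h1 : (1 - t) * (n * (Real.pi ^ 2 / 6)) = m * Real.log 2 := by
    rw [hm, levyConst]
    field_simp
    ring
  rw [h1] at key
  rw [sub_neg_eq_add, Real.exp_add, Real.exp_log hlog]
  linarith

lemma pressure_one_nonpos : pressure 1 ≤ 0 := by
  refine pressure_le (c := Real.log 2) (by norm_num) fun n => ?_
  rw [mul_zero, zero_add, Real.exp_log two_pos]
  have h := gaussSum_eq n (le_refl (0 : ℝ))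
  calc Z 1 n 0 ≤ ENNReal.ofReal 2 * gaussSum n 0 := by
        unfold Z gaussSum
        rw [← ENNReal.tsum_mul_left]
        refine ENNReal.tsum_le_tsum fun w => ?_
        rw [← ENNReal.ofReal_mul (Real.exp_pos _).le, ← ENNReal.ofReal_mul zero_le_two]
        refine ENNReal.ofReal_le_ofReal ?_
        have h1 : 1 / 2 ≤ gaussDensity (mob (List.ofFn w) 0) :=
          one_div_le_one_div_of_le (by linarith [mob_nonneg (List.ofFn w) (le_refl (0 : ℝ))])
            (by linarith [mob_le_one (List.ofFn w) (le_refl (0 : ℝ)) zero_le_one])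
        nlinarith [Real.exp_pos (-1 * lg (List.ofFn w) 0)]
    _ = ENNReal.ofReal 2 := by rw [h]; simp [gaussDensity]

lemma one_le_minimizer {α s : ℝ} (hα : α < 2 * levyConst) (hs : 1 / 2 < s)
    (h : ∀ t, 1 / 2 < t → pressure s + s * α ≤ pressure t + t * α) : 1 ≤ s := by
  by_contra! hs1
  have h1 := h 1 (by norm_num)
  have h2 := levy_mul_le_pressure hs hs1.le
  nlinarith [pressure_one_nonpos]

/-- The Chernoff bound for the lower tail. -/
lemma volume_lg_le {α s : ℝ} (hα : minExp < α) (hs : 1 ≤ s)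
    (h : ∀ t, 1 / 2 < t → pressure s + s * α ≤ pressure t + t * α) (n : ℕ) :
    volume {x : ℝ | IrrUnit x ∧ lg (letters n x) 0 ≤ α * n} ≤
      ENNReal.ofReal (Real.exp (s * (2 * Real.log 2) - rateI α * n)) := by
  have hs' : 1 / 2 < s := by linarith
  calc volume {x : ℝ | IrrUnit x ∧ lg (letters n x) 0 ≤ α * n}
      ≤ volume (⋃ w : {w : Fin n → ℕ // lg (List.ofFn w) 0 ≤ α * n},
          cyl (List.ofFn (w : Fin n → ℕ))) := by
        refine measure_mono fun x hx => ?_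
        obtain ⟨w, hw⟩ := exists_ofFn_letters n x
        have hx2 := hx.2
        rw [hw] at hx2
        exact mem_iUnion.mpr ⟨⟨w, hx2⟩, hx.1, by rw [List.length_ofFn, hw]⟩
    _ ≤ ∑' w : {w : Fin n → ℕ // lg (List.ofFn w) 0 ≤ α * n},
          volume (cyl (List.ofFn (w : Fin n → ℕ))) := measure_iUnion_le _
    _ ≤ ∑' w : {w : Fin n → ℕ // lg (List.ofFn w) 0 ≤ α * n},
          ENNReal.ofReal (Real.exp ((s - 1) * (α * n))) *
            ENNReal.ofReal (Real.exp (-s * lg (List.ofFn (w : Fin n → ℕ)) 0)) := by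
        refine ENNReal.tsum_le_tsum fun w => (volume_cyl_le _).trans ?_
        rw [inv_den_sq, ← ENNReal.ofReal_mul (Real.exp_pos _).le, ← Real.exp_add]
        refine ENNReal.ofReal_le_ofReal (Real.exp_le_exp.mpr ?_)
        nlinarith [w.2]
    _ ≤ ENNReal.ofReal (Real.exp ((s - 1) * (α * n))) * Z s n 0 := by
        rw [ENNReal.tsum_mul_left]
        gcongr
        exact ENNReal.tsum_comp_le_tsum_of_injective Subtype.val_injective
          fun w : Fin n → ℕ => ENNReal.ofReal (Real.exp (-s * lg (List.ofFn w) 0))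
    _ ≤ ENNReal.ofReal (Real.exp ((s - 1) * (α * n))) *
          ENNReal.ofReal (Real.exp (n * pressure s + s * (2 * Real.log 2))) := by
        gcongr
        exact Z_le hs' n
    _ = _ := by
        rw [← ENNReal.ofReal_mul (Real.exp_pos _).le, ← Real.exp_add, rateI_eq hα,
          legendre_eq hs' h]
        congr 2
        ring

lemma mob_mul_den_cons (a : ℕ) (w : List ℕ) :
    mob (a :: w) 0 * den (a :: w) 0 = den w 0 := by
  have h := mob_nonneg w (le_refl (0 : ℝ))
  have : (a : ℝ) + 1 + mob w 0 ≠ 0 := by positivity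
  simp only [mob, den]
  field_simp

lemma fib_le_den (w : List ℕ) :
    (Nat.fib (w.length + 1) : ℝ) ≤ den w 0 ∧ (Nat.fib w.length : ℝ) ≤ mob w 0 * den w 0 := by
  induction w with
  | nil => simp [mob, den]
  | cons a w ih =>
    rw [mob_mul_den_cons, List.length_cons]
    refine ⟨?_, ih.1⟩
    rw [Nat.fib_add_two]
    simp only [den]
    push_cast
    nlinarith [mul_nonneg (a.cast_nonneg (α := ℝ)) (den_pos w (le_refl (0 : ℝ))).le]

lemma fib_add_le_den (u : List ℕ) (a : ℕ) (v : List ℕ) :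
    (Nat.fib (u.length + v.length + 2) : ℝ) +
      a * (Nat.fib (u.length + 1) * Nat.fib (v.length + 1)) ≤ den (u ++ a :: v) 0 ∧
    (Nat.fib (u.length + v.length + 1) : ℝ) +
      a * (Nat.fib u.length * Nat.fib (v.length + 1)) ≤
        mob (u ++ a :: v) 0 * den (u ++ a :: v) 0 := by
  have ha : (0 : ℝ) ≤ a := a.cast_nonneg
  induction u with
  | nil =>
    obtain ⟨h1, h2⟩ := fib_le_den v
    rw [List.nil_append, mob_mul_den_cons]
    simp only [List.length_nil, zero_add, Nat.fib_one, Nat.fib_zero, Nat.cast_one, Nat.cast_zero,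
      zero_mul, mul_zero, one_mul, add_zero]
    refine ⟨?_, h1⟩
    rw [Nat.fib_add_two]
    simp only [den]
    push_cast
    nlinarith [mul_le_mul_of_nonneg_left h1 ha]
  | cons b u ih =>
    obtain ⟨h1, h2⟩ := ih
    rw [List.cons_append, mob_mul_den_cons, List.length_cons,
      show u.length + 1 + v.length + 1 = u.length + v.length + 2 by ring]
    refine ⟨?_, h1⟩
    have e1 : Nat.fib (u.length + 1 + v.length + 2) =
        Nat.fib (u.length + v.length + 1) + Nat.fib (u.length + v.length + 2) := by
      rw [show u.length + 1 + v.length + 2 = u.length + v.length + 1 + 2 by ring, Nat.fib_add_two]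
    have e2 : Nat.fib (u.length + 1 + 1) = Nat.fib u.length + Nat.fib (u.length + 1) :=
      Nat.fib_add_two
    rw [e1, e2]
    simp only [den]
    push_cast
    nlinarith [mul_nonneg (b.cast_nonneg (α := ℝ)) (den_pos (u ++ a :: v) (le_refl (0 : ℝ))).le]

open Real

lemma goldenRatio_pow_le (k : ℕ) : goldenRatio ^ k ≤ goldenRatio * Nat.fib (k + 1) := by
  have h := goldenRatio_mul_fib_succ_add_fib k
  have h1 : (Nat.fib k : ℝ) ≤ Nat.fib (k + 1) := by exact_mod_cast Nat.fib_le_fib_succ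
  have h2 : (0 : ℝ) ≤ Nat.fib (k + 1) := Nat.cast_nonneg _
  refine le_of_mul_le_mul_left ?_ goldenRatio_pos
  rw [← pow_succ', ← h, ← mul_assoc, ← sq, goldenRatio_sq]
  linarith

lemma mul_goldenRatio_pow_le (k : ℕ) :
    435 / 1000 * goldenRatio ^ (k + 3) ≤ Nat.fib (k + 3) := by
  have hsq := goldenRatio_sq
  have hφ : goldenRatio < 1.62 := by
    have := one_lt_goldenRatio
    nlinarith
  have h3 : goldenRatio ^ 3 = 2 * goldenRatio + 1 := by
    rw [pow_succ, hsq]; linarith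
  have h4 : goldenRatio ^ 4 = 3 * goldenRatio + 2 := by
    rw [pow_succ, h3]; linarith
  suffices h : 435 / 1000 * goldenRatio ^ (k + 3) ≤ Nat.fib (k + 3) ∧
      435 / 1000 * goldenRatio ^ (k + 4) ≤ Nat.fib (k + 4) from h.1
  induction k with
  | zero =>
    simp only [zero_add, h3, h4]
    rw [show Nat.fib 3 = 2 from rfl, show Nat.fib 4 = 3 from rfl]
    constructor <;> norm_num at hφ ⊢ <;> linarith
  | succ k ih =>
    refine ⟨ih.2, ?_⟩
    have h5 : goldenRatio ^ (k + 5) = goldenRatio ^ (k + 3) + goldenRatio ^ (k + 4) := by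
      have := goldenRatio_pow_sub_goldenRatio_pow (k + 3)
      linarith
    rw [show k + 1 + 4 = k + 5 by ring, h5, show k + 5 = k + 3 + 2 by ring, Nat.fib_add_two]
    push_cast
    linarith [ih.1, ih.2]

lemma letter_lt_five {u : List ℕ} {a : ℕ} {v : List ℕ}
    (h : den (u ++ a :: v) 0 ≤ goldenRatio ^ (u.length + v.length + 1)) : a < 5 := by
  have h1 := (fib_add_le_den u a v).1.trans h
  have h2 := goldenRatio_pow_le u.length
  have h3 := goldenRatio_pow_le v.length
  have hφ := goldenRatio_pos
  have hu : (0 : ℝ) < Nat.fib (u.length + 1) := by exact_mod_cast Nat.fib_pos.mpr (by omega)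
  have hv : (0 : ℝ) < Nat.fib (v.length + 1) := by exact_mod_cast Nat.fib_pos.mpr (by omega)
  have h0 : (0 : ℝ) ≤ Nat.fib (u.length + v.length + 2) := Nat.cast_nonneg _
  have h4 : (a : ℝ) * (Nat.fib (u.length + 1) * Nat.fib (v.length + 1)) ≤
      goldenRatio ^ 3 * (Nat.fib (u.length + 1) * Nat.fib (v.length + 1)) := by
    calc _ ≤ goldenRatio ^ (u.length + v.length + 1) := by linarith
      _ = goldenRatio * (goldenRatio ^ u.length * goldenRatio ^ v.length) := by ring
      _ ≤ goldenRatio * ((goldenRatio * Nat.fib (u.length + 1)) *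
          (goldenRatio * Nat.fib (v.length + 1))) := by gcongr
      _ = _ := by ring
  have h5 := le_of_mul_le_mul_right h4 (mul_pos hu hv)
  have h6 : goldenRatio ^ 3 < 5 := by
    rw [pow_succ, goldenRatio_sq]
    nlinarith [goldenRatio_sq, goldenRatio_lt_two]
  exact_mod_cast h5.trans_lt h6

lemma letter_eq_zero {u : List ℕ} {a : ℕ} {v : List ℕ} (hu : 2 ≤ u.length) (hv : 2 ≤ v.length)
    (h : den (u ++ a :: v) 0 ≤ goldenRatio ^ (u.length + v.length + 1)) : a = 0 := by
  by_contra ha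
  have ha' : (1 : ℝ) ≤ a := by exact_mod_cast Nat.one_le_iff_ne_zero.mpr ha
  have h1 := (fib_add_le_den u a v).1.trans h
  obtain ⟨i, hi⟩ := Nat.exists_eq_add_of_le' hu
  obtain ⟨j, hj⟩ := Nat.exists_eq_add_of_le' hv
  rw [hi, hj] at h1
  have h2 := mul_goldenRatio_pow_le i
  have h3 := mul_goldenRatio_pow_le j
  have h4 := mul_goldenRatio_pow_le (i + j + 3)
  rw [show i + j + 3 + 3 = i + 2 + (j + 2) + 2 by ring] at h4
  have h5 := mul_le_mul h2 h3 (by positivity) (Nat.cast_nonneg _)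
  set P := goldenRatio ^ (i + 2 + (j + 2) + 1) with hP
  have hP0 : 0 < P := pow_pos goldenRatio_pos _
  have h6 : goldenRatio ^ (i + 2 + (j + 2) + 2) = P * goldenRatio := by rw [hP]; ring
  have h7 : 435 / 1000 * goldenRatio ^ (i + 3) * (435 / 1000 * goldenRatio ^ (j + 3)) =
      (435 / 1000) ^ 2 * (P * goldenRatio) := by rw [hP]; ring
  rw [h6] at h4
  rw [h7] at h5
  have h8 : 1 * ((Nat.fib (i + 3) : ℝ) * Nat.fib (j + 3)) ≤
      a * (Nat.fib (i + 3) * Nat.fib (j + 3)) := by gcongr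
  have hφ : 1.61 < goldenRatio := by
    have := one_lt_goldenRatio
    nlinarith [goldenRatio_sq]
  norm_num at hφ
  nlinarith [mul_lt_mul_of_pos_left hφ hP0]

/-- The words whose letters are small, and zero away from the ends. -/
def extremalWords (n : ℕ) : Finset (Fin n → ℕ) :=
  Fintype.piFinset fun i => if 2 ≤ (i : ℕ) ∧ (i : ℕ) + 3 ≤ n then {0} else Finset.range 5

lemma card_extremalWords_le (n : ℕ) : (extremalWords n).card ≤ 625 := by
  have h : (Finset.univ.filter fun i : Fin n => ¬ (2 ≤ (i : ℕ) ∧ (i : ℕ) + 3 ≤ n)).card ≤ 4 := by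
    refine (Finset.card_le_card_of_injOn (t := {0, 1, n - 2, n - 1}) (fun i : Fin n => (i : ℕ)) ?_
      Fin.val_injective.injOn).trans Finset.card_le_four
    intro i hi
    have h1 := (Finset.mem_filter.mp hi).2
    have h2 := i.2
    simp only [Finset.coe_insert, Finset.coe_singleton, mem_insert_iff, mem_singleton_iff]
    omega
  calc (extremalWords n).card
      = ∏ i : Fin n, (if 2 ≤ (i : ℕ) ∧ (i : ℕ) + 3 ≤ n then 1 else 5) := by
        rw [extremalWords, Fintype.card_piFinset]
        exact Finset.prod_congr rfl fun i _ => by split_ifs <;> simp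
    _ = 5 ^ (Finset.univ.filter fun i : Fin n => ¬ (2 ≤ (i : ℕ) ∧ (i : ℕ) + 3 ≤ n)).card := by
        rw [Finset.prod_ite, Finset.prod_const_one, one_mul, Finset.prod_const]
    _ ≤ 5 ^ 4 := Nat.pow_le_pow_right (by norm_num) h

lemma mem_extremalWords {n : ℕ} {w : Fin n → ℕ} (h : den (List.ofFn w) 0 ≤ goldenRatio ^ n) :
    w ∈ extremalWords n := by
  rw [extremalWords, Fintype.mem_piFinset]
  intro i
  have hlen : (i : ℕ) < (List.ofFn w).length := by simp
  have hsplit : List.ofFn w = (List.ofFn w).take i ++ w i :: (List.ofFn w).drop (i + 1) := by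
    have h1 : w i = (List.ofFn w)[(i : ℕ)] := by simp
    rw [h1, List.getElem_cons_drop, List.take_append_drop]
  have hu : ((List.ofFn w).take i).length = i := by simp
  have hv : ((List.ofFn w).drop (i + 1)).length = n - (i + 1) := by simp
  have hn : ((List.ofFn w).take i).length + ((List.ofFn w).drop (i + 1)).length + 1 = n := by
    have := i.2
    omega
  have h' : den ((List.ofFn w).take i ++ w i :: (List.ofFn w).drop (i + 1)) 0 ≤ goldenRatio ^
      (((List.ofFn w).take i).length + ((List.ofFn w).drop (i + 1)).length + 1) := by
    rwa [← hsplit, hn]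
  split_ifs with hi
  · exact Finset.mem_singleton.mpr (letter_eq_zero (by omega) (by omega) h')
  · exact Finset.mem_range.mpr (letter_lt_five h')

lemma volume_cyl_le_exp {n : ℕ} (w : Fin n → ℕ) :
    volume (cyl (List.ofFn w)) ≤ ENNReal.ofReal (4 * exp (-(n * minExp))) := by
  refine (volume_cyl_le _).trans (ENNReal.ofReal_le_ofReal ?_)
  have h1 : goldenRatio ^ n ≤ 2 * den (List.ofFn w) 0 := by
    have h := (fib_le_den (List.ofFn w)).1
    rw [List.length_ofFn] at h
    have h0 : (0 : ℝ) ≤ Nat.fib (n + 1) := Nat.cast_nonneg _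
    nlinarith [goldenRatio_pow_le n, goldenRatio_lt_two]
  have h2 : exp (-(n * minExp)) = ((goldenRatio ^ n) ^ 2)⁻¹ := by
    rw [exp_neg, ← pow_mul, mul_comm n 2, minExp,
      show n * (2 * log goldenRatio) = (2 * n : ℕ) * log goldenRatio by push_cast; ring,
      exp_nat_mul, exp_log goldenRatio_pos]
  have hg : 0 < goldenRatio ^ n := pow_pos goldenRatio_pos n
  have hd := den_pos (List.ofFn w) (le_refl (0 : ℝ))
  rw [h2, ← div_eq_mul_inv, le_div_iff₀ (by positivity), inv_mul_le_iff₀ (by positivity)]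
  nlinarith [mul_le_mul h1 h1 hg.le (by positivity)]

/-- The lower tail bound for slopes below the minimal Lyapunov exponent. -/
lemma volume_lg_le_of_le_minExp {α : ℝ} (hα : α ≤ minExp) (n : ℕ) :
    volume {x : ℝ | IrrUnit x ∧ lg (letters n x) 0 ≤ α * n} ≤
      ENNReal.ofReal (2500 * exp (-(α * n))) := by
  have hn : (0 : ℝ) ≤ n := n.cast_nonneg
  calc volume {x : ℝ | IrrUnit x ∧ lg (letters n x) 0 ≤ α * n}
      ≤ volume (⋃ w ∈ extremalWords n, cyl (List.ofFn w)) := by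
        refine measure_mono fun x hx => ?_
        obtain ⟨w, hw⟩ := exists_ofFn_letters n x
        have hx2 := hx.2
        rw [hw, lg] at hx2
        refine mem_iUnion₂.mpr ⟨w, mem_extremalWords ?_, hx.1, by rw [List.length_ofFn, hw]⟩
        rw [← log_le_log_iff (den_pos _ le_rfl) (pow_pos goldenRatio_pos n), log_pow]
        rw [minExp] at hα
        nlinarith
    _ ≤ ∑ w ∈ extremalWords n, volume (cyl (List.ofFn w)) := measure_biUnion_finset_le _ _
    _ ≤ (extremalWords n).card • ENNReal.ofReal (4 * exp (-(n * minExp))) :=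
        Finset.sum_le_card_nsmul _ _ _ fun w _ => volume_cyl_le_exp w
    _ = ENNReal.ofReal ((extremalWords n).card * (4 * exp (-(n * minExp)))) := by
        rw [nsmul_eq_mul, ENNReal.ofReal_mul (Nat.cast_nonneg _), ENNReal.ofReal_natCast]
    _ ≤ _ := by
        refine ENNReal.ofReal_le_ofReal ?_
        have h1 : ((extremalWords n).card : ℝ) ≤ 625 := by exact_mod_cast card_extremalWords_le n
        have h2 : exp (-(n * minExp)) ≤ exp (-(α * n)) := exp_le_exp.mpr (by nlinarith)
        nlinarith [exp_pos (-(n * minExp))]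

end ContFrac

/-- Main Theorem, lower tail: for every `n ≥ 1` with `α_min < 2γ - 16/n` and every
`α ∈ (α_min, 2γ - 16/n)`, the Lebesgue measure of the set of irrational `x ∈ (0,1)` with
`(2/n) log q_n(x) ≤ α` is at most `C_α e^{-I(α) n}` with `C_α = e^{16(|I'(α)|+1)}`. -/
theorem main_lower_tail (n : ℕ) (hn : 1 ≤ n)
    (hn' : alphaMin < 2 * levyConst - 16 / (n : ℝ)) (α : ℝ)
    (hα₁ : alphaMin < α) (hα₂ : α < 2 * levyConst - 16 / (n : ℝ)) :
    volume {x : ℝ | x ∈ Set.Ioo (0 : ℝ) 1 ∧ Irrational x ∧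
        2 / (n : ℝ) * Real.log (qDen n x) ≤ α} ≤
      ENNReal.ofReal
        (Real.exp (16 * (|deriv rateI α| + 1)) * Real.exp (-(rateI α) * (n : ℝ))) := by
  have hn0 : (0 : ℝ) < n := by exact_mod_cast hn
  have hset : {x : ℝ | x ∈ Ioo (0 : ℝ) 1 ∧ Irrational x ∧
      2 / (n : ℝ) * Real.log (qDen n x) ≤ α} =
      {x : ℝ | ContFrac.IrrUnit x ∧ ContFrac.lg (ContFrac.letters n x) 0 ≤ α * n} := by
    ext x
    simp only [mem_ofPred_eq, ContFrac.IrrUnit, and_assoc]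
    refine and_congr_right fun h1 => and_congr_right fun h2 => ?_
    rw [ContFrac.two_div_mul_log_qDen ⟨h1, h2⟩, div_le_iff₀ hn0]
  rw [hset, ← Real.exp_add]
  rcases lt_or_ge ContFrac.minExp α with h | h
  · obtain ⟨s, hs, hmin⟩ := ContFrac.exists_minimizer h
    have hα : α < 2 * levyConst := hα₂.trans_le (sub_le_self _ (by positivity))
    have hs1 := ContFrac.one_le_minimizer hα hs hmin
    refine (ContFrac.volume_lg_le h hs1 hmin n).trans
      (ENNReal.ofReal_le_ofReal (Real.exp_le_exp.mpr ?_))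
    rw [ContFrac.deriv_rateI h hs hmin, abs_of_nonpos (by linarith)]
    nlinarith [Real.log_two_lt_d9]
  · refine (ContFrac.volume_lg_le_of_le_minExp h n).trans (ENNReal.ofReal_le_ofReal ?_)
    have hα0 : 0 < α := lt_of_le_of_lt (Real.log_nonneg (by
      linarith [Real.one_le_sqrt.mpr (by norm_num : (1 : ℝ) ≤ 5)])) hα₁
    have hrate : rateI α ≤ α := mul_le_of_le_one_right hα0.le
      (sub_le_self _ ENNReal.toReal_nonneg)
    have h16 : (2500 : ℝ) ≤ Real.exp 16 := by
      have h1 : Real.exp 16 = Real.exp 1 ^ 16 := by rw [← Real.exp_nat_mul]; norm_num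
      have h2 : (2 : ℝ) ≤ Real.exp 1 := by linarith [Real.add_one_le_exp (1 : ℝ)]
      rw [h1]
      exact le_trans (by norm_num) (pow_le_pow_left₀ zero_le_two h2 16)
    calc 2500 * Real.exp (-(α * n)) ≤ Real.exp 16 * Real.exp (-(α * n)) := by gcongr
      _ = Real.exp (16 + -(α * n)) := (Real.exp_add _ _).symm
      _ ≤ _ := by
        refine Real.exp_le_exp.mpr ?_
        nlinarith [abs_nonneg (deriv rateI α), mul_le_mul_of_nonneg_right hrate hn0.le]
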